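/- arXiv:2602.12219 — 3 statements merged into one kernel-verified Lean document; each statement's English description precedes it below -/
import Mathlib

section
/- Let R be a finite chain ring of length m with maximal ideal N and residue field of order q. Let λ = (λ₁ ≥ … ≥ λ_n ≥ 0) with λ₁ ≤ m, and let M = R/N^{λ₁} ⊕ … ⊕ R/N^{λ_n}. For every sequence μ = (μ₁ ≥ … ≥ μ_n ≥ 0) with μ_i ≤ λ_i for all i, the number of submodules of M isomorphic to R/N^{μ₁} ⊕ … ⊕ R/N^{μ_n} equals ∏_{i=1}^{m} q^{μ'_{i+1}(λ'_i − μ'_i)} · [λ'_i − μ'_{i+1} choose μ'_i − μ'_{i+1}]_q, where λ'_i = #{ j : λ_j ≥ i }, μ'_i = #{ j : μ_j ≥ i }, and μ'_{m+1} = 0. -/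
/-- Powers of a (left) ideal of a possibly noncommutative ring:
`idealPow N 0 = ⊤` and `idealPow N (i+1) = (idealPow N i) * N`
(the left ideal generated by the products `a * b` with `a ∈ N^i`, `b ∈ N`). -/
def idealPow {R : Type*} [Ring R] (N : Ideal R) : ℕ → Ideal R
  | 0 => ⊤
  | i + 1 => Submodule.span R {x | ∃ a ∈ idealPow N i, ∃ b ∈ N, x = a * b}

/-- The Gaussian binomial coefficient
`[n choose k]_q = ∏_{i=0}^{k-1} (q^{n-i} - 1) / (q^{k-i} - 1)`
(the quotient of the two integer products; it is an exact division). -/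
def gaussBinom (q n k : ℕ) : ℕ :=
  (∏ i ∈ Finset.range k, (q ^ (n - i) - 1)) / ∏ i ∈ Finset.range k, (q ^ (k - i) - 1)

/-- The dual (conjugate) shape: `dualShape λ i = #{ j : λ j ≥ i }`. -/
def dualShape {n : ℕ} (lam : Fin n → ℕ) (i : ℕ) : ℕ :=
  (Finset.univ.filter fun j : Fin n => i ≤ lam j).card

set_option linter.unusedSectionVars false
section ringfacts
variable {R : Type*} [Ring R] [Finite R]

theorem cs_left_inv (hchain : ∀ I J : Ideal R, I ≤ J ∨ J ≤ I) (N : Ideal R) (hN : N.IsMaximal)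
    (a : R) (ha : a ∉ N) : ∃ s, s * a = 1 := by
  have h : Ideal.span {a} = ⊤ := by
    rcases hchain (Ideal.span {a}) N with h | h
    · exact absurd (h (Ideal.subset_span rfl)) ha
    · by_contra hne
      have := hN.eq_of_le hne h
      apply ha
      rw [this]
      exact Ideal.subset_span rfl
  have h1 : (1 : R) ∈ Ideal.span {a} := h ▸ Submodule.mem_top
  exact Ideal.mem_span_singleton'.1 h1

theorem cs_two_sided (hchain : ∀ I J : Ideal R, I ≤ J ∨ J ≤ I) (N : Ideal R) (hN : N.IsMaximal)
    (a r : R) (ha : a ∈ N) : a * r ∈ N := by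
  by_contra h
  obtain ⟨s, hs⟩ := cs_left_inv hchain N hN _ h
  rw [← mul_assoc] at hs
  have h2 : r * (s * a) = 1 := mul_eq_one_comm.1 hs
  apply hN.ne_top
  rw [Ideal.eq_top_iff_one, ← h2, ← mul_assoc]
  exact N.mul_mem_left _ ha

theorem cs_exists_gen (hchain : ∀ I J : Ideal R, I ≤ J ∨ J ≤ I) (N : Ideal R) :
    ∃ t, N = Ideal.span {t} := by
  have : Nonempty N := ⟨0⟩
  obtain ⟨t, ht⟩ := Finite.exists_max (fun x : N => Nat.card (Ideal.span {(x : R)} : Ideal R))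
  refine ⟨t, le_antisymm ?_ ?_⟩
  · intro y hy
    rcases hchain (Ideal.span {y}) (Ideal.span {(t : R)}) with h | h
    · exact h (Ideal.subset_span rfl)
    · have h3 := ht ⟨y, hy⟩
      have : (Ideal.span {(t : R)} : Set R) = (Ideal.span {y} : Set R) := by
        apply Set.eq_of_subset_of_ncard_le h h3
      have h4 : y ∈ (Ideal.span {y} : Set R) := Ideal.subset_span rfl
      rw [← this] at h4
      exact h4
  · rw [Ideal.span_le]
    simp

/-- Structure facts of a finite chain ring, packaged. -/
structure CSData (N : Ideal R) (t : R) (m : ℕ) : Prop where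
  pow_eq : ∀ k, idealPow N k = Ideal.span {t ^ k}
  comm : ∀ (k : ℕ) (s : R), ∃ s', t ^ k * s = s' * t ^ k
  inv : ∀ a, a ∉ N → ∃ s, s * a = 1
  r3 : ∀ k r, r ∉ idealPow N (k + 1) → ∃ s, s * r = t ^ k
  r4 : ∀ k, k < m → t ^ k ∉ idealPow N (k + 1)

theorem cs_data (hchain : ∀ I J : Ideal R, I ≤ J ∨ J ≤ I) (N : Ideal R) (hN : N.IsMaximal)
    (m : ℕ) (hnil : idealPow N m = ⊥) (hnil' : idealPow N (m - 1) ≠ ⊥) :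
    ∃ t, CSData N t m := by
  obtain ⟨t, ht⟩ := cs_exists_gen hchain N
  have comm1 : ∀ s, ∃ s', t * s = s' * t := by
    intro s
    have : t * s ∈ N := cs_two_sided hchain N hN _ _ (ht ▸ Ideal.subset_span rfl)
    rw [ht] at this
    obtain ⟨a, h⟩ := Ideal.mem_span_singleton'.1 this
    exact ⟨a, h.symm⟩
  have comm : ∀ (k : ℕ) (s : R), ∃ s', t ^ k * s = s' * t ^ k := by
    intro k
    induction k with
    | zero => intro s; exact ⟨s, by simp⟩
    | succ k ih =>
      intro s
      obtain ⟨s1, h1⟩ := comm1 s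
      obtain ⟨s2, h2⟩ := ih s1
      exact ⟨s2, by rw [pow_succ, mul_assoc, h1, ← mul_assoc, h2, mul_assoc]⟩
  have pow_eq : ∀ k, idealPow N k = Ideal.span {t ^ k} := by
    intro k
    induction k with
    | zero => simp [idealPow]
    | succ k ih =>
      apply le_antisymm
      · rw [idealPow]
        apply Submodule.span_le.2
        rintro _ ⟨a, ha, b, hb, rfl⟩
        rw [ih] at ha
        rw [ht] at hb
        obtain ⟨a, rfl⟩ := Ideal.mem_span_singleton'.1 ha
        obtain ⟨b, rfl⟩ := Ideal.mem_span_singleton'.1 hb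
        obtain ⟨c, hc⟩ := comm k b
        refine Ideal.mem_span_singleton'.2 ⟨a * c, ?_⟩
        rw [pow_succ, mul_assoc a c, ← mul_assoc c, ← hc]
        simp only [mul_assoc]
      · rw [Ideal.span_le, Set.singleton_subset_iff, idealPow]
        apply Submodule.subset_span
        exact ⟨t ^ k, ih ▸ Ideal.subset_span rfl, t, ht ▸ Ideal.subset_span rfl, pow_succ _ _⟩
  have inv := cs_left_inv hchain N hN
  refine ⟨t, pow_eq, comm, inv, ?_, ?_⟩
  · intro k r hr
    rcases hchain (Ideal.span {r}) (idealPow N k) with h | h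
    · have h1 : r ∈ idealPow N k := h (Ideal.subset_span rfl)
      rw [pow_eq] at h1
      obtain ⟨a, rfl⟩ := Ideal.mem_span_singleton'.1 h1
      have ha : a ∉ N := by
        intro ha
        apply hr
        rw [ht] at ha
        obtain ⟨b, rfl⟩ := Ideal.mem_span_singleton'.1 ha
        rw [pow_eq]
        exact Ideal.mem_span_singleton'.2 ⟨b, by rw [pow_succ', mul_assoc]⟩
      obtain ⟨s, hs⟩ := inv a ha
      exact ⟨s, by rw [← mul_assoc, hs, one_mul]⟩
    · have h1 : t ^ k ∈ idealPow N k := pow_eq k ▸ Ideal.subset_span rfl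
      exact Ideal.mem_span_singleton'.1 (h h1)
  · intro k hk h
    have key : ∀ j, t ^ (k + j) ∈ idealPow N (k + j + 1) := by
      intro j
      induction j with
      | zero => simpa using h
      | succ j ih =>
        rw [pow_eq] at ih ⊢
        obtain ⟨a, ha⟩ := Ideal.mem_span_singleton'.1 ih
        refine Ideal.mem_span_singleton'.2 ⟨a, ?_⟩
        rw [show k + (j + 1) + 1 = (k + j + 1) + 1 from rfl, pow_succ, ← mul_assoc, ha,
          ← pow_succ]
        rfl
    apply hnil'
    have h2 := key (m - 1 - k)
    rw [show k + (m - 1 - k) = m - 1 by omega, show m - 1 + 1 = m by omega, hnil] at h2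
    rw [pow_eq, Ideal.span_singleton_eq_bot]
    simpa using h2

theorem CSData.mem_iff {N : Ideal R} {t : R} {m : ℕ} (h : CSData N t m) (k l : ℕ)
    (hkl : l + k ≤ m) (x : R) : t ^ k * x ∈ idealPow N (l + k) ↔ x ∈ idealPow N l := by
  constructor
  · intro hx
    by_contra hx'
    rcases l with _ | l
    · exact hx' (by simp [idealPow])
    obtain ⟨s, hs⟩ := h.r3 l x hx'
    obtain ⟨s', hs'⟩ := h.comm k s
    apply h.r4 (k + l) (by omega)
    rw [pow_add, ← hs, ← mul_assoc, hs', mul_assoc]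
    apply Ideal.mul_mem_left
    convert hx using 2
    omega
  · intro hx
    rw [h.pow_eq] at hx ⊢
    obtain ⟨a, rfl⟩ := Ideal.mem_span_singleton'.1 hx
    obtain ⟨s', hs'⟩ := h.comm k a
    refine Ideal.mem_span_singleton'.2 ⟨s', ?_⟩
    rw [← mul_assoc, hs', mul_assoc, ← pow_add, add_comm]

theorem CSData.mem_of_le {N : Ideal R} {t : R} {m : ℕ} (h : CSData N t m) (k l : ℕ)
    (hkl : l ≤ k) (x : R) : t ^ k * x ∈ idealPow N l := by
  rw [h.pow_eq]
  obtain ⟨s', hs'⟩ := h.comm k x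
  refine Ideal.mem_span_singleton'.2 ⟨s' * t ^ (k - l), ?_⟩
  rw [hs', mul_assoc, ← pow_add]
  congr 2
  omega

theorem CSData.antitone {N : Ideal R} {t : R} {m : ℕ} (h : CSData N t m) {k l : ℕ}
    (hkl : l ≤ k) : idealPow N k ≤ idealPow N l := by
  rw [h.pow_eq k, Ideal.span_le, Set.singleton_subset_iff]
  simpa using h.mem_of_le k l hkl 1

theorem CSData.card_quot {N : Ideal R} {t : R} {m : ℕ} (h : CSData N t m) (k : ℕ)
    (hk : k ≤ m) : Nat.card (R ⧸ idealPow N k) = Nat.card (R ⧸ N) ^ k := by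
  induction k with
  | zero =>
    rw [pow_zero, Nat.card_eq_one_iff_unique]
    have : idealPow N 0 = ⊤ := rfl
    rw [this]
    exact ⟨inferInstance, inferInstance⟩
  | succ k ih =>
    have hle : idealPow N (k + 1) ≤ idealPow N k := h.antitone (by omega)
    let S : Submodule R (R ⧸ idealPow N (k + 1)) :=
      Submodule.map (Submodule.mkQ (idealPow N (k + 1))) (idealPow N k)
    have e1 := Submodule.quotientQuotientEquivQuotient _ _ hle
    rw [Submodule.card_eq_card_quotient_mul_card S, Nat.card_congr e1.toEquiv, ih (by omega),
      pow_succ']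
    congr 1
    let φ : R →ₗ[R] (R ⧸ idealPow N (k + 1)) :=
      LinearMap.toSpanSingleton R _ (Submodule.Quotient.mk (t ^ k))
    have hr : φ.range = S := by
      rw [LinearMap.range_toSpanSingleton]
      simp only [S]
      rw [h.pow_eq k, Ideal.span, Submodule.map_span]
      simp
    have hφ : ∀ x, φ x = Submodule.Quotient.mk (x * t ^ k) := fun x => by
      simp only [φ, LinearMap.toSpanSingleton_apply]
      rfl
    have hker : φ.ker = N := by
      ext x
      rw [LinearMap.mem_ker, hφ, Submodule.Quotient.mk_eq_zero]
      constructor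
      · intro hx
        by_contra hx'
        obtain ⟨s, hs⟩ := h.inv x hx'
        apply h.r4 k (by omega)
        have := (idealPow N (k + 1)).mul_mem_left s hx
        rwa [← mul_assoc, hs, one_mul] at this
      · intro hx
        have hN : N = idealPow N 1 := by
          rw [idealPow, idealPow]
          apply le_antisymm
          · intro y hy
            exact Submodule.subset_span ⟨1, trivial, y, hy, by simp⟩
          · apply Submodule.span_le.2
            rintro _ ⟨a, _, b, hb, rfl⟩
            exact N.mul_mem_left _ hb
        rw [hN, h.pow_eq] at hx
        obtain ⟨b, rfl⟩ := Ideal.mem_span_singleton'.1 hx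
        rw [h.pow_eq]
        exact Ideal.mem_span_singleton'.2 ⟨b, by rw [pow_succ', pow_one, mul_assoc]⟩
    rw [← hr, ← Nat.card_congr φ.quotKerEquivRange.toEquiv, hker]

/-- elements killed by `s` -/
def killed (s : R) (M : Type*) [AddCommGroup M] [Module R M] : AddSubgroup M :=
  (DistribSMul.toAddMonoidHom M s).ker

theorem mem_killed {s : R} {M : Type*} [AddCommGroup M] [Module R M] {x : M} :
    x ∈ killed s M ↔ s • x = 0 := Iff.rfl

theorem CSData.card_killed {N : Ideal R} {t : R} {m : ℕ} (h : CSData N t m) (k l : ℕ)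
    (hl : l ≤ m) : Nat.card (killed (t ^ k) (R ⧸ idealPow N l)) = Nat.card (R ⧸ N) ^ (min k l) := by
  rcases le_total l k with hlk | hlk
  · rw [min_eq_right hlk, ← h.card_quot l hl]
    have : killed (t ^ k) (R ⧸ idealPow N l) = ⊤ := by
      rw [eq_top_iff]
      rintro x -
      obtain ⟨x, rfl⟩ := Submodule.Quotient.mk_surjective _ x
      rw [mem_killed, ← Submodule.Quotient.mk_smul, Submodule.Quotient.mk_eq_zero]
      exact h.mem_of_le k l hlk x
    rw [this]
    exact Nat.card_congr (Equiv.Set.univ _)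
  · rw [min_eq_left hlk]
    have hle : idealPow N l ≤ idealPow N (l - k) := h.antitone (by omega)
    let S : Submodule R (R ⧸ idealPow N l) :=
      Submodule.map (Submodule.mkQ (idealPow N l)) (idealPow N (l - k))
    have e1 := Submodule.quotientQuotientEquivQuotient _ _ hle
    have h1 := Submodule.card_eq_card_quotient_mul_card S
    rw [Nat.card_congr e1.toEquiv, h.card_quot _ hl, h.card_quot _ (by omega)] at h1
    have hS : (killed (t ^ k) (R ⧸ idealPow N l) : Set (R ⧸ idealPow N l)) = S := by
      ext x
      obtain ⟨x, rfl⟩ := Submodule.Quotient.mk_surjective _ x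
      have := h.mem_iff k (l - k) (by omega) x
      rw [show l - k + k = l by omega] at this
      rw [SetLike.mem_coe, mem_killed, ← Submodule.Quotient.mk_smul,
        Submodule.Quotient.mk_eq_zero, smul_eq_mul, this]
      simp only [S, SetLike.mem_coe]
      rw [← Submodule.mkQ_apply, ← Submodule.mem_comap, Submodule.comap_map_mkQ,
        sup_eq_right.2 hle]
    have h2 : Nat.card (killed (t ^ k) (R ⧸ idealPow N l)) = Nat.card S :=
      Nat.card_congr (Equiv.setCongr hS)
    rw [h2]
    have hpos : 0 < Nat.card (R ⧸ N) := by
      have : Finite (R ⧸ N) := Quotient.finite _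
      exact Nat.card_pos
    have h3 : Nat.card (R ⧸ N) ^ l = Nat.card (R ⧸ N) ^ k * Nat.card (R ⧸ N) ^ (l - k) := by
      rw [← pow_add]; congr 1; omega
    rw [h3] at h1
    exact (Nat.eq_of_mul_eq_mul_right (pow_pos hpos (l - k)) h1).symm

theorem CSData.card_killed_pi {N : Ideal R} {t : R} {m : ℕ} (h : CSData N t m) (k : ℕ) {n : ℕ}
    (lam : Fin n → ℕ)
    (hl : ∀ i, lam i ≤ m) : Nat.card (killed (t ^ k) (∀ i, R ⧸ idealPow N (lam i))) =
      Nat.card (R ⧸ N) ^ (∑ i, min k (lam i)) := by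
  rw [← Finset.prod_pow_eq_pow_sum]
  simp_rw [← fun i => h.card_killed k (lam i) (hl i)]
  rw [← Nat.card_pi]
  apply Nat.card_congr
  exact
    { toFun := fun x i => ⟨x.1 i, by
        have := x.2
        rw [mem_killed] at this ⊢
        exact congrFun this i⟩
      invFun := fun x => ⟨fun i => (x i).1, by
        rw [mem_killed]
        funext i
        exact (x i).2⟩
      left_inv := fun x => rfl
      right_inv := fun x => rfl }
end ringfacts
section counting
variable {R : Type*} [Ring R] [Finite R]

/-- injective linear maps -/
abbrev InjMap (R : Type*) [Ring R] (P M : Type*) [AddCommGroup P] [AddCommGroup M]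
    [Module R P] [Module R M] : Type _ := {f : P →ₗ[R] M // Function.Injective f}

theorem finite_linearMap (P M : Type*) [AddCommGroup P] [AddCommGroup M]
    [Module R P] [Module R M] [Finite P] [Finite M] : Finite (P →ₗ[R] M) :=
  Finite.of_injective (fun f => (f : P → M)) DFunLike.coe_injective

theorem fiber_count {t : R} (k : ℕ) {P M : Type*} [AddCommGroup P] [AddCommGroup M]
    [Module R P] [Module R M] [Finite P] [Finite M]
    (hP : ∀ p : P, t • p = 0 → ∃ p', t ^ k • p' = p) (f : P →ₗ[R] M)
    (hf : Function.Injective f) :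
    Nat.card {x : M // t ^ (k + 1) • x = 0 ∧ t ^ k • x ∉ LinearMap.range f} =
      Nat.card (killed (t ^ (k + 1)) M) - Nat.card (killed t P) * Nat.card (killed (t ^ k) M) := by
  let S : Set M := {x | t ^ (k + 1) • x = 0}
  let B : Set M := {x | t ^ (k + 1) • x = 0 ∧ t ^ k • x ∈ LinearMap.range f}
  have hBS : B ⊆ S := fun x hx => hx.1
  have h1 : Nat.card {x : M // t ^ (k + 1) • x = 0 ∧ t ^ k • x ∉ LinearMap.range f}
      = (S \ B).ncard := by
    rw [← Nat.card_coe_set_eq]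
    apply Nat.card_congr
    apply Equiv.subtypeEquivRight
    intro x
    simp only [S, B, Set.mem_sdiff, Set.mem_ofPred_eq]
    tauto
  rw [h1, Set.ncard_sdiff hBS]
  congr 1
  rw [← Nat.card_prod, ← Nat.card_coe_set_eq]
  have hσ : ∀ p : killed t P, ∃ x : M, t ^ k • x = f p := by
    rintro ⟨p, hp⟩
    obtain ⟨p', hp'⟩ := hP p hp
    exact ⟨f p', by rw [← map_smul, hp']⟩
  choose σ hσ using hσ
  symm
  have hmem : ∀ z : killed t P × killed (t ^ k) M, t ^ k • (σ z.1 + z.2) = f z.1 := by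
    rintro ⟨p, y⟩
    have : t ^ k • (y : M) = 0 := y.2
    rw [smul_add, hσ, this, add_zero]
  refine Nat.card_eq_of_bijective
    (fun z : killed t P × killed (t ^ k) M => (⟨σ z.1 + z.2, ?_, ?_⟩ : B)) ⟨?_, ?_⟩
  · rw [pow_succ', mul_smul, hmem, ← map_smul]
    have : t • (z.1 : P) = 0 := z.1.2
    rw [this, map_zero]
  · exact ⟨_, (hmem z).symm⟩
  · intro z w hzw
    have h2 : σ z.1 + z.2 = σ w.1 + w.2 := congrArg Subtype.val hzw
    have h3 : f z.1 = f w.1 := by rw [← hmem, ← hmem, h2]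
    have h4 : z.1 = w.1 := Subtype.ext (hf h3)
    rw [h4] at h2
    exact Prod.ext h4 (Subtype.ext (add_left_cancel h2))
  · rintro ⟨x, hx, p, hp⟩
    have hp0 : t • p = 0 := by
      apply hf
      rw [map_smul, hp, map_zero, ← mul_smul, ← pow_succ', hx]
    refine ⟨⟨⟨p, hp0⟩, ⟨x - σ ⟨p, hp0⟩, ?_⟩⟩, ?_⟩
    · rw [mem_killed, smul_sub, hσ, ← hp, sub_self]
    · apply Subtype.ext
      simp

theorem CSData.inj_iff {N : Ideal R} {t : R} {m : ℕ} (h : CSData N t m) (k : ℕ) (hk : k < m)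
    {P M : Type*} [AddCommGroup P] [AddCommGroup M]
    [Module R P] [Module R M] (f : P × (R ⧸ idealPow N (k + 1)) →ₗ[R] M) :
    Function.Injective f ↔ Function.Injective (f.comp (LinearMap.inl R _ _)) ∧
      t ^ k • f (0, Submodule.Quotient.mk 1) ∉ LinearMap.range (f.comp (LinearMap.inl R _ _)) := by
  constructor
  · intro hf
    refine ⟨hf.comp LinearMap.inl_injective, ?_⟩
    rintro ⟨p, hp⟩
    rw [LinearMap.comp_apply, ← map_smul] at hp
    have h1 := congrArg Prod.snd (hf hp)
    simp only [LinearMap.inl_apply, Prod.smul_snd] at h1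
    rw [← Submodule.Quotient.mk_smul, eq_comm, Submodule.Quotient.mk_eq_zero, smul_eq_mul,
      mul_one] at h1
    exact h.r4 k hk h1
  · rintro ⟨h1, h2⟩
    rw [← LinearMap.ker_eq_bot, eq_bot_iff]
    rintro ⟨p, r⟩ hpr
    obtain ⟨r, rfl⟩ := Submodule.Quotient.mk_surjective _ r
    rw [LinearMap.mem_ker] at hpr
    have e : f (p, Submodule.Quotient.mk r) = f (p, 0) + r • f (0, Submodule.Quotient.mk 1) := by
      rw [← map_smul, ← map_add]
      congr 1
      rw [Prod.smul_mk, ← Submodule.Quotient.mk_smul]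
      simp
    rw [e] at hpr
    by_cases hr : r ∈ idealPow N (k + 1)
    · have hr0 : (Submodule.Quotient.mk r : R ⧸ idealPow N (k + 1)) = 0 :=
        (Submodule.Quotient.mk_eq_zero _).2 hr
      have h3 : r • f (0, (Submodule.Quotient.mk 1 : R ⧸ idealPow N (k + 1))) = 0 := by
        rw [← map_smul, Prod.smul_mk, ← Submodule.Quotient.mk_smul, smul_eq_mul, mul_one, hr0,
          smul_zero]
        exact map_zero f
      rw [h3, add_zero] at hpr
      have hp : p = 0 := by
        apply h1
        rw [map_zero]
        exact hpr
      rw [hp, hr0]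
      exact Submodule.zero_mem _
    · exfalso
      obtain ⟨s, hs⟩ := h.r3 k r hr
      apply h2
      refine ⟨-(s • p), ?_⟩
      rw [map_neg, map_smul, ← hs, mul_smul, neg_eq_iff_add_eq_zero, ← smul_add]
      exact (congrArg (s • ·) hpr).trans (smul_zero s)

theorem sig_ext {A B : Type*} {Q : A → B → Prop} (z w : Σ f : A, {x : B // Q f x})
    (h1 : z.1 = w.1) (h2 : z.2.1 = w.2.1) : z = w := by
  rcases z with ⟨a, x, hx⟩
  rcases w with ⟨b, y, hy⟩
  dsimp only at h1 h2
  subst h1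
  subst h2
  rfl

theorem CSData.step {N : Ideal R} {t : R} {m : ℕ} (h : CSData N t m) (k : ℕ) (hk : k < m)
    {P M : Type*} [AddCommGroup P] [AddCommGroup M]
    [Module R P] [Module R M] [Finite P] [Finite M]
    (hP : ∀ p : P, t • p = 0 → ∃ p', t ^ k • p' = p) :
    Nat.card (InjMap R (P × (R ⧸ idealPow N (k + 1))) M) = Nat.card (InjMap R P M) *
      (Nat.card (killed (t ^ (k + 1)) M) - Nat.card (killed t P) * Nat.card (killed (t ^ k) M)) := by
  have hfin := finite_linearMap (R := R) P M
  have hone : ∀ x : M, t ^ (k + 1) • x = 0 →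
      idealPow N (k + 1) ≤ LinearMap.ker (LinearMap.toSpanSingleton R M x) := by
    intro x hx
    rw [h.pow_eq, Ideal.span_le, Set.singleton_subset_iff]
    exact hx
  let E : InjMap R (P × (R ⧸ idealPow N (k + 1))) M ≃
      Σ f : InjMap R P M, {x : M // t ^ (k + 1) • x = 0 ∧ t ^ k • x ∉ LinearMap.range f.1} :=
    { toFun := fun f => ⟨⟨f.1.comp (LinearMap.inl R _ _), ((h.inj_iff k hk f.1).1 f.2).1⟩,
        ⟨f.1 (0, Submodule.Quotient.mk 1), by
          refine ⟨?_, ((h.inj_iff k hk f.1).1 f.2).2⟩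
          have : (Submodule.Quotient.mk (t ^ (k + 1)) : R ⧸ idealPow N (k + 1)) = 0 := by
            rw [Submodule.Quotient.mk_eq_zero, h.pow_eq]
            exact Ideal.subset_span rfl
          rw [← map_smul, Prod.smul_mk, ← Submodule.Quotient.mk_smul, smul_eq_mul, mul_one,
            this, smul_zero]
          exact map_zero f.1⟩⟩
      invFun := fun z => ⟨z.1.1.coprod
          ((idealPow N (k + 1)).liftQ (LinearMap.toSpanSingleton R M z.2.1) (hone _ z.2.2.1)), by
        rw [h.inj_iff k hk]
        have e1 : (z.1.1.coprod ((idealPow N (k + 1)).liftQ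
          (LinearMap.toSpanSingleton R M z.2.1) (hone _ z.2.2.1))).comp (LinearMap.inl R _ _) = z.1.1 := by
          simp
        rw [e1]
        refine ⟨z.1.2, ?_⟩
        convert z.2.2.2 using 2
        simp⟩
      left_inv := fun f => by
        apply Subtype.ext
        apply LinearMap.prod_ext
        · simp
        · apply Submodule.linearMap_qext
          ext
          simp
      right_inv := fun z => by
        rcases z with ⟨⟨f, hf⟩, x, hx⟩
        have e1 : (f.coprod ((idealPow N (k + 1)).liftQ
          (LinearMap.toSpanSingleton R M x) (hone _ hx.1))).comp (LinearMap.inl R _ _) = f := by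
          simp
        have e2 : (f.coprod ((idealPow N (k + 1)).liftQ
          (LinearMap.toSpanSingleton R M x) (hone _ hx.1))) (0, Submodule.Quotient.mk 1) = x := by
          simp
        exact sig_ext _ _ (Subtype.ext e1) e2 }
  have := Fintype.ofFinite (InjMap R P M)
  rw [Nat.card_congr E, Nat.card_sigma]
  rw [Finset.sum_congr rfl (fun f _ => fiber_count k hP f.1 f.2)]
  simp

theorem CSData.socle {N : Ideal R} {t : R} {m : ℕ} (h : CSData N t m) (k : ℕ) {n : ℕ}
    (mu : Fin n → ℕ) (hle : ∀ i, mu i ≤ m) (hge : ∀ i, k + 1 ≤ mu i)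
    (p : ∀ i, R ⧸ idealPow N (mu i)) (hp : t • p = 0) : ∃ p', t ^ k • p' = p := by
  let P := ∀ i, R ⧸ idealPow N (mu i)
  have hf : ∀ i, Finite (R ⧸ idealPow N (mu i)) := fun i => Quotient.finite _
  let ψ : killed (t ^ (k + 1)) P →+ killed t P :=
    { toFun := fun x => ⟨t ^ k • x.1, by
        rw [mem_killed, ← mul_smul, ← pow_succ']
        exact x.2⟩
      map_zero' := Subtype.ext (smul_zero _)
      map_add' := fun x y => Subtype.ext (smul_add _ _ _) }
  have hsum : ∀ j, j ≤ k + 1 → Nat.card (killed (t ^ j) P) = Nat.card (R ⧸ N) ^ (n * j) := by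
    intro j hj
    rw [h.card_killed_pi j mu hle]
    congr 1
    rw [Finset.sum_congr rfl (fun i _ => min_eq_left (hj.trans (hge i)))]
    simp
  have hker : Nat.card ψ.ker = Nat.card (killed (t ^ k) P) := by
    refine Nat.card_congr
      { toFun := fun x => ⟨x.1.1, congrArg Subtype.val x.2⟩
        invFun := fun x => ⟨⟨x.1, ?_⟩, ?_⟩
        left_inv := fun x => rfl
        right_inv := fun x => rfl }
    · have := x.2
      rw [mem_killed] at this ⊢
      rw [pow_succ', mul_smul, this, smul_zero]
    · exact Subtype.ext x.2
  have hpos : 0 < Nat.card (R ⧸ N) := by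
    have : Finite (R ⧸ N) := Quotient.finite _
    exact Nat.card_pos
  have h1 := ψ.ker.card_mul_index
  rw [AddSubgroup.index_ker, hker, hsum k (by omega), hsum (k + 1) le_rfl, mul_add] at h1
  have h2 := Nat.eq_of_mul_eq_mul_left (pow_pos hpos _) (h1.trans (pow_add _ _ _))
  have h3 := hsum 1 (by omega)
  rw [pow_one] at h3
  have h4 : ψ.range = ⊤ := AddSubgroup.eq_top_of_card_eq _ (h2.trans h3.symm)
  have h5 : (⟨p, hp⟩ : killed t P) ∈ ψ.range := h4 ▸ AddSubgroup.mem_top _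
  obtain ⟨x, hx⟩ := h5
  exact ⟨x.1, congrArg Subtype.val hx⟩

/-- splitting off the last factor -/
def snocLin {n : ℕ} (A : Fin (n + 1) → Type*) [∀ i, AddCommGroup (A i)] [∀ i, Module R (A i)] :
    (∀ i, A i) ≃ₗ[R] (∀ i : Fin n, A i.castSucc) × A (Fin.last n) where
  toFun x := (fun i => x i.castSucc, x (Fin.last n))
  map_add' _ _ := rfl
  map_smul' _ _ := rfl
  invFun p := Fin.snoc p.1 p.2
  left_inv x := by
    funext i
    refine Fin.lastCases ?_ (fun i => ?_) i <;> simp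
  right_inv p := by
    ext <;> simp

theorem injMap_congr {P P' M : Type*} [AddCommGroup P] [AddCommGroup P'] [AddCommGroup M]
    [Module R P] [Module R P'] [Module R M] (e : P ≃ₗ[R] P') :
    Nat.card (InjMap R P M) = Nat.card (InjMap R P' M) := by
  refine Nat.card_congr
    { toFun := fun f => ⟨f.1.comp e.symm.toLinearMap, f.2.comp e.symm.injective⟩
      invFun := fun f => ⟨f.1.comp e.toLinearMap, f.2.comp e.injective⟩
      left_inv := fun f => by ext; simp
      right_inv := fun f => by ext; simp }

theorem CSData.card_inj {N : Ideal R} {t : R} {m : ℕ} (h : CSData N t m)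
    {M : Type*} [AddCommGroup M] [Module R M] [Finite M] (e : ℕ → ℕ)
    (he : ∀ k, Nat.card (killed (t ^ k) M) = Nat.card (R ⧸ N) ^ e k) (n : ℕ)
    (mu : Fin n → ℕ) (hmu : Antitone mu) (hle : ∀ i, mu i ≤ m) :
    Nat.card (InjMap R (∀ i, R ⧸ idealPow N (mu i)) M) =
      ∏ j : Fin n, if mu j = 0 then 1 else
        Nat.card (R ⧸ N) ^ e (mu j) - Nat.card (R ⧸ N) ^ ((j : ℕ) + e (mu j - 1)) := by
  induction n with
  | zero =>
    rw [Fin.prod_univ_zero, Nat.card_eq_one_iff_unique]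
    refine ⟨⟨fun f g => ?_⟩, ⟨⟨0, fun x y _ => Subsingleton.elim _ _⟩⟩⟩
    apply Subtype.ext
    apply LinearMap.ext
    intro x
    rw [Subsingleton.elim x 0, map_zero, map_zero]
  | succ n ih =>
    rw [Fin.prod_univ_castSucc, injMap_congr (snocLin _)]
    have ih' := ih (fun i => mu i.castSucc) (fun i j hij => hmu (by simpa using hij))
      (fun i => hle _)
    have hf : ∀ i, Finite (R ⧸ idealPow N (mu i)) := fun i => Quotient.finite _
    simp only [Fin.val_castSucc, Fin.val_last]
    rw [← ih']
    rcases hk : mu (Fin.last n) with _ | k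
    · rw [if_pos rfl, mul_one]
      have hs : Subsingleton (R ⧸ idealPow N 0) := by
        have : idealPow N 0 = ⊤ := rfl
        rw [this]
        infer_instance
      have : Unique (R ⧸ idealPow N 0) := ⟨⟨0⟩, fun _ => Subsingleton.elim _ _⟩
      exact injMap_congr LinearEquiv.prodUnique
    · rw [if_neg (by omega), h.step k (by have := hle (Fin.last n); omega)
        (h.socle k _ (fun i => hle _) (fun i => hk ▸ hmu (Fin.le_last _)))]
      congr 1
      rw [he, he]
      have h1 := h.card_killed_pi 1 (fun i : Fin n => mu i.castSucc) (fun i => hle _)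
      rw [pow_one] at h1
      rw [h1, ← pow_add]
      have h2 : ∑ i : Fin n, min 1 (mu i.castSucc) = n := by
        rw [Finset.sum_congr rfl (fun (i : Fin n) _ => min_eq_left
          (show 1 ≤ mu i.castSucc by have := hmu (Fin.le_last i.castSucc); omega))]
        simp
      rw [h2]
      simp

theorem card_sub_mul {P M : Type*} [AddCommGroup P] [AddCommGroup M]
    [Module R P] [Module R M] [Finite P] [Finite M] :
    Nat.card {U : Submodule R M // Nonempty (U ≃ₗ[R] P)} * Nat.card (InjMap R P P) =
      Nat.card (InjMap R P M) := by
  have hfin := finite_linearMap (R := R) P M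
  let E : (Σ U : {U : Submodule R M // Nonempty (U ≃ₗ[R] P)}, InjMap R P U.1) → InjMap R P M :=
    fun z => ⟨z.1.1.subtype.comp z.2.1, z.1.1.injective_subtype.comp z.2.2⟩
  have hcard : ∀ U : {U : Submodule R M // Nonempty (U ≃ₗ[R] P)},
      Nat.card (InjMap R P U.1) = Nat.card (InjMap R P P) := by
    rintro ⟨U, ⟨e⟩⟩
    refine Nat.card_congr
      { toFun := fun f => ⟨e.toLinearMap.comp f.1, e.injective.comp f.2⟩
        invFun := fun f => ⟨e.symm.toLinearMap.comp f.1, e.symm.injective.comp f.2⟩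
        left_inv := fun f => by ext; simp
        right_inv := fun f => by ext; simp }
  have hsurj : ∀ (U : {U : Submodule R M // Nonempty (U ≃ₗ[R] P)}) (f : InjMap R P U.1),
      Function.Surjective f.1 := by
    rintro ⟨U, ⟨e⟩⟩ f
    have : Function.Injective (e ∘ f.1) := e.injective.comp f.2
    have h2 := Finite.surjective_of_injective this
    exact (e.toEquiv.comp_surjective _).1 h2
  have hE : Function.Bijective E := by
    constructor
    · rintro ⟨U, f⟩ ⟨V, g⟩ hfg
      have h1 : U.1.subtype.comp f.1 = V.1.subtype.comp g.1 := congrArg Subtype.val hfg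
      have hUV : U = V := by
        apply Subtype.ext
        have h2 := congrArg LinearMap.range h1
        rwa [LinearMap.range_comp, LinearMap.range_comp,
          LinearMap.range_eq_top.2 (hsurj U f), LinearMap.range_eq_top.2 (hsurj V g),
          Submodule.map_top, Submodule.map_top, Submodule.range_subtype,
          Submodule.range_subtype] at h2
      subst hUV
      congr 1
      apply Subtype.ext
      ext x
      exact congrArg (fun φ => φ x) h1
    · rintro ⟨f, hf⟩
      refine ⟨⟨⟨LinearMap.range f, ⟨(LinearEquiv.ofInjective f hf).symm⟩⟩,
        ⟨f.rangeRestrict, fun x y hxy => hf (congrArg Subtype.val hxy)⟩⟩, ?_⟩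
      apply Subtype.ext
      ext x
      rfl
  have hfs : Finite {U : Submodule R M // Nonempty (U ≃ₗ[R] P)} := by
    have : Finite (Submodule R M) := Finite.of_injective (fun U => (U : Set M)) SetLike.coe_injective
    infer_instance
  have := Fintype.ofFinite {U : Submodule R M // Nonempty (U ≃ₗ[R] P)}
  have hfU : ∀ U : {U : Submodule R M // Nonempty (U ≃ₗ[R] P)}, Finite (InjMap R P U.1) := by
    intro U
    have := finite_linearMap (R := R) P U.1
    infer_instance
  rw [← Nat.card_eq_of_bijective E hE, Nat.card_sigma,
    Finset.sum_congr rfl (fun U _ => hcard U)]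
  simp
end counting
section numerics

theorem gauss_dvd (q : ℕ) (hq : 1 ≤ q) (n k : ℕ) :
    (∏ i ∈ Finset.range k, (q ^ (k - i) - 1)) ∣ ∏ i ∈ Finset.range k, (q ^ (n - i) - 1) := by
  induction n generalizing k with
  | zero =>
    rcases k with _ | k
    · simp
    · rw [Finset.prod_eq_zero (i := 0) (s := Finset.range (k + 1))
        (f := fun i => q ^ (0 - i) - 1) (by simp) (by simp)]
      exact dvd_zero _
  | succ n ih =>
    rcases k with _ | k
    · simp
    rcases lt_or_ge n k with hnk | hnk
    · rw [Finset.prod_eq_zero (i := n + 1) (s := Finset.range (k + 1))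
        (f := fun i => q ^ (n + 1 - i) - 1) (by simp; omega) (by simp)]
      exact dvd_zero _
    have hnum : ∏ i ∈ Finset.range (k + 1), (q ^ (n + 1 - i) - 1) =
        q ^ (k + 1) * (∏ i ∈ Finset.range (k + 1), (q ^ (n - i) - 1)) +
        (q ^ (k + 1) - 1) * ∏ i ∈ Finset.range k, (q ^ (n - i) - 1) := by
      rw [Finset.prod_range_succ', Finset.prod_range_succ]
      have : ∀ i, n + 1 - (i + 1) = n - i := by intro i; omega
      simp_rw [this]
      have h1 : 1 ≤ q ^ (n - k) := Nat.one_le_pow _ _ hq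
      have h2 : 1 ≤ q ^ (k + 1) := Nat.one_le_pow _ _ hq
      have h3 : q ^ (n + 1 - 0) = q ^ (n - k) * q ^ (k + 1) := by
        rw [← pow_add]; congr 1; omega
      rw [h3]
      obtain ⟨a, ha⟩ := Nat.exists_eq_add_of_le h1
      obtain ⟨b, hb⟩ := Nat.exists_eq_add_of_le h2
      rw [ha, hb]
      have : (1 + a) * (1 + b) - 1 = a + b + a * b := by
        rw [show (1 + a) * (1 + b) = (a + b + a * b) + 1 by ring]; rfl
      rw [this]
      simp only [Nat.add_sub_cancel_left]
      ring
    have hden : ∏ i ∈ Finset.range (k + 1), (q ^ (k + 1 - i) - 1) =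
        (q ^ (k + 1) - 1) * ∏ i ∈ Finset.range k, (q ^ (k - i) - 1) := by
      rw [Finset.prod_range_succ']
      have : ∀ i, k + 1 - (i + 1) = k - i := by intro i; omega
      simp_rw [this]
      rw [mul_comm]; rfl
    rw [hnum]
    apply dvd_add
    · exact (ih (k + 1)).mul_left _
    · rw [hden]
      exact mul_dvd_mul_left _ (ih k)

theorem gauss_mul (q : ℕ) (hq : 1 ≤ q) (n k : ℕ) :
    gaussBinom q n k * (∏ i ∈ Finset.range k, (q ^ (k - i) - 1)) =
      ∏ i ∈ Finset.range k, (q ^ (n - i) - 1) :=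
  Nat.div_mul_cancel (gauss_dvd q hq n k)

theorem dual_iff {n : ℕ} (mu : Fin n → ℕ) (hmu : Antitone mu) (i : ℕ) (j : Fin n) :
    i ≤ mu j ↔ (j : ℕ) < dualShape mu i := by
  unfold dualShape
  constructor
  · intro h
    have hsub : Finset.Iic j ⊆ Finset.univ.filter fun j : Fin n => i ≤ mu j := by
      intro x hx
      simp only [Finset.mem_filter, Finset.mem_univ, true_and]
      exact h.trans (hmu (Finset.mem_Iic.1 hx))
    have := Finset.card_le_card hsub
    rw [Fin.card_Iic] at this
    omega
  · intro h
    by_contra hlt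
    have hsub : (Finset.univ.filter fun j : Fin n => i ≤ mu j) ⊆ Finset.Iio j := by
      intro x hx
      simp only [Finset.mem_filter, Finset.mem_univ, true_and] at hx
      rw [Finset.mem_Iio]
      by_contra hx'
      exact hlt (hx.trans (hmu (not_lt.1 hx')))
    have := Finset.card_le_card hsub
    rw [Fin.card_Iio] at this
    omega

theorem dual_le {n : ℕ} (mu : Fin n → ℕ) (i : ℕ) : dualShape mu i ≤ n := by
  unfold dualShape
  exact (Finset.card_le_univ _).trans (by simp)

theorem dual_anti {n : ℕ} (mu : Fin n → ℕ) (i : ℕ) : dualShape mu (i + 1) ≤ dualShape mu i := by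
  unfold dualShape
  apply Finset.card_le_card
  intro x
  simp only [Finset.mem_filter, Finset.mem_univ, true_and]
  omega

theorem dual_mono {n : ℕ} (mu lam : Fin n → ℕ) (h : ∀ i, mu i ≤ lam i) (i : ℕ) :
    dualShape mu i ≤ dualShape lam i := by
  unfold dualShape
  apply Finset.card_le_card
  intro x
  simp only [Finset.mem_filter, Finset.mem_univ, true_and]
  intro hx
  exact hx.trans (h x)

theorem sum_min_succ {n : ℕ} (lam : Fin n → ℕ) (i : ℕ) :
    ∑ s, min (i + 1) (lam s) = ∑ s, min i (lam s) + dualShape lam (i + 1) := by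
  unfold dualShape
  rw [Finset.card_filter, ← Finset.sum_add_distrib]
  apply Finset.sum_congr rfl
  intro s _
  split_ifs <;> omega

/-- product over indices with a given value of `mu` -/
theorem prod_fiber {n : ℕ} (mu : Fin n → ℕ) (hmu : Antitone mu) (i : ℕ) (F : ℕ → ℕ) :
    ∏ j ∈ Finset.univ.filter (fun j : Fin n => mu j = i), F j =
      ∏ s ∈ Finset.range (dualShape mu i - dualShape mu (i + 1)), F (dualShape mu (i + 1) + s) := by
  symm
  have hd := dual_le mu i
  refine Finset.prod_bij (fun s hs => ⟨dualShape mu (i + 1) + s, by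
    rw [Finset.mem_range] at hs; omega⟩) ?_ ?_ ?_ ?_
  · intro s hs
    rw [Finset.mem_range] at hs
    simp only [Finset.mem_filter, Finset.mem_univ, true_and]
    have h1 := dual_iff mu hmu i ⟨dualShape mu (i + 1) + s, by omega⟩
    have h2 := dual_iff mu hmu (i + 1) ⟨dualShape mu (i + 1) + s, by omega⟩
    simp only at h1 h2
    omega
  · intro a _ b _ hab
    have := congrArg Fin.val hab
    simp only at this
    omega
  · intro j hj
    simp only [Finset.mem_filter, Finset.mem_univ, true_and] at hj
    have h1 := dual_iff mu hmu i j
    have h2 := dual_iff mu hmu (i + 1) j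
    refine ⟨j - dualShape mu (i + 1), ?_, ?_⟩
    · rw [Finset.mem_range]; omega
    · apply Fin.ext
      simp only
      omega
  · intro s hs
    rfl

theorem prod_regroup {n m : ℕ} (mu : Fin n → ℕ) (hmu : Antitone mu) (hle : ∀ i, mu i ≤ m)
    (F : ℕ → ℕ → ℕ) :
    (∏ j : Fin n, if mu j = 0 then 1 else F (mu j) j) =
      ∏ i ∈ Finset.Icc 1 m, ∏ s ∈ Finset.range (dualShape mu i - dualShape mu (i + 1)),
        F i (dualShape mu (i + 1) + s) := by
  have h0 : (∏ j : Fin n, if mu j = 0 then 1 else F (mu j) j) =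
      ∏ j ∈ Finset.univ.filter (fun j : Fin n => mu j ≠ 0), F (mu j) j := by
    rw [Finset.prod_filter]
    apply Finset.prod_congr rfl
    intro j _
    split_ifs <;> simp_all
  rw [h0, ← Finset.prod_fiberwise_of_maps_to (t := Finset.Icc 1 m) (g := mu)]
  · apply Finset.prod_congr rfl
    intro i hi
    rw [Finset.mem_Icc] at hi
    rw [← prod_fiber mu hmu i (F i), Finset.filter_filter]
    have : (Finset.univ.filter fun j : Fin n => mu j ≠ 0 ∧ mu j = i) =
        Finset.univ.filter fun j : Fin n => mu j = i := by
      apply Finset.filter_congr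
      intro j _
      omega
    rw [this]
    apply Finset.prod_congr rfl
    intro j hj
    rw [(Finset.mem_filter.1 hj).2]
  · intro j hj
    have := (Finset.mem_filter.1 hj).2
    have := hle j
    rw [Finset.mem_Icc]
    omega

theorem abel (L D EL ED : ℕ → ℕ) (hLD : ∀ i, D i ≤ L i) (hD : ∀ i, D (i + 1) ≤ D i)
    (hEL0 : EL 0 = 0) (hED0 : ED 0 = 0)
    (hEL : ∀ i, EL (i + 1) = EL i + L (i + 1)) (hED : ∀ i, ED (i + 1) = ED i + D (i + 1)) (M : ℕ) :
    (∑ i ∈ Finset.Icc 1 M, D (i + 1) * (L i - D i)) +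
      (∑ i ∈ Finset.Icc 1 M, (D i - D (i + 1)) * ED (i - 1)) + D (M + 1) * ED M =
    (∑ i ∈ Finset.Icc 1 M, (D i - D (i + 1)) * EL (i - 1)) + D (M + 1) * EL M := by
  induction M with
  | zero => simp [hEL0, hED0]
  | succ M ih =>
    rw [Finset.sum_Icc_succ_top (by omega), Finset.sum_Icc_succ_top (by omega),
      Finset.sum_Icc_succ_top (by omega)]
    rw [hEL, hED, Nat.add_sub_cancel]
    obtain ⟨a, ha⟩ := Nat.exists_eq_add_of_le (hLD (M + 1))
    obtain ⟨b, hb⟩ := Nat.exists_eq_add_of_le (hD (M + 1))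
    rw [ha, Nat.add_sub_cancel_left]
    have hb' : D (M + 1) - D (M + 1 + 1) = b := by omega
    rw [hb']
    rw [hb] at ih ⊢
    nlinarith [ih]
theorem group_term (q L D D' E k : ℕ) (hk : k = D - D') (hD : D' ≤ D) (hDL : D ≤ L) :
    ∏ s ∈ Finset.range k, (q ^ (E + L) - q ^ (D' + s + E)) =
    q ^ (∑ s ∈ Finset.range k, (D' + s)) * q ^ (k * E) *
      ∏ s ∈ Finset.range k, (q ^ (L - D' - s) - 1) := by
  have : q ^ (k * E) = ∏ s ∈ Finset.range k, q ^ E := by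
    rw [Finset.prod_const, Finset.card_range, ← pow_mul, mul_comm]
  rw [this, ← Finset.prod_pow_eq_pow_sum, ← Finset.prod_mul_distrib, ← Finset.prod_mul_distrib]
  apply Finset.prod_congr rfl
  intro s hs
  rw [Finset.mem_range] at hs
  rw [Nat.mul_sub, mul_one, ← pow_add, ← pow_add]
  congr 2
  omega

theorem numeric (q m n : ℕ) (hq : 2 ≤ q) (lam mu : Fin n → ℕ)
    (hmu : Antitone mu) (hlam_le : ∀ i, lam i ≤ m) (hmu_le : ∀ i, mu i ≤ lam i) (c : ℕ)
    (hc : c * (∏ j : Fin n, if mu j = 0 then 1 else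
        q ^ (∑ s, min (mu j) (mu s)) - q ^ ((j : ℕ) + ∑ s, min (mu j - 1) (mu s))) =
      ∏ j : Fin n, if mu j = 0 then 1 else
        q ^ (∑ s, min (mu j) (lam s)) - q ^ ((j : ℕ) + ∑ s, min (mu j - 1) (lam s))) :
    c = ∏ i ∈ Finset.Icc 1 m,
        q ^ (dualShape mu (i + 1) * (dualShape lam i - dualShape mu i)) *
          gaussBinom q (dualShape lam i - dualShape mu (i + 1))
            (dualShape mu i - dualShape mu (i + 1)) := by
  have hmum : ∀ i, mu i ≤ m := fun i => (hmu_le i).trans (hlam_le i)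
  have key : ∀ nu : Fin n → ℕ, (∀ i, mu i ≤ nu i) →
      (∏ j : Fin n, if mu j = 0 then 1 else
        q ^ (∑ s, min (mu j) (nu s)) - q ^ ((j : ℕ) + ∑ s, min (mu j - 1) (nu s))) =
      ∏ i ∈ Finset.Icc 1 m,
        (q ^ (∑ s ∈ Finset.range (dualShape mu i - dualShape mu (i + 1)),
            (dualShape mu (i + 1) + s)) *
          q ^ ((dualShape mu i - dualShape mu (i + 1)) * ∑ s, min (i - 1) (nu s)) *
          ∏ s ∈ Finset.range (dualShape mu i - dualShape mu (i + 1)),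
            (q ^ (dualShape nu i - dualShape mu (i + 1) - s) - 1)) := by
    intro nu hnu
    rw [prod_regroup mu hmu hmum (fun i j =>
      q ^ (∑ s, min i (nu s)) - q ^ (j + ∑ s, min (i - 1) (nu s)))]
    apply Finset.prod_congr rfl
    intro i hi
    rw [Finset.mem_Icc] at hi
    obtain ⟨i, rfl⟩ : ∃ i', i = i' + 1 := ⟨i - 1, by omega⟩
    rw [← group_term q (dualShape nu (i + 1)) (dualShape mu (i + 1)) (dualShape mu (i + 1 + 1)) _ _
      rfl (dual_anti _ _) (dual_mono _ _ hnu _)]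
    rw [sum_min_succ]
    rfl
  have hDm : dualShape mu (m + 1) = 0 := by
    unfold dualShape
    rw [Finset.card_eq_zero, Finset.filter_eq_empty_iff]
    intro j _
    have := hmum j
    omega
  have hab := abel (dualShape lam) (dualShape mu) (fun i => ∑ s, min i (lam s))
    (fun i => ∑ s, min i (mu s)) (dual_mono _ _ hmu_le) (dual_anti _) (by simp) (by simp)
    (sum_min_succ lam) (sum_min_succ mu) m
  rw [hDm, zero_mul, zero_mul, add_zero, add_zero] at hab
  rw [key lam hmu_le, key mu (fun _ => le_rfl)] at hc
  have hpos : 0 < ∏ i ∈ Finset.Icc 1 m,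
        (q ^ (∑ s ∈ Finset.range (dualShape mu i - dualShape mu (i + 1)),
            (dualShape mu (i + 1) + s)) *
          q ^ ((dualShape mu i - dualShape mu (i + 1)) * ∑ s, min (i - 1) (mu s)) *
          ∏ s ∈ Finset.range (dualShape mu i - dualShape mu (i + 1)),
            (q ^ (dualShape mu i - dualShape mu (i + 1) - s) - 1)) := by
    apply Finset.prod_pos
    intro i _
    apply Nat.mul_pos
    · positivity
    · apply Finset.prod_pos
      intro s hs
      rw [Finset.mem_range] at hs
      have : 1 < q ^ (dualShape mu i - dualShape mu (i + 1) - s) :=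
        Nat.one_lt_pow (by omega) (by omega)
      omega
  apply Nat.eq_of_mul_eq_mul_right hpos
  rw [hc]
  have hA := congrArg (fun z => q ^ z) hab
  simp only [pow_add, ← Finset.prod_pow_eq_pow_sum] at hA
  simp only [Finset.prod_mul_distrib]
  rw [← hA]
  simp_rw [← gauss_mul q (by omega) (dualShape lam _ - dualShape mu _)
    (dualShape mu _ - dualShape mu _)]
  simp only [Finset.prod_mul_distrib]
  ring

end numerics
/-- **Counting submodules of a given shape in a module over a finite chain ring.**
Let `R` be a finite chain ring of length `m` with maximal ideal `N` and residue field of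
order `q`. Let `λ = (λ₁ ≥ … ≥ λ_n ≥ 0)` with `λ₁ ≤ m` and `M = R/N^{λ₁} ⊕ … ⊕ R/N^{λ_n}`.
For every sequence `μ = (μ₁ ≥ … ≥ μ_n ≥ 0)` with `μ_i ≤ λ_i` for all `i`, the number of
submodules of `M` isomorphic to `R/N^{μ₁} ⊕ … ⊕ R/N^{μ_n}` equals
`∏_{i=1}^{m} q^{μ'_{i+1}(λ'_i - μ'_i)} · [λ'_i - μ'_{i+1} choose μ'_i - μ'_{i+1}]_q`. -/
theorem count_submodules_of_shape (q m n : ℕ) {R : Type*} [Ring R] [Fintype R]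
    (hchain : ∀ I J : Ideal R, I ≤ J ∨ J ≤ I)
    (N : Ideal R) (hN : N.IsMaximal)
    (hnil : idealPow N m = ⊥) (hnil' : idealPow N (m - 1) ≠ ⊥)
    (hq : Nat.card (R ⧸ N) = q) (hq' : IsPrimePow q)
    (lam mu : Fin n → ℕ)
    (hlam : Antitone lam) (hlam_le : ∀ i, lam i ≤ m)
    (hmu : Antitone mu) (hmu_le : ∀ i, mu i ≤ lam i) :
    Nat.card {U : Submodule R ((i : Fin n) → R ⧸ idealPow N (lam i)) //
        Nonempty (U ≃ₗ[R] ((i : Fin n) → R ⧸ idealPow N (mu i)))} =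
      ∏ i ∈ Finset.Icc 1 m,
        q ^ (dualShape mu (i + 1) * (dualShape lam i - dualShape mu i)) *
          gaussBinom q (dualShape lam i - dualShape mu (i + 1))
            (dualShape mu i - dualShape mu (i + 1)) := by
  obtain ⟨t, h⟩ := cs_data hchain N hN m hnil hnil'
  have hf : ∀ l, Finite (R ⧸ idealPow N l) := fun l => Quotient.finite _
  have hmum : ∀ i, mu i ≤ m := fun i => (hmu_le i).trans (hlam_le i)
  have h1 := h.card_inj (fun k => ∑ s, min k (mu s)) (fun k => h.card_killed_pi k mu hmum)
    n mu hmu hmum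
  have h2 := h.card_inj (fun k => ∑ s, min k (lam s)) (fun k => h.card_killed_pi k lam hlam_le)
    n mu hmu hmum
  have h3 := card_sub_mul (R := R) (P := ∀ i, R ⧸ idealPow N (mu i))
    (M := ∀ i, R ⧸ idealPow N (lam i))
  rw [h1, h2, hq] at h3
  exact numeric q m n hq'.two_le lam mu hmu hlam_le hmu_le _ h3
end

section
/- Let R be a finite chain ring of length m with maximal ideal N and residue field F_q, and let 1 ≤ t < k ≤ n be integers. Let 𝓕 be a family of free rank-k submodules of the left R-module R^n such that any two members of 𝓕 contain a common free submodule of rank t. Then for every i with 1 ≤ i ≤ m−1, the images η_i(F) for F ∈ 𝓕 are free rank-k submodules of the (R/N^i)-module (R/N^i)^n, any two of which contain a common free rank-t (R/N^i)-submodule. In particular, the images η₁(F) for F ∈ 𝓕 are k-dimensional F_q-subspaces of F_q^n, any two of which intersect in a subspace of dimension at least t. -/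
/-- Componentwise reduction `η_i : R^n → (R/N^i)^n`, realised as the quotient of the
`R`-module `R^n` by the submodule of vectors all of whose coordinates lie in `N^i`
(so `(R^n)/(N^i)^n ≅ (R/N^i)^n` as `R`-modules). -/
def etaMap {R : Type*} [Ring R] (N : Ideal R) (n i : ℕ) :
    (Fin n → R) →ₗ[R] (Fin n → R) ⧸ Submodule.pi Set.univ (fun _ : Fin n => idealPow N i) :=
  (Submodule.pi Set.univ (fun _ : Fin n => idealPow N i)).mkQ

section Helpers

variable {R : Type*} [Ring R]

theorem left_inv_of_not_mem (hchain : ∀ I J : Ideal R, I ≤ J ∨ J ≤ I)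
    (N : Ideal R) (hN : N.IsMaximal) (r : R) (hr : r ∉ N) : ∃ s, s * r = 1 := by
  have h : Submodule.span R {r} = (⊤ : Ideal R) := by
    rcases hchain (Submodule.span R {r}) N with h | h
    · exact absurd (h (Submodule.mem_span_singleton_self r)) hr
    · apply hN.out.2
      refine lt_of_le_of_ne h ?_
      intro he
      apply hr
      rw [he]
      exact Submodule.mem_span_singleton_self r
  have h1 : (1 : R) ∈ Submodule.span R {r} := by rw [h]; trivial
  obtain ⟨s, hs⟩ := Submodule.mem_span_singleton.1 h1
  exact ⟨s, hs⟩

theorem mul_mem_right_max [Finite R] (hchain : ∀ I J : Ideal R, I ≤ J ∨ J ≤ I)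
    (N : Ideal R) (hN : N.IsMaximal) (r s : R) (hr : r ∈ N) : r * s ∈ N := by
  by_contra h
  obtain ⟨u, hu⟩ := left_inv_of_not_mem hchain N hN _ h
  have h2 : (u * r) * s = 1 := by rw [mul_assoc]; exact hu
  have h3 : s * (u * r) = 1 := mul_eq_one_symm h2
  apply hN.ne_top
  rw [Ideal.eq_top_iff_one, ← h3, ← mul_assoc]
  exact N.mul_mem_left _ hr

theorem idealPow_mul_right (N : Ideal R) (hR : ∀ r s : R, r ∈ N → r * s ∈ N) (i : ℕ) :
    ∀ x ∈ idealPow N i, ∀ s : R, x * s ∈ idealPow N i := by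
  cases i with
  | zero => intro x _ s; trivial
  | succ i =>
    intro x hx s
    change x ∈ Submodule.span R _ at hx
    induction hx using Submodule.span_induction with
    | mem x h =>
      obtain ⟨a, ha, b, hb, rfl⟩ := h
      exact Submodule.subset_span ⟨a, ha, b * s, hR _ _ hb, mul_assoc _ _ _⟩
    | zero => rw [zero_mul]; exact zero_mem _
    | add x y _ _ h1 h2 => rw [add_mul]; exact add_mem h1 h2
    | smul r x _ h =>
      rw [smul_eq_mul, mul_assoc]
      exact Ideal.mul_mem_left _ _ h

theorem idealPow_mul_mem (N : Ideal R) (hR : ∀ r s : R, r ∈ N → r * s ∈ N) (i j : ℕ) :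
    ∀ a ∈ idealPow N i, ∀ b ∈ idealPow N j, a * b ∈ idealPow N (i + j) := by
  induction j with
  | zero => intro a ha b _; exact idealPow_mul_right N hR i a ha b
  | succ j ih =>
    intro a ha b hb
    change b ∈ Submodule.span R _ at hb
    induction hb using Submodule.span_induction generalizing a with
    | mem x h =>
      obtain ⟨c, hc, d, hd, rfl⟩ := h
      exact Submodule.subset_span ⟨a * c, ih a ha c hc, d, hd, (mul_assoc _ _ _).symm⟩
    | zero => rw [mul_zero]; exact zero_mem _
    | add x y _ _ h1 h2 => rw [mul_add]; exact add_mem (h1 a ha) (h2 a ha)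
    | smul r x _ h =>
      rw [smul_eq_mul, ← mul_assoc]
      exact h _ (idealPow_mul_right N hR i a ha r)

theorem idealPow_add_le (N : Ideal R) (i j : ℕ) :
    ∀ J : Ideal R, (∀ a ∈ idealPow N i, ∀ b ∈ idealPow N j, a * b ∈ J) →
      idealPow N (i + j) ≤ J := by
  induction j with
  | zero => intro J h a ha; simpa using h a ha 1 trivial
  | succ j ih =>
    intro J h
    change Submodule.span R _ ≤ J
    rw [Submodule.span_le]
    rintro _ ⟨c, hc, b, hb, rfl⟩
    have := ih (Submodule.comap (LinearMap.toSpanSingleton R R b) J) (by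
      intro a' ha b' hb'
      rw [Submodule.mem_comap, LinearMap.toSpanSingleton_apply, smul_eq_mul, mul_assoc]
      exact h a' ha _ (Submodule.subset_span ⟨b', hb', b, hb, rfl⟩)) hc
    simpa using this

theorem idealPow_le_span (hchain : ∀ I J : Ideal R, I ≤ J ∨ J ≤ I)
    (N : Ideal R) (hN : N.IsMaximal) (hR : ∀ r s : R, r ∈ N → r * s ∈ N) (x : R) (i : ℕ) :
    x ∉ idealPow N (i + 1) → idealPow N i ≤ Submodule.span R {x} := by
  induction i with
  | zero =>
    intro hx y _
    have hxN : x ∉ N := fun h => hx (Submodule.subset_span ⟨1, trivial, x, h, (one_mul x).symm⟩)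
    obtain ⟨s, hs⟩ := left_inv_of_not_mem hchain N hN x hxN
    exact Submodule.mem_span_singleton.2 ⟨y * s, by rw [smul_eq_mul, mul_assoc, hs, mul_one]⟩
  | succ i ih =>
    intro hx
    by_cases hxi : x ∈ idealPow N (i + 1)
    · intro y hy
      by_contra hyx
      rcases hchain (Submodule.span R {x}) (Submodule.span R {y}) with h | h
      · obtain ⟨r, hr⟩ := Submodule.mem_span_singleton.1 (h (Submodule.mem_span_singleton_self x))
        by_cases hrN : r ∈ N
        · apply hx
          rw [← hr, add_comm (i + 1) 1]
          refine idealPow_mul_mem N hR 1 (i + 1) r ?_ y hy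
          exact Submodule.subset_span ⟨1, trivial, r, hrN, (one_mul r).symm⟩
        · obtain ⟨s, hs⟩ := left_inv_of_not_mem hchain N hN r hrN
          apply hyx
          refine Submodule.mem_span_singleton.2 ⟨s, ?_⟩
          rw [← hr, smul_eq_mul, smul_eq_mul, ← mul_assoc, hs, one_mul]
      · exact hyx (h (Submodule.mem_span_singleton_self y))
    · refine le_trans ?_ (ih hxi)
      exact idealPow_add_le N i 1 _ (fun a ha b _ => idealPow_mul_right N hR i a ha b)

theorem reduction_free [Finite R] (m n k i : ℕ) (hchain : ∀ I J : Ideal R, I ≤ J ∨ J ≤ I)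
    (N : Ideal R) (hN : N.IsMaximal)
    (hnil : idealPow N m = ⊥) (hnil' : idealPow N (m - 1) ≠ ⊥)
    (hi : 1 ≤ i) (him : i ≤ m - 1) (U : Submodule R (Fin n → R)) (e : U ≃ₗ[R] (Fin k → R)) :
    Nonempty ((U.map (etaMap N n i)) ≃ₗ[R] (Fin k → R ⧸ idealPow N i)) := by
  have hR : ∀ r s : R, r ∈ N → r * s ∈ N := mul_mem_right_max hchain N hN
  let f : (Fin k → R) →ₗ[R] (Fin n → R) := U.subtype ∘ₗ e.symm.toLinearMap
  have hf : Function.Injective f := U.injective_subtype.comp e.symm.injective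
  let φ := etaMap N n i ∘ₗ f
  let ψ : (Fin k → R) →ₗ[R] (Fin k → R ⧸ idealPow N i) :=
    LinearMap.pi fun j => (idealPow N i).mkQ ∘ₗ LinearMap.proj j
  have hψ : Function.Surjective ψ := by
    intro y
    choose g hg using fun j => (idealPow N i).mkQ_surjective (y j)
    exact ⟨g, funext hg⟩
  have hrange : LinearMap.range φ = U.map (etaMap N n i) := by
    rw [LinearMap.range_comp]
    congr 1
    change LinearMap.range (U.subtype ∘ₗ e.symm.toLinearMap) = U
    rw [LinearMap.range_comp, LinearEquiv.range, Submodule.map_top, Submodule.range_subtype]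
  have hker : LinearMap.ker φ = LinearMap.ker ψ := by
    ext x
    have h1 : x ∈ LinearMap.ker φ ↔ ∀ l, f x l ∈ idealPow N i := by
      rw [LinearMap.mem_ker]
      change (Submodule.pi Set.univ (fun _ : Fin n => idealPow N i)).mkQ (f x) = 0 ↔ _
      rw [Submodule.mkQ_apply, Submodule.Quotient.mk_eq_zero, Submodule.mem_pi]
      simp
    have h2 : x ∈ LinearMap.ker ψ ↔ ∀ j, x j ∈ idealPow N i := by
      rw [LinearMap.mem_ker, funext_iff]
      refine forall_congr' fun j => ?_
      change (idealPow N i).mkQ (x j) = 0 ↔ _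
      rw [Submodule.mkQ_apply, Submodule.Quotient.mk_eq_zero]
    rw [h1, h2]
    constructor
    · intro h j
      by_contra hj
      obtain ⟨i', rfl⟩ : ∃ i', i = i' + 1 := ⟨i - 1, by omega⟩
      have hle := idealPow_le_span hchain N hN hR (x j) i' hj
      have hann : ∀ a ∈ idealPow N (m - (i' + 1)), a * x j = 0 := by
        intro a ha
        have h0 : f (a • x) = 0 := by
          rw [map_smul]
          funext l
          have := idealPow_mul_mem N hR _ _ a ha _ (h l)
          rw [Nat.sub_add_cancel (by omega), hnil] at this
          simpa using this
        have h3 : a • x = 0 := hf (by rw [h0, map_zero])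
        simpa using congrFun h3 j
      apply hnil'
      rw [eq_bot_iff]
      have hm : m - 1 = (m - (i' + 1)) + i' := by omega
      rw [hm]
      apply idealPow_add_le
      intro a ha b hb
      obtain ⟨r, rfl⟩ := Submodule.mem_span_singleton.1 (hle hb)
      rw [Submodule.mem_bot, smul_eq_mul, ← mul_assoc]
      exact hann _ (idealPow_mul_right N hR _ a ha r)
    · intro h l
      have hx : f x = ∑ j, x j • f (Pi.single j 1) := by
        conv_lhs => rw [pi_eq_sum_univ' x]
        rw [map_sum]
        refine Finset.sum_congr rfl fun j _ => ?_
        rw [map_smul]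
      rw [hx, Finset.sum_apply]
      refine sum_mem fun j _ => ?_
      exact idealPow_mul_right N hR i _ (h j) _
  exact ⟨(LinearEquiv.ofEq _ _ hrange).symm ≪≫ₗ φ.quotKerEquivRange.symm ≪≫ₗ
    Submodule.quotEquivOfEq _ _ hker ≪≫ₗ ψ.quotKerEquivOfSurjective hψ⟩

end Helpers

/-- **Reduction of intersecting families of Hjelmslev subspaces.**
Let `R` be a finite chain ring of length `m` with maximal ideal `N` and residue field of
order `q`, and `1 ≤ t < k ≤ n`. Let `𝓕` be a family of free rank-`k` submodules of `R^n`
such that any two members contain a common free rank-`t` submodule. Then for every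
`1 ≤ i ≤ m-1` the images `η_i(F)`, `F ∈ 𝓕`, are free rank-`k` `(R/N^i)`-submodules of
`(R/N^i)^n` (i.e. isomorphic as `R`-modules to `(R/N^i)^k`), any two of which contain a
common free rank-`t` `(R/N^i)`-submodule; in particular (the case `i = 1`), the images
`η₁(F)` are `k`-dimensional `F_q`-subspaces of `F_q^n` any two of which intersect in a
subspace of dimension at least `t`. -/
theorem intersecting_family_reduction (q m t k n : ℕ) {R : Type*} [Ring R] [Fintype R]
    (hchain : ∀ I J : Ideal R, I ≤ J ∨ J ≤ I)
    (N : Ideal R) (hN : N.IsMaximal)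
    (hnil : idealPow N m = ⊥) (hnil' : idealPow N (m - 1) ≠ ⊥)
    (hq : Nat.card (R ⧸ N) = q) (hq' : IsPrimePow q)
    (ht : 1 ≤ t) (htk : t < k) (hkn : k ≤ n)
    (𝓕 : Set (Submodule R (Fin n → R)))
    (hfree : ∀ F ∈ 𝓕, Nonempty (F ≃ₗ[R] (Fin k → R)))
    (hint : ∀ F ∈ 𝓕, ∀ F' ∈ 𝓕, ∃ U : Submodule R (Fin n → R),
      U ≤ F ⊓ F' ∧ Nonempty (U ≃ₗ[R] (Fin t → R))) :
    ∀ i, 1 ≤ i → i ≤ m - 1 →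
      (∀ F ∈ 𝓕, Nonempty ((F.map (etaMap N n i)) ≃ₗ[R] (Fin k → R ⧸ idealPow N i))) ∧
      (∀ F ∈ 𝓕, ∀ F' ∈ 𝓕,
        ∃ V : Submodule R ((Fin n → R) ⧸ Submodule.pi Set.univ (fun _ : Fin n => idealPow N i)),
          V ≤ (F.map (etaMap N n i)) ⊓ (F'.map (etaMap N n i)) ∧
            Nonempty (V ≃ₗ[R] (Fin t → R ⧸ idealPow N i))) := by
  intro i hi him
  refine ⟨fun F hF => ?_, fun F hF F' hF' => ?_⟩
  · obtain ⟨e⟩ := hfree F hF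
    exact reduction_free m n k i hchain N hN hnil hnil' hi him F e
  · obtain ⟨U, hU, ⟨e⟩⟩ := hint F hF F' hF'
    refine ⟨U.map (etaMap N n i), le_inf ?_ ?_,
      reduction_free m n t i hchain N hN hnil hnil' hi him U e⟩
    · exact Submodule.map_mono (hU.trans inf_le_left)
    · exact Submodule.map_mono (hU.trans inf_le_right)
end

section
/- Let R be a finite chain ring of length m with maximal ideal N and residue field F_q, and let t, k, n be integers with 1 ≤ t < k ≤ n/2. Let 𝓕 be a family of free rank-k submodules of the left R-module R^n such that any two members of 𝓕 contain a common free submodule of rank t. Then |𝓕| ≤ q^{(m−1)(k−t)(n−k)} · [n−t choose k−t]_q. -/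
section Part1
open Module Finset

/-- real Gaussian binomial in "frame" form -/
noncomputable def gc (q n k : ℕ) : ℝ :=
  ∏ i ∈ Finset.range k, (((q:ℝ) ^ n - (q:ℝ) ^ i) / ((q:ℝ) ^ k - (q:ℝ) ^ i))

set_option linter.unusedSectionVars false
section counting
variable {K V : Type*} [Field K] [Finite K] [AddCommGroup V] [Module K V] [Finite V]

theorem card_LI (k : ℕ) : (Nat.card { s : Fin k → V // LinearIndependent K s } : ℝ) =
    ∏ i ∈ Finset.range k, ((Nat.card K : ℝ) ^ (finrank K V) - (Nat.card K : ℝ) ^ i) := by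
  classical
  have := Fintype.ofFinite K
  by_cases hk : k ≤ finrank K V
  · rw [card_linearIndependent hk, Nat.card_eq_fintype_card, Nat.cast_prod,
      Finset.prod_range (fun i => ((Fintype.card K : ℝ) ^ (finrank K V) - (Fintype.card K : ℝ) ^ i))]
    refine Finset.prod_congr rfl fun i _ => ?_
    rw [Nat.cast_sub (Nat.pow_le_pow_right Fintype.card_pos (by omega))]
    push_cast; rfl
  · push Not at hk
    rw [Finset.prod_eq_zero (i := finrank K V) (by simpa using hk) (by simp)]
    have : IsEmpty { s : Fin k → V // LinearIndependent K s } := by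
      refine ⟨fun s => ?_⟩
      have := s.2.fintype_card_le_finrank
      simp at this
      omega
    simp

/-- splitting off a subspace -/
noncomputable def splitEquiv (S : Submodule K V) : V ≃ (V ⧸ S) × S where
  toFun v := (S.mkQ v, ⟨v - Quotient.out (S.mkQ v), by
    rw [← Submodule.Quotient.mk_eq_zero, Submodule.Quotient.mk_sub, sub_eq_zero]
    exact (Quotient.out_eq _).symm⟩)
  invFun p := Quotient.out p.1 + p.2
  left_inv v := by simp
  right_inv p := by
    have h : S.mkQ (Quotient.out p.1 + p.2) = p.1 := by
      rw [map_add]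
      have : S.mkQ (p.2 : V) = 0 := by simp
      rw [this, add_zero]; exact Quotient.out_eq _
    ext
    · exact h
    · simp [h]

theorem splitEquiv_fst (S : Submodule K V) (v : V) : (splitEquiv S v).1 = S.mkQ v := rfl

theorem card_LI_mk (S : Submodule K V) (k : ℕ) :
    Nat.card { s : Fin k → V // LinearIndependent K (S.mkQ ∘ s) } =
    Nat.card { s : Fin k → V ⧸ S // LinearIndependent K s } * (Nat.card S) ^ k := by
  have e : { s : Fin k → V // LinearIndependent K (S.mkQ ∘ s) } ≃
      { s : Fin k → V ⧸ S // LinearIndependent K s } × (Fin k → S) :=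
    { toFun := fun s => (⟨S.mkQ ∘ s.1, s.2⟩, fun i => (splitEquiv S (s.1 i)).2)
      invFun := fun p => ⟨fun i => (splitEquiv S).symm (p.1.1 i, p.2 i), by
        have : S.mkQ ∘ (fun i => (splitEquiv S).symm (p.1.1 i, p.2 i)) = p.1.1 := by
          funext i
          simp only [Function.comp]
          rw [← splitEquiv_fst]; simp
        rw [this]; exact p.1.2⟩
      left_inv := by
        intro s
        ext i
        simp only [Function.comp, ← splitEquiv_fst]
        simp
      right_inv := by
        intro p
        ext i
        · simp only [Function.comp, ← splitEquiv_fst]; simp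
        · simp }
  rw [Nat.card_congr e, Nat.card_prod, Nat.card_fun]
  simp

theorem card_disj_mul (S : Submodule K V) (k : ℕ) :
    Nat.card { s : Fin k → V // LinearIndependent K (S.mkQ ∘ s) } =
    Nat.card {U : Submodule K V // finrank K U = k ∧ U ⊓ S = ⊥} *
     Nat.card { s : Fin k → (Fin k → K) // LinearIndependent K s } := by
  classical
  have key : ∀ (U : Submodule K V), finrank K U = k →
      Nat.card { s : Fin k → U // LinearIndependent K s } =
      Nat.card { s : Fin k → (Fin k → K) // LinearIndependent K s } := by
    intro U hU
    let e : U ≃ₗ[K] (Fin k → K) := LinearEquiv.ofFinrankEq _ _ (by simp [hU])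
    refine Nat.card_congr ((Equiv.piCongrRight (fun _ : Fin k => e.toEquiv)).subtypeEquiv ?_)
    intro s
    exact (e.toLinearMap.linearIndependent_iff (v := s) (by simp)).symm
  have hspan : ∀ s : Fin k → V, LinearIndependent K (S.mkQ ∘ s) →
      finrank K (Submodule.span K (Set.range s)) = k ∧ Submodule.span K (Set.range s) ⊓ S = ⊥ := by
    intro s hs
    have h1 : LinearIndependent K s := LinearIndependent.of_comp S.mkQ hs
    refine ⟨by simpa using finrank_span_eq_card h1, ?_⟩
    have := hs.of_comp
    have h2 : Disjoint (Submodule.span K (Set.range s)) (LinearMap.ker S.mkQ) := 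
      Submodule.range_ker_disjoint hs
    rw [Submodule.ker_mkQ] at h2
    exact h2.eq_bot
  let e : { s : Fin k → V // LinearIndependent K (S.mkQ ∘ s) } ≃
      Σ U : {U : Submodule K V // finrank K U = k ∧ U ⊓ S = ⊥},
        { s : Fin k → U.1 // LinearIndependent K s } :=
    { toFun := fun s => ⟨⟨Submodule.span K (Set.range s.1), hspan s.1 s.2⟩,
        ⟨fun i => ⟨s.1 i, Submodule.subset_span ⟨i, rfl⟩⟩, by
          have h1 : LinearIndependent K s.1 := LinearIndependent.of_comp S.mkQ s.2
          exact LinearIndependent.of_comp (Submodule.subtype _) h1⟩⟩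
      invFun := fun p => ⟨fun i => (p.2.1 i : V), by
        have h1 : LinearIndependent K (p.1.1.subtype ∘ p.2.1) :=
          p.2.2.map' _ (by simp)
        refine h1.map ?_
        rw [Submodule.ker_mkQ]
        refine Disjoint.mono_left ?_ (disjoint_iff.mpr p.1.2.2)
        rw [Submodule.span_le]
        rintro _ ⟨i, rfl⟩
        exact (p.2.1 i).2⟩
      left_inv := fun s => rfl
      right_inv := by
        have hU : ∀ (U : Submodule K V), finrank K U = k → ∀ (s : Fin k → U),
            LinearIndependent K s →
            Submodule.span K (Set.range (fun i => (s i : V))) = U := by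
          intro U hU s hs
          have h1 : LinearIndependent K (U.subtype ∘ s) := hs.map' _ (by simp)
          apply Submodule.eq_of_le_of_finrank_eq
          · rw [Submodule.span_le]
            rintro _ ⟨i, rfl⟩
            exact (s i).2
          · have := finrank_span_eq_card h1
            simp at this
            exact this.trans hU.symm
        apply Function.LeftInverse.rightInverse_of_injective (fun s => rfl)
        rintro ⟨⟨U, h1, h2⟩, s, hs⟩ ⟨⟨U', h1', h2'⟩, s', hs'⟩ h
        replace h : (fun i => (s i : V)) = fun i => (s' i : V) := congrArg Subtype.val h
        have e1 := hU U h1 s hs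
        have e2 := hU U' h1' s' hs'
        have e3 : U = U' := by rw [← e1, ← e2, h]
        subst e3
        have : s = s' := by
          funext i
          exact Subtype.ext (congrFun h i)
        subst this
        rfl }
  have := Fintype.ofFinite {U : Submodule K V // finrank K U = k ∧ U ⊓ S = ⊥}
  rw [Nat.card_congr e, Nat.card_sigma]
  rw [Finset.sum_congr rfl (fun U _ => key U.1 U.2.1)]
  simp

theorem q_gt_one : (1:ℝ) < Nat.card K := by
  exact_mod_cast Finite.one_lt_card

theorem card_disj (S : Submodule K V) (k : ℕ) :
    (Nat.card {U : Submodule K V // finrank K U = k ∧ U ⊓ S = ⊥} : ℝ) =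
      (Nat.card K : ℝ) ^ (finrank K S * k) * gc (Nat.card K) (finrank K V - finrank K S) k := by
  have h1 := card_LI_mk S k
  rw [card_disj_mul] at h1
  have h2 : (Nat.card {U : Submodule K V // finrank K U = k ∧ U ⊓ S = ⊥} : ℝ) *
     Nat.card { s : Fin k → (Fin k → K) // LinearIndependent K s } = 
     Nat.card { s : Fin k → V ⧸ S // LinearIndependent K s } * (Nat.card S : ℝ) ^ k := by
    exact_mod_cast h1
  have : Finite (V ⧸ S) := Quotient.finite _
  rw [card_LI, card_LI, Submodule.finrank_quotient] at h2
  have hS : Nat.card S = Nat.card K ^ finrank K S := Module.natCard_eq_pow_finrank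
  rw [hS] at h2
  simp only [finrank_fintype_fun_eq_card, Fintype.card_fin] at h2
  have hq := q_gt_one (K := K)
  have hne : ∏ i ∈ Finset.range k, ((Nat.card K : ℝ) ^ k - (Nat.card K : ℝ) ^ i) ≠ 0 := by
    rw [Finset.prod_ne_zero_iff]
    intro i hi
    have := pow_lt_pow_right₀ hq (Finset.mem_range.mp hi)
    linarith
  rw [gc, Finset.prod_div_distrib, ← mul_div_assoc, eq_div_iff hne, h2]
  push_cast
  rw [pow_mul]; ring

theorem card_disj_above (E S : Submodule K V) (k : ℕ) (hES : E ⊓ S = ⊥) (hk : finrank K E ≤ k) :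
    (Nat.card {U : Submodule K V // finrank K U = k ∧ E ≤ U ∧ U ⊓ S = ⊥} : ℝ) =
      (Nat.card K : ℝ) ^ (finrank K S * (k - finrank K E)) *
        gc (Nat.card K) (finrank K V - finrank K E - finrank K S) (k - finrank K E) := by
  have : Finite (V ⧸ E) := Quotient.finite _
  have hmap : finrank K (S.map E.mkQ) = finrank K S := by
    have h := LinearMap.finrank_range_add_finrank_ker (E.mkQ.domRestrict S)
    have h2 : LinearMap.ker (E.mkQ.domRestrict S) = ⊥ := by
      rw [LinearMap.ker_eq_bot']
      intro x hx
      have h3 : (x : V) ∈ E := by simpa using hx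
      have h4 : (x : V) ∈ E ⊓ S := ⟨h3, x.2⟩
      rw [hES] at h4
      simpa using h4
    rw [h2, LinearMap.range_domRestrict] at h
    simpa using h
  have h := card_disj (S.map E.mkQ) (k - finrank K E)
  rw [hmap, Submodule.finrank_quotient] at h
  rw [← h]
  congr 1
  have hfin : ∀ U' : Submodule K (V ⧸ E), finrank K (U'.comap E.mkQ) = finrank K U' + finrank K E := by
    intro U'
    have h := LinearMap.finrank_range_add_finrank_ker (E.mkQ.domRestrict (U'.comap E.mkQ))
    rw [LinearMap.range_domRestrict, Submodule.map_comap_eq_of_surjective E.mkQ_surjective] at h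
    rw [← h]
    congr 1
    rw [LinearMap.ker_domRestrict, Submodule.ker_mkQ]
    have hle : E ≤ U'.comap E.mkQ := by
      intro x hx
      have : E.mkQ x = 0 := by simpa using hx
      simp only [Submodule.mem_comap, this, zero_mem]
    exact (Submodule.comapSubtypeEquivOfLe hle).finrank_eq
  have hdisj : ∀ U' : Submodule K (V ⧸ E), U'.comap E.mkQ ⊓ S = ⊥ ↔ U' ⊓ S.map E.mkQ = ⊥ := by
    intro U'
    rw [Submodule.eq_bot_iff, Submodule.eq_bot_iff]
    constructor
    · rintro h x ⟨hx, y, hy, rfl⟩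
      rw [h y ⟨hx, hy⟩, map_zero]
    · rintro h x ⟨hx, hy⟩
      have h1 := h (E.mkQ x) ⟨hx, x, hy, rfl⟩
      have h3 : x ∈ E := by simpa using h1
      have h4 : x ∈ E ⊓ S := ⟨h3, hy⟩
      rw [hES] at h4
      simpa using h4
  refine Nat.card_congr
    { toFun := fun U => ⟨U.1.map E.mkQ, ?_⟩
      invFun := fun U' => ⟨U'.1.comap E.mkQ, ?_, ?_, ?_⟩
      left_inv := ?_
      right_inv := ?_ }
  · have h1 : (U.1.map E.mkQ).comap E.mkQ = U.1 := by
      rw [Submodule.comap_map_mkQ]; exact sup_eq_right.mpr U.2.2.1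
    have h2 := hfin (U.1.map E.mkQ)
    rw [h1, U.2.1] at h2
    refine ⟨by omega, ?_⟩
    rw [← hdisj, h1]; exact U.2.2.2
  · have := hfin U'.1
    have := U'.2.1
    omega
  · intro x hx
    have : E.mkQ x = 0 := by simpa using hx
    simp only [Submodule.mem_comap, this, zero_mem]
  · rw [hdisj]; exact U'.2.2
  · intro U
    ext1
    simp only [Submodule.comap_map_mkQ]; exact sup_eq_right.mpr U.2.2.1
  · intro U'
    ext1
    exact Submodule.map_comap_eq_of_surjective E.mkQ_surjective _

theorem card_disj_between (E S M : Submodule K V) (k : ℕ) (hES : E ⊓ S = ⊥) (hk : finrank K E ≤ k)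
    (hE : E ≤ M) (hS : S ≤ M) :
    (Nat.card {U : Submodule K V // finrank K U = k ∧ E ≤ U ∧ U ≤ M ∧ U ⊓ S = ⊥} : ℝ) =
      (Nat.card K : ℝ) ^ (finrank K S * (k - finrank K E)) *
        gc (Nat.card K) (finrank K M - finrank K E - finrank K S) (k - finrank K E) := by
  have e1 : finrank K (E.comap M.subtype) = finrank K E :=
    (Submodule.comapSubtypeEquivOfLe hE).finrank_eq
  have e2 : finrank K (S.comap M.subtype) = finrank K S :=
    (Submodule.comapSubtypeEquivOfLe hS).finrank_eq
  have h := card_disj_above (E.comap M.subtype) (S.comap M.subtype) k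
    (by rw [← Submodule.comap_inf, hES]; simp) (by rw [e1]; exact hk)
  rw [e1, e2] at h
  rw [← h]
  congr 1
  have hinj : Function.Injective M.subtype := M.injective_subtype
  have hmc : ∀ U ≤ M, (U.comap M.subtype).map M.subtype = U := by
    intro U hU
    rw [Submodule.map_comap_subtype]; exact inf_eq_right.mpr hU
  refine Nat.card_congr
    { toFun := fun U => ⟨U.1.comap M.subtype, ?_, ?_, ?_⟩
      invFun := fun U' => ⟨U'.1.map M.subtype, ?_, ?_, ?_, ?_⟩
      left_inv := ?_
      right_inv := ?_ }
  · rw [(Submodule.comapSubtypeEquivOfLe U.2.2.2.1).finrank_eq]; exact U.2.1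
  · exact Submodule.comap_mono U.2.2.1
  · rw [← Submodule.comap_inf, U.2.2.2.2]; simp
  · rw [Submodule.finrank_map_subtype_eq]; exact U'.2.1
  · have := Submodule.map_mono (f := M.subtype) U'.2.2.1
    rwa [hmc E hE] at this
  · exact Submodule.map_subtype_le _ _
  · have := congrArg (Submodule.map M.subtype) U'.2.2.2
    rw [Submodule.map_inf _ hinj, hmc S hS] at this
    rw [this]; simp
  · intro U
    ext1
    exact hmc _ U.2.2.2.1
  · intro U'
    ext1
    exact Submodule.comap_map_eq_of_injective hinj _

end counting

end Part1

section Part2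
open Module Finset
set_option linter.unusedSectionVars false

section gcfacts
theorem gc_zero_right (q n : ℕ) : gc q n 0 = 1 := by simp [gc]

theorem gc_eq_zero (q : ℕ) {n k : ℕ} (h : n < k) : gc q n k = 0 := by
  rw [gc]
  exact Finset.prod_eq_zero (i := n) (by simpa using h) (by simp)

theorem qpow_sub_pos {q : ℕ} (hq : 2 ≤ q) {a b : ℕ} (h : a < b) : 0 < (q:ℝ) ^ b - (q:ℝ) ^ a := by
  have : (1:ℝ) < q := by exact_mod_cast hq
  have := pow_lt_pow_right₀ this h
  linarith

theorem gc_pos {q : ℕ} (hq : 2 ≤ q) {n k : ℕ} (h : k ≤ n) : 0 < gc q n k := by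
  rw [gc]
  refine Finset.prod_pos fun i hi => ?_
  have := Finset.mem_range.mp hi
  exact div_pos (qpow_sub_pos hq (by omega)) (qpow_sub_pos hq this)

theorem gc_den_succ (q i : ℕ) : ∏ s ∈ Finset.range (i+1), ((q:ℝ) ^ (i+1) - (q:ℝ) ^ s) =
    ((q:ℝ)^(i+1) - 1) * (q:ℝ)^i * ∏ s ∈ Finset.range i, ((q:ℝ) ^ i - (q:ℝ) ^ s) := by
  rw [Finset.prod_range_succ']
  have : ∀ s ∈ Finset.range i, ((q:ℝ) ^ (i+1) - (q:ℝ) ^ (s+1)) = q * ((q:ℝ) ^ i - (q:ℝ) ^ s) := by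
    intro s _; ring
  rw [Finset.prod_congr rfl this, Finset.prod_mul_distrib]
  simp; ring

theorem gc_succ_succ {q : ℕ} (hq : 2 ≤ q) (l i : ℕ) :
    gc q (l+1) (i+1) = ((q:ℝ)^(l+1) - 1) / ((q:ℝ)^(i+1) - 1) * gc q l i := by
  rw [gc, gc, Finset.prod_div_distrib, Finset.prod_div_distrib, gc_den_succ]
  have hnum : ∏ s ∈ Finset.range (i+1), ((q:ℝ) ^ (l+1) - (q:ℝ) ^ s) =
    ((q:ℝ)^(l+1) - 1) * (q:ℝ)^i * ∏ s ∈ Finset.range i, ((q:ℝ) ^ l - (q:ℝ) ^ s) := by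
    rw [Finset.prod_range_succ']
    have : ∀ s ∈ Finset.range i, ((q:ℝ) ^ (l+1) - (q:ℝ) ^ (s+1)) = q * ((q:ℝ) ^ l - (q:ℝ) ^ s) := by
      intro s _; ring
    rw [Finset.prod_congr rfl this, Finset.prod_mul_distrib]
    simp; ring
  rw [hnum]
  have h0 : (q:ℝ)^i ≠ 0 := by positivity
  rw [mul_right_comm, mul_right_comm ((q:ℝ)^(i+1) - 1), mul_div_mul_right _ _ h0, mul_div_mul_comm]

theorem gc_succ_right {q : ℕ} (hq : 2 ≤ q) (l i : ℕ) :
    gc q l (i+1) = ((q:ℝ)^l - (q:ℝ)^i) / (((q:ℝ)^(i+1) - 1) * (q:ℝ)^i) * gc q l i := by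
  rw [gc, gc, Finset.prod_div_distrib, Finset.prod_div_distrib, gc_den_succ, Finset.prod_range_succ,
    mul_comm (∏ s ∈ Finset.range i, ((q:ℝ) ^ l - (q:ℝ) ^ s)), mul_div_mul_comm]

theorem gc_pascal {q : ℕ} (hq : 2 ≤ q) (l i : ℕ) :
    gc q (l+1) (i+1) = gc q l i + (q:ℝ)^(i+1) * gc q l (i+1) := by
  rw [gc_succ_succ hq, gc_succ_right hq]
  have h1 := qpow_sub_pos hq (Nat.succ_pos i)
  simp only [pow_zero, Nat.succ_eq_add_one] at h1
  have h0 : (q:ℝ)^i ≠ 0 := by positivity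
  field_simp
  ring

theorem gc_alt_partial {q : ℕ} (hq : 2 ≤ q) (l e : ℕ) :
    ∑ i ∈ Finset.range (e+1), (-1:ℝ)^i * (q:ℝ)^(i.choose 2) * gc q (l+1) i =
    (-1)^e * (q:ℝ)^((e+1).choose 2) * gc q l e := by
  induction e with
  | zero => simp [gc_zero_right]
  | succ e ih =>
    rw [Finset.sum_range_succ, ih, gc_pascal hq]
    have : (e+1+1).choose 2 = (e+1).choose 2 + (e+1) := by
      rw [Nat.choose_succ_succ' (e+1) 1]; simp; ring
    rw [this]; ring

theorem gc_mobius {q : ℕ} (hq : 2 ≤ q) {l e : ℕ} (h : l ≤ e) :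
    ∑ i ∈ Finset.range (e+1), (-1:ℝ)^i * (q:ℝ)^(i.choose 2) * gc q l i =
     if l = 0 then 1 else 0 := by
  rcases l with _ | l
  · rw [Finset.sum_range_succ']
    simp only [if_true]
    rw [Finset.sum_eq_zero]
    · simp [gc_zero_right]
    · intro i _
      rw [gc_eq_zero q (Nat.succ_pos i)]; simp
  · rw [gc_alt_partial hq, gc_eq_zero q (by omega)]; simp

/-- unnormalised q-factorial -/
noncomputable def qf (q a : ℕ) : ℝ := ∏ s ∈ Finset.range a, ((q:ℝ)^(s+1) - 1)

theorem qf_pos {q : ℕ} (hq : 2 ≤ q) (a : ℕ) : 0 < qf q a := by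
  rw [qf]
  refine Finset.prod_pos fun s _ => ?_
  have h1 := qpow_sub_pos hq (Nat.succ_pos s)
  simpa using h1

theorem gc_eq_qf {q : ℕ} (hq : 2 ≤ q) (a b : ℕ) : gc q (a+b) b = qf q (a+b) / (qf q a * qf q b) := by
  induction b with
  | zero => 
    have := (qf_pos hq a).ne'
    simp [gc_zero_right, qf]
    rw [qf] at this; field_simp
  | succ b ih =>
    rw [← add_assoc, gc_succ_succ hq, ih]
    have e1 : qf q (a+b+1) = qf q (a+b) * ((q:ℝ)^(a+b+1)-1) := by rw [qf, Finset.prod_range_succ, ← qf]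
    have e2 : qf q (b+1) = qf q (b) * ((q:ℝ)^(b+1)-1) := by rw [qf, Finset.prod_range_succ, ← qf]
    rw [e1, e2]
    have h1 := qpow_sub_pos hq (Nat.succ_pos b)
    simp only [pow_zero, Nat.succ_eq_add_one] at h1
    have := qf_pos hq a
    have := qf_pos hq b
    field_simp

theorem gaussBinom_eq {q : ℕ} (hq : 2 ≤ q) {n k : ℕ} (hk : k ≤ n) {c : ℕ} (hc : (c:ℝ) = gc q n k) :
    (∏ i ∈ Finset.range k, (q ^ (n - i) - 1)) / ∏ i ∈ Finset.range k, (q ^ (k - i) - 1) = c := by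
  have hpos : 0 < ∏ i ∈ Finset.range k, (q ^ (k - i) - 1) := by
    refine Finset.prod_pos fun i hi => ?_
    have := Finset.mem_range.mp hi
    have : 1 < q ^ (k-i) := Nat.one_lt_pow (by omega) (by omega)
    omega
  apply Nat.div_eq_of_eq_mul_left hpos
  have : ((∏ i ∈ Finset.range k, (q ^ (n - i) - 1) : ℕ) : ℝ) =
      c * ((∏ i ∈ Finset.range k, (q ^ (k - i) - 1) : ℕ) : ℝ) := by
    rw [hc, gc]
    push_cast
    rw [← Finset.prod_mul_distrib]
    refine Finset.prod_congr rfl fun i hi => ?_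
    have hik := Finset.mem_range.mp hi
    have h1 : 1 ≤ q ^ (n-i) := Nat.one_le_pow _ _ (by omega)
    have h2 : 1 ≤ q ^ (k-i) := Nat.one_le_pow _ _ (by omega)
    rw [Nat.cast_sub h1, Nat.cast_sub h2]
    push_cast
    have e1 : (q:ℝ)^n = (q:ℝ)^(n-i) * (q:ℝ)^i := by rw [← pow_add]; congr 1; omega
    have e2 : (q:ℝ)^k = (q:ℝ)^(k-i) * (q:ℝ)^i := by rw [← pow_add]; congr 1; omega
    have h3 := qpow_sub_pos hq (show 0 < k - i by omega)
    rw [pow_zero] at h3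
    rw [e1, e2]
    have : (q:ℝ)^i ≠ 0 := by positivity
    have e3 : ∀ x : ℝ, x * (q:ℝ)^i - (q:ℝ)^i = (x - 1) * (q:ℝ)^i := by intro x; ring
    rw [e3, e3, mul_div_mul_right _ _ this]
    field_simp
  exact_mod_cast this
end gcfacts

noncomputable def ind (p : Prop) : ℝ := open Classical in if p then 1 else 0

theorem ind_true {p : Prop} (h : p) : ind p = 1 := by simp [ind, h]
theorem ind_false {p : Prop} (h : ¬ p) : ind p = 0 := by simp [ind, h]
theorem ind_and (p r : Prop) : ind (p ∧ r) = ind p * ind r := by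
  by_cases hp : p <;> by_cases hr : r <;> simp [ind, hp, hr]
theorem ind_congr {p r : Prop} (h : p ↔ r) : ind p = ind r := by
  rw [propext h]

section eig
variable {K V : Type*} [Field K] [Finite K] [AddCommGroup V] [Module K V] [Finite V]

variable (K V) in
noncomputable def Gr (d : ℕ) : Finset (Submodule K V) :=
  (Set.toFinite {U : Submodule K V | finrank K U = d}).toFinset

theorem mem_Gr {d : ℕ} {U : Submodule K V} : U ∈ Gr K V d ↔ finrank K U = d := by simp [Gr]

theorem sum_ind (d : ℕ) (p : Submodule K V → Prop) :
    ∑ U ∈ Gr K V d, ind (p U) = Nat.card {U : Submodule K V // finrank K U = d ∧ p U} := by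
  classical
  have : ∀ U ∈ Gr K V d, ind (p U) = if p U then 1 else 0 := by
    intro U _; unfold ind; congr
  rw [Finset.sum_congr rfl this, Finset.sum_boole]
  congr 1
  symm
  apply Nat.subtype_card
  intro U
  simp [mem_Gr]

noncomputable def up (e : ℕ) (g : Submodule K V → ℝ) (U : Submodule K V) : ℝ :=
  ∑ E ∈ Gr K V e, ind (E ≤ U) * g E

def Harm (e : ℕ) (g : Submodule K V → ℝ) : Prop :=
  ∀ i < e, ∀ X ∈ Gr K V i, ∑ E ∈ Gr K V e, ind (X ≤ E) * g E = 0

theorem two_le_q : 2 ≤ Nat.card K := Finite.one_lt_card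

theorem count_le (Z : Submodule K V) (i : ℕ) :
    ∑ X ∈ Gr K V i, ind (X ≤ Z) = gc (Nat.card K) (finrank K Z) i := by
  rw [sum_ind]
  have h := card_disj_between (⊥ : Submodule K V) ⊥ Z i (by simp) (by simp) bot_le bot_le
  simpa using h

theorem lemA {e : ℕ} {g : Submodule K V → ℝ} (hg : Harm e g) {S : Submodule K V} :
    ∑ E ∈ Gr K V e, ind (E ⊓ S = ⊥) * g E =
      (-1)^e * (Nat.card K:ℝ)^(e.choose 2) * up e g S := by
  have h1 : ∀ E ∈ Gr K V e, ind (E ⊓ S = ⊥) * g E = ∑ i ∈ Finset.range (e+1),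
      (-1:ℝ)^i * (Nat.card K:ℝ)^(i.choose 2) *
        ∑ X ∈ Gr K V i, ind (X ≤ S) * (ind (X ≤ E) * g E) := by
    intro E hE
    have hE := mem_Gr.mp hE
    have h2 := gc_mobius (two_le_q (K := K)) (l := finrank K ↥(E ⊓ S)) (e := e)
      (hE ▸ Submodule.finrank_mono inf_le_left)
    have h3 : ind (E ⊓ S = ⊥) = if finrank K ↥(E ⊓ S) = 0 then 1 else 0 := by
      by_cases h : E ⊓ S = ⊥
      · simp [ind, h]
      · rw [ind_false h, if_neg]
        rwa [Submodule.finrank_eq_zero]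
    rw [h3, ← h2, Finset.sum_mul]
    refine Finset.sum_congr rfl fun i _ => ?_
    rw [← count_le, mul_assoc, Finset.sum_mul]
    congr 1
    refine Finset.sum_congr rfl fun X _ => ?_
    rw [ind_congr le_inf_iff, ind_and]; ring
  rw [Finset.sum_congr rfl h1, Finset.sum_comm, Finset.sum_range_succ, Finset.sum_eq_zero, zero_add]
  · rw [← Finset.mul_sum, Finset.sum_comm]
    congr 1
    rw [up]
    refine Finset.sum_congr rfl fun X hX => ?_
    rw [← Finset.mul_sum]
    congr 1
    rw [Finset.sum_eq_single X]
    · rw [ind_true le_rfl, one_mul]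
    · intro E hE hne
      rw [ind_false, zero_mul]
      intro hle
      exact hne (Submodule.eq_of_le_of_finrank_eq hle ((mem_Gr.mp hX).trans (mem_Gr.mp hE).symm)).symm
    · intro h; exact absurd hX h
  · intro i hi
    rw [← Finset.mul_sum, Finset.sum_comm]
    rw [Finset.sum_eq_zero, mul_zero]
    intro X hX
    rw [← Finset.mul_sum, hg i (Finset.mem_range.mp hi) X hX, mul_zero]

theorem lemB {e j k : ℕ} (g : Submodule K V → ℝ) {S : Submodule K V} (hS : S ∈ Gr K V j)
    (hek : e ≤ k) :
    ∑ U ∈ Gr K V k, ind (U ⊓ S = ⊥) * up e g U =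
     (Nat.card K:ℝ)^(j*(k-e)) * gc (Nat.card K) (finrank K V - e - j) (k-e) *
      ∑ E ∈ Gr K V e, ind (E ⊓ S = ⊥) * g E := by
  simp only [up, Finset.mul_sum]
  rw [Finset.sum_comm]
  refine Finset.sum_congr rfl fun E hE => ?_
  have hE' := mem_Gr.mp hE
  have h1 : ∀ U ∈ Gr K V k, ind (U ⊓ S = ⊥) * (ind (E ≤ U) * g E) =
      ind (E ≤ U ∧ U ⊓ S = ⊥) * g E := by
    intro U _; rw [ind_and]; ring
  rw [Finset.sum_congr rfl h1, ← Finset.sum_mul, sum_ind]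
  by_cases h : E ⊓ S = ⊥
  · rw [card_disj_above E S k h (by omega), ind_true h, hE', mem_Gr.mp hS]; ring
  · rw [ind_false h]
    have : IsEmpty {U : Submodule K V // finrank K U = k ∧ E ≤ U ∧ U ⊓ S = ⊥} := by
      refine ⟨fun U => h ?_⟩
      rw [eq_bot_iff, ← U.2.2.2]
      exact inf_le_inf_right _ U.2.2.1
    simp

theorem lemC {e j k : ℕ} (g : Submodule K V → ℝ) {U : Submodule K V} (hU : U ∈ Gr K V k)
    (hej : e ≤ j) :
    ∑ S ∈ Gr K V j, ind (S ≤ U) * up e g S = gc (Nat.card K) (k-e) (j-e) * up e g U := by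
  simp only [up, Finset.mul_sum]
  rw [Finset.sum_comm]
  refine Finset.sum_congr rfl fun E hE => ?_
  have hE' := mem_Gr.mp hE
  have h1 : ∀ S ∈ Gr K V j, ind (S ≤ U) * (ind (E ≤ S) * g E) =
      ind (E ≤ S ∧ S ≤ U ∧ S ⊓ ⊥ = ⊥) * g E := by
    intro U _; rw [ind_and, ind_and, ind_true (p := _ ⊓ ⊥ = ⊥) (by simp)]; ring
  rw [Finset.sum_congr rfl h1, ← Finset.sum_mul, sum_ind]
  by_cases h : E ≤ U
  · rw [card_disj_between E ⊥ U j (by simp) (by omega) h bot_le, ind_true h, hE', mem_Gr.mp hU]; simp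
  · rw [ind_false h]
    have : IsEmpty {S : Submodule K V // finrank K S = j ∧ E ≤ S ∧ S ≤ U ∧ S ⊓ ⊥ = ⊥} := by
      refine ⟨fun S => h (S.2.2.1.trans S.2.2.2.1)⟩
    rw [Nat.card_of_isEmpty]; simp

theorem up_eq_zero {e j : ℕ} (g : Submodule K V → ℝ) {S : Submodule K V} (hS : S ∈ Gr K V j)
    (hej : j < e) : up e g S = 0 := by
  rw [up]
  refine Finset.sum_eq_zero fun E hE => ?_
  rw [ind_false, zero_mul]
  intro h
  have := Submodule.finrank_mono h
  rw [mem_Gr.mp hS, mem_Gr.mp hE] at this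
  omega

noncomputable def bb (j : ℕ) (U U' : Submodule K V) : ℝ :=
  ∑ S ∈ Gr K V j, ind (S ≤ U') * ind (U ⊓ S = ⊥)

noncomputable def lam (q n k j e : ℕ) : ℝ :=
  if e ≤ j then (-1)^e * (q:ℝ)^(e.choose 2 + j*(k-e)) * gc q (n-e-j) (k-e) * gc q (k-e) (j-e) else 0

theorem eigen {e j k : ℕ} {g : Submodule K V → ℝ} (hg : Harm e g) (hek : e ≤ k)
    {U' : Submodule K V} (hU' : U' ∈ Gr K V k) :
    ∑ U ∈ Gr K V k, bb j U U' * up e g U =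
      lam (Nat.card K) (finrank K V) k j e * up e g U' := by
  have h1 : ∑ U ∈ Gr K V k, bb j U U' * up e g U = ∑ S ∈ Gr K V j, ind (S ≤ U') *
      ∑ U ∈ Gr K V k, ind (U ⊓ S = ⊥) * up e g U := by
    simp only [bb, Finset.sum_mul, Finset.mul_sum]
    rw [Finset.sum_comm]
    refine Finset.sum_congr rfl fun S _ => Finset.sum_congr rfl fun U _ => ?_
    ring
  have h2 : ∀ S ∈ Gr K V j, ind (S ≤ U') *
      ∑ U ∈ Gr K V k, ind (U ⊓ S = ⊥) * up e g U =
      ((Nat.card K:ℝ)^(j*(k-e)) * gc (Nat.card K) (finrank K V - e - j) (k-e) *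
      ((-1)^e * (Nat.card K:ℝ)^(e.choose 2))) * (ind (S ≤ U') * up e g S) := by
    intro S hS
    rw [lemB g hS hek, lemA hg]; ring
  rw [h1, Finset.sum_congr rfl h2, ← Finset.mul_sum, lam]
  split_ifs with h
  · rw [lemC g hU' h, pow_add]; ring
  · rw [Finset.sum_eq_zero]
    · simp
    · intro S hS
      rw [up_eq_zero g hS (by omega), mul_zero]

theorem bb_eq {j k : ℕ} {U U' : Submodule K V} (hU' : U' ∈ Gr K V k) :
    bb j U U' = (Nat.card K:ℝ)^(finrank K ↥(U ⊓ U') * j) *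
      gc (Nat.card K) (k - finrank K ↥(U ⊓ U')) j := by
  have h1 : ∀ S ∈ Gr K V j, ind (S ≤ U') * ind (U ⊓ S = ⊥) =
      ind (⊥ ≤ S ∧ S ≤ U' ∧ S ⊓ (U ⊓ U') = ⊥) := by
    intro S _
    rw [← ind_and]
    apply ind_congr
    simp only [bot_le, true_and]
    refine and_congr_right fun h => ?_
    have : S ⊓ (U ⊓ U') = U ⊓ S := by
      rw [inf_comm U U', ← inf_assoc, inf_eq_left.mpr h, inf_comm]
    rw [this]
  rw [bb, Finset.sum_congr rfl h1, sum_ind,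
    card_disj_between ⊥ (U ⊓ U') U' j (by simp) (by simp) bot_le inf_le_right, mem_Gr.mp hU']
  simp

theorem bb_symm {j k : ℕ} {U U' : Submodule K V} (hU : U ∈ Gr K V k) (hU' : U' ∈ Gr K V k) :
    bb j U U' = bb j U' U := by
  rw [bb_eq hU', bb_eq hU, inf_comm]

theorem orth {e e' k : ℕ} {g g' : Submodule K V → ℝ} (hg : Harm e g) (hg' : Harm e' g')
    (he : e < e') (hek : e' ≤ k) (hn : 2 * k ≤ finrank K V) :
    ∑ U ∈ Gr K V k, up e g U * up e' g' U = 0 := by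
  have h1 : ∑ U ∈ Gr K V k, ∑ U' ∈ Gr K V k, (bb e U U' * up e g U) * up e' g' U' =
      lam (Nat.card K) (finrank K V) k e e * ∑ U ∈ Gr K V k, up e g U * up e' g' U := by
    rw [Finset.sum_comm, Finset.mul_sum]
    refine Finset.sum_congr rfl fun U' hU' => ?_
    rw [← Finset.sum_mul, eigen hg (by omega) hU', mul_assoc]
  have h2 : ∑ U ∈ Gr K V k, ∑ U' ∈ Gr K V k, (bb e U U' * up e g U) * up e' g' U' = 0 := by
    refine Finset.sum_eq_zero fun U hU => ?_
    have : ∀ U' ∈ Gr K V k, (bb e U U' * up e g U) * up e' g' U' =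
        up e g U * (bb e U' U * up e' g' U') := by
      intro U' hU'
      rw [bb_symm hU hU']; ring
    rw [Finset.sum_congr rfl this, ← Finset.mul_sum, eigen hg' hek hU, lam, if_neg (by omega)]
    simp
  have h3 : lam (Nat.card K) (finrank K V) k e e ≠ 0 := by
    have hq := two_le_q (K := K)
    have := gc_pos hq (show k - e ≤ finrank K V - e - e by omega)
    have hq0 : (Nat.card K : ℝ) ≠ 0 := by positivity
    rw [lam, if_pos le_rfl, Nat.sub_self, gc_zero_right]
    simp [this.ne', hq0]
  rw [h2] at h1
  exact (mul_eq_zero.mp h1.symm).resolve_left h3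

end eig

end Part2

section Part3
open Module Finset
set_option linter.unusedSectionVars false

section dec
variable {K V : Type*} [Field K] [Finite K] [AddCommGroup V] [Module K V] [Finite V]

theorem Harm.add {e : ℕ} {g g' : Submodule K V → ℝ} (h : Harm e g) (h' : Harm e g') :
    Harm e (g + g') := by
  intro i hi X hX
  simp only [Pi.add_apply, mul_add, Finset.sum_add_distrib, h i hi X hX, h' i hi X hX, add_zero]

theorem Harm.smul {e : ℕ} {g : Submodule K V → ℝ} (h : Harm e g) (c : ℝ) : Harm e (c • g) := by
  intro i hi X hX
  have : ∀ E ∈ Gr K V e, ind (X ≤ E) * (c • g) E = c * (ind (X ≤ E) * g E) := by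
    intro E _; simp only [Pi.smul_apply, smul_eq_mul]; ring
  rw [Finset.sum_congr rfl this, ← Finset.mul_sum, h i hi X hX, mul_zero]

theorem Harm.zero (e : ℕ) : Harm e (0 : Submodule K V → ℝ) := by
  intro i hi X hX; simp

theorem up_add (e : ℕ) (g g' : Submodule K V → ℝ) (U) : up e (g+g') U = up e g U + up e g' U := by
  simp only [up, Pi.add_apply, mul_add, Finset.sum_add_distrib]

theorem up_smul (e : ℕ) (c : ℝ) (g : Submodule K V → ℝ) (U) : up e (c • g) U = c * up e g U := by
  simp only [up, Pi.smul_apply, smul_eq_mul, Finset.mul_sum]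
  exact Finset.sum_congr rfl fun _ _ => by ring

theorem up_zero (e : ℕ) (U : Submodule K V) : up e 0 U = 0 := by simp [up]

theorem up_self {e : ℕ} (g : Submodule K V → ℝ) {U : Submodule K V} (hU : U ∈ Gr K V e) :
    up e g U = g U := by
  rw [up, Finset.sum_eq_single U]
  · rw [ind_true le_rfl, one_mul]
  · intro E hE hne
    rw [ind_false, zero_mul]
    intro hle
    exact hne (Submodule.eq_of_le_of_finrank_eq hle ((mem_Gr.mp hE).trans (mem_Gr.mp hU).symm))
  · intro h; exact absurd hU h

def Dec (k e : ℕ) (f : Submodule K V → ℝ) : Prop :=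
  ∃ h : ℕ → Submodule K V → ℝ, (∀ i, Harm i (h i)) ∧
    ∀ U ∈ Gr K V k, f U = ∑ i ∈ Finset.range (e+1), up i (h i) U

theorem Dec.add {k e : ℕ} {f f' : Submodule K V → ℝ} (h : Dec k e f) (h' : Dec k e f') :
    Dec k e (f + f') := by
  obtain ⟨g, hg, h⟩ := h
  obtain ⟨g', hg', h'⟩ := h'
  refine ⟨fun i => g i + g' i, fun i => (hg i).add (hg' i), fun U hU => ?_⟩
  simp only [up_add, Finset.sum_add_distrib, Pi.add_apply, h U hU, h' U hU]

theorem Dec.smul {k e : ℕ} {f : Submodule K V → ℝ} (h : Dec k e f) (c : ℝ) :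
    Dec k e (c • f) := by
  obtain ⟨g, hg, h⟩ := h
  refine ⟨fun i => c • g i, fun i => (hg i).smul c, fun U hU => ?_⟩
  simp only [up_smul, ← Finset.mul_sum, Pi.smul_apply, smul_eq_mul, h U hU]

theorem Dec.zero (k e : ℕ) : Dec k e (0 : Submodule K V → ℝ) :=
  ⟨fun _ => 0, fun i => Harm.zero i, fun U _ => by simp [up_zero]⟩

theorem Dec.congr {k e : ℕ} {f f' : Submodule K V → ℝ} (h : Dec k e f)
    (hf : ∀ U ∈ Gr K V k, f' U = f U) : Dec k e f' := by
  obtain ⟨g, hg, h⟩ := h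
  exact ⟨g, hg, fun U hU => (hf U hU).trans (h U hU)⟩

theorem Dec.mono {k e e' : ℕ} {f : Submodule K V → ℝ} (h : Dec k e f) (he : e ≤ e') :
    Dec k e' f := by
  obtain ⟨g, hg, h⟩ := h
  refine ⟨fun i => if i ≤ e then g i else 0, fun i => ?_, fun U hU => ?_⟩
  · dsimp only
    split_ifs
    · exact hg i
    · exact Harm.zero i
  · rw [h U hU]
    rw [← Finset.sum_subset (Finset.range_mono (by omega : e + 1 ≤ e' + 1))]
    · refine Finset.sum_congr rfl fun i hi => ?_
      have hi' := Finset.mem_range.mp hi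
      dsimp only
      rw [if_pos (by omega)]
    · intro i _ hi
      have hi' := Finset.mem_range.not.mp hi
      dsimp only
      rw [if_neg (by omega), up_zero]

theorem Dec.of_harm {k e : ℕ} {g : Submodule K V → ℝ} (hg : Harm e g) : Dec k e (up e g) := by
  refine ⟨fun i => if i = e then g else 0, fun i => ?_, fun U hU => ?_⟩
  · dsimp only
    split_ifs with h
    · rw [h]; exact hg
    · exact Harm.zero i
  · rw [Finset.sum_range_succ, Finset.sum_eq_zero]
    · simp
    · intro i hi
      have hi' := Finset.mem_range.mp hi
      dsimp only
      rw [if_neg (by omega), up_zero]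

theorem Dec.up {k i e : ℕ} {g : Submodule K V → ℝ} (h : Dec i e g) (hei : e ≤ i) :
    Dec k e (up i g) := by
  obtain ⟨h, hh, hg⟩ := h
  refine ⟨fun l => gc (Nat.card K) (k-l) (i-l) • h l, fun l => (hh l).smul _, fun U hU => ?_⟩
  have h1 : _root_.up i g U = ∑ l ∈ Finset.range (e+1), ∑ X ∈ Gr K V i, ind (X ≤ U) * _root_.up l (h l) X := by
    rw [_root_.up, Finset.sum_comm]
    refine Finset.sum_congr rfl fun X hX => ?_
    rw [hg X hX, Finset.mul_sum]
  rw [h1]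
  refine Finset.sum_congr rfl fun l hl => ?_
  rw [lemC (h l) hU (by have := Finset.mem_range.mp hl; omega), up_smul]

open Classical in
noncomputable def extd {e : ℕ} (a : EuclideanSpace ℝ (Gr K V e)) (E : Submodule K V) : ℝ :=
  if h : E ∈ Gr K V e then a ⟨E, h⟩ else 0

theorem dec_all (e : ℕ) (g : Submodule K V → ℝ) : Dec e e g := by
  classical
  induction e using Nat.strong_induction_on generalizing g with
  | _ e ih =>
  let chi (X : Submodule K V) : EuclideanSpace ℝ (Gr K V e) :=
    WithLp.toLp 2 (fun E => ind (X ≤ E.1))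
  let L : Submodule ℝ (EuclideanSpace ℝ (Gr K V e)) :=
    Submodule.span ℝ {v | ∃ i < e, ∃ X ∈ Gr K V i, v = chi X}
  have hL : ∀ a ∈ L, Dec e e (extd a) := by
    intro a ha
    induction ha using Submodule.span_induction with
    | mem v hv =>
      obtain ⟨i, hi, X, hX, rfl⟩ := hv
      have h1 : Dec i i (fun Y => ind (Y = X)) := ih i hi _
      have h2 := (h1.up (k := e) le_rfl).mono hi.le
      refine h2.congr fun U hU => ?_
      rw [extd, dif_pos hU, up, Finset.sum_eq_single X]
      · simp [chi, ind_true]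
      · intro Y _ hne
        rw [ind_false hne, mul_zero]
      · intro h; exact absurd hX h
    | zero => exact (Dec.zero e e).congr fun U hU => by simp [extd]
    | add x y _ _ hx hy => exact (hx.add hy).congr fun U hU => by simp [extd, hU]
    | smul c x _ hx => exact (hx.smul c).congr fun U hU => by simp [extd, hU]
  obtain ⟨a, ha, b, hb, hab⟩ := L.exists_add_mem_mem_orthogonal
    (WithLp.toLp 2 (fun E : Gr K V e => g E.1))
  have hbH : Harm e (extd b) := by
    intro i hi X hX
    have h1 := (Submodule.mem_orthogonal L b).mp hb (chi X) (Submodule.subset_span ⟨i, hi, X, hX, rfl⟩)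
    rw [PiLp.inner_apply, ← Finset.sum_coe_sort (Gr K V e)] at *
    rw [← h1]
    refine Finset.sum_congr rfl fun E _ => ?_
    simp [extd, chi, mul_comm]
  refine ((hL a ha).add (Dec.of_harm (k := e) hbH)).congr fun U hU => ?_
  have h1 := congrArg (fun v : EuclideanSpace ℝ (Gr K V e) => v ⟨U, hU⟩) hab
  simp only [PiLp.add_apply] at h1
  rw [Pi.add_apply, up_self _ hU, extd, extd, dif_pos hU, dif_pos hU, ← h1]

theorem quad {k t s : ℕ} (hs : s ≤ k) (hn : 2 * k ≤ finrank K V) (c : ℕ → ℝ)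
    {f : Submodule K V → ℝ} {h : ℕ → Submodule K V → ℝ} (hh : ∀ i, Harm i (h i))
    (hf : ∀ U ∈ Gr K V k, f U = ∑ i ∈ Finset.range (s+1), up i (h i) U) :
    ∑ U ∈ Gr K V k, f U * f U + ∑ i ∈ Finset.range t, c i *
      ∑ U' ∈ Gr K V k, (∑ U ∈ Gr K V k, bb (k-i) U U' * f U) * f U' =
    ∑ e ∈ Finset.range (s+1), (1 + ∑ i ∈ Finset.range t, c i *
      lam (Nat.card K) (finrank K V) k (k-i) e) * ∑ U ∈ Gr K V k, (up e (h e) U)^2 := by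
  have horth : ∀ e ∈ Finset.range (s+1), ∑ U ∈ Gr K V k, up e (h e) U * f U =
      ∑ U ∈ Gr K V k, (up e (h e) U)^2 := by
    intro e he
    have he' := Finset.mem_range.mp he
    have h1 : ∀ U ∈ Gr K V k, up e (h e) U * f U =
        ∑ i ∈ Finset.range (s+1), up e (h e) U * up i (h i) U := by
      intro U hU; rw [hf U hU, Finset.mul_sum]
    rw [Finset.sum_congr rfl h1, Finset.sum_comm, Finset.sum_eq_single e]
    · exact Finset.sum_congr rfl fun U _ => by ring
    · intro i hi hne
      have hi' := Finset.mem_range.mp hi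
      rcases Nat.lt_or_gt_of_ne hne with hlt | hlt
      · rw [← orth (hh i) (hh e) hlt (by omega) hn]
        exact Finset.sum_congr rfl fun U _ => by ring
      · exact orth (hh e) (hh i) hlt (by omega) hn
    · intro hh; exact absurd he hh
  have hsq : ∑ U ∈ Gr K V k, f U * f U = ∑ e ∈ Finset.range (s+1), ∑ U ∈ Gr K V k, (up e (h e) U)^2 := by
    rw [← Finset.sum_congr rfl horth, Finset.sum_comm]
    refine Finset.sum_congr rfl fun U hU => ?_
    rw [← Finset.sum_mul, ← hf U hU]
  have hb : ∀ i, ∑ U' ∈ Gr K V k, (∑ U ∈ Gr K V k, bb (k-i) U U' * f U) * f U' =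
      ∑ e ∈ Finset.range (s+1), lam (Nat.card K) (finrank K V) k (k-i) e *
        ∑ U ∈ Gr K V k, (up e (h e) U)^2 := by
    intro i
    have hx : ∑ e ∈ Finset.range (s+1), lam (Nat.card K) (finrank K V) k (k-i) e *
        ∑ U ∈ Gr K V k, (up e (h e) U)^2 = ∑ e ∈ Finset.range (s+1), lam (Nat.card K) (finrank K V) k (k-i) e *
        ∑ U ∈ Gr K V k, up e (h e) U * f U :=
      Finset.sum_congr rfl (fun e he => by rw [horth e he])
    rw [hx]
    have hy : ∀ e ∈ Finset.range (s+1), lam (Nat.card K) (finrank K V) k (k-i) e *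
        ∑ U ∈ Gr K V k, up e (h e) U * f U = ∑ U ∈ Gr K V k, lam (Nat.card K) (finrank K V) k (k-i) e *
        (up e (h e) U * f U) := fun e _ => Finset.mul_sum _ _ _
    rw [Finset.sum_congr rfl hy, Finset.sum_comm]
    refine Finset.sum_congr rfl fun U' hU' => ?_
    have : ∑ U ∈ Gr K V k, bb (k-i) U U' * f U = ∑ e ∈ Finset.range (s+1),
        lam (Nat.card K) (finrank K V) k (k-i) e * up e (h e) U' := by
      have h1 : ∀ U ∈ Gr K V k, bb (k-i) U U' * f U =
          ∑ e ∈ Finset.range (s+1), bb (k-i) U U' * up e (h e) U := by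
        intro U hU; rw [hf U hU, Finset.mul_sum]
      rw [Finset.sum_congr rfl h1, Finset.sum_comm]
      refine Finset.sum_congr rfl fun e he => ?_
      have he' := Finset.mem_range.mp he
      exact eigen (hh e) (by omega) hU'
    rw [this, Finset.sum_mul]
    exact Finset.sum_congr rfl fun e _ => by ring
  rw [hsq]
  simp only [hb]
  simp only [add_mul, one_mul, Finset.sum_add_distrib]
  congr 1
  simp only [Finset.sum_mul]
  rw [Finset.sum_comm]
  refine Finset.sum_congr rfl fun i _ => ?_
  rw [Finset.mul_sum]
  refine Finset.sum_congr rfl fun e _ => ?_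
  ring

/-- consequence for a `t`-intersecting family -/
theorem quad_family {k t s : ℕ} (hs : s ≤ k) (htk : t < k) (hn : 2 * k ≤ finrank K V) (c : ℕ → ℝ)
    (F : Finset (Submodule K V)) (hF : F ⊆ Gr K V k)
    (hint : ∀ U ∈ F, ∀ U' ∈ F, t ≤ finrank K ↥(U ⊓ U'))
    (hdec : Dec k s (fun U => ind (U ∈ F))) :
    ∃ N : ℕ → ℝ, (∀ e, 0 ≤ N e) ∧ N 0 * gc (Nat.card K) (finrank K V) k = (F.card:ℝ)^2 ∧
      (F.card : ℝ) = ∑ e ∈ Finset.range (s+1), (1 + ∑ i ∈ Finset.range t, c i *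
      lam (Nat.card K) (finrank K V) k (k-i) e) * N e := by
  classical
  obtain ⟨h, hh, hf⟩ := hdec
  have hG : ∑ U ∈ Gr K V k, (1:ℝ) = gc (Nat.card K) (finrank K V) k := by
    have := count_le (⊤ : Submodule K V) k
    rw [finrank_top] at this
    rw [← this]
    exact Finset.sum_congr rfl fun U _ => by rw [ind_true le_top]
  have hup0 : ∀ (g : Submodule K V → ℝ) (U : Submodule K V), up 0 g U = g ⊥ := by
    intro g U
    have hb : (⊥ : Submodule K V) ∈ Gr K V 0 := by rw [mem_Gr]; simp
    rw [up, Finset.sum_eq_single ⊥]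
    · rw [ind_true bot_le, one_mul]
    · intro E hE hne
      exact absurd (Submodule.finrank_eq_zero.mp (mem_Gr.mp hE)) hne
    · intro h; exact absurd hb h
  have hsum : ∑ U ∈ Gr K V k, ind (U ∈ F) = F.card := by
    have : ∀ U ∈ Gr K V k, ind (U ∈ F) = if U ∈ F then 1 else 0 := by
      intro U _; unfold ind; congr
    rw [Finset.sum_congr rfl this, Finset.sum_ite_mem, Finset.inter_eq_right.mpr hF]
    simp
  have hc : (F.card : ℝ) = h 0 ⊥ * gc (Nat.card K) (finrank K V) k := by
    rw [← hsum, Finset.sum_congr rfl hf, Finset.sum_comm, Finset.sum_eq_single 0]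
    · simp only [hup0]
      rw [← hG, Finset.mul_sum]; simp
    · intro e he hne
      have he' := Finset.mem_range.mp he
      have h1 : Harm 0 (fun _ : Submodule K V => (1:ℝ)) := fun i hi => absurd hi (by omega)
      have := orth (k := k) h1 (hh e) (Nat.pos_of_ne_zero hne) (by omega) hn
      simpa [hup0] using this
    · intro h; simp at h
  refine ⟨fun e => ∑ U ∈ Gr K V k, (up e (h e) U)^2, fun e => Finset.sum_nonneg fun U _ => sq_nonneg _,
    ?_, ?_⟩
  · simp only [hup0]
    rw [Finset.sum_const, nsmul_eq_mul]
    rw [Finset.sum_const, nsmul_eq_mul, mul_one] at hG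
    rw [hG, hc]; ring
  · rw [← quad (t := t) hs hn c hh hf, ← hsum]
    symm
    apply (add_eq_left.mpr ?_).trans ?_
    rotate_left
    · refine Finset.sum_congr rfl fun U _ => ?_
      by_cases h : U ∈ F
      · simp [ind_true h]
      · simp [ind_false h]
    · refine Finset.sum_eq_zero fun i hi => ?_
      have hi' := Finset.mem_range.mp hi
      rw [Finset.sum_eq_zero, mul_zero]
      intro U' hU'
      by_cases h' : U' ∈ F
      · rw [Finset.sum_eq_zero, zero_mul]
        intro U hU
        by_cases h : U ∈ F
        · have h1 := hint U h U' h'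
          rw [bb_eq hU', gc_eq_zero _ (by omega)]; simp
        · rw [ind_false h, mul_zero]
      · rw [ind_false h', mul_zero]

theorem ekr_abs {k t : ℕ} (htk : t < k) (hn : 2 * k ≤ finrank K V) (c : ℕ → ℝ)
    (h1 : ∀ e, 1 ≤ e → e ≤ t → ∑ i ∈ Finset.range t, c i *
      lam (Nat.card K) (finrank K V) k (k-i) e = -1)
    (h2 : ∀ e, t < e → e ≤ k → -1 ≤ ∑ i ∈ Finset.range t, c i *
      lam (Nat.card K) (finrank K V) k (k-i) e)
    (F : Finset (Submodule K V)) (hF : F ⊆ Gr K V k)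
    (hint : ∀ U ∈ F, ∀ U' ∈ F, t ≤ finrank K ↥(U ⊓ U')) :
    (F.card : ℝ) ≤ gc (Nat.card K) (finrank K V - t) (k - t) := by
  classical
  have hq := two_le_q (K := K)
  have hG := gc_pos hq (show k ≤ finrank K V by omega)
  obtain ⟨T, hT⟩ : ∃ T, T ∈ Gr K V t := by
    by_contra hcon
    push Not at hcon
    have := count_le (⊤ : Submodule K V) t
    rw [finrank_top, Finset.sum_eq_zero (fun T hT => absurd hT (hcon T))] at this
    have := gc_pos hq (show t ≤ finrank K V by omega)
    linarith
  set S := (Gr K V k).filter (fun U => T ≤ U) with hS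
  have hScard : (S.card : ℝ) = gc (Nat.card K) (finrank K V - t) (k - t) := by
    have h3 := card_disj_above T ⊥ k (by simp) (by rw [mem_Gr.mp hT]; omega)
    rw [mem_Gr.mp hT] at h3
    simp only [finrank_bot, zero_mul, pow_zero, one_mul, Nat.sub_zero] at h3
    rw [← h3, ← sum_ind]
    have : ∀ U ∈ Gr K V k, ind (T ≤ U ∧ U ⊓ ⊥ = ⊥) = if T ≤ U then 1 else 0 := by
      intro U _; rw [ind]; simp
    rw [Finset.sum_congr rfl this, Finset.sum_boole]
  have hSpos : 0 < (S.card : ℝ) := by rw [hScard]; exact gc_pos hq (by omega)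
  obtain ⟨N, hN, hN0, hNS⟩ := quad_family (s := t) (by omega) htk hn c S (Finset.filter_subset _ _)
    (by
      intro U hU U' hU'
      rw [← mem_Gr.mp hT]
      exact Submodule.finrank_mono (le_inf (Finset.mem_filter.mp hU).2 (Finset.mem_filter.mp hU').2))
    (by
      refine (Dec.up (k := k) (dec_all t (fun Y => ind (Y = T))) le_rfl).congr fun U hU => ?_
      rw [up, Finset.sum_eq_single T]
      · rw [ind_true rfl, mul_one]
        apply ind_congr
        simp [S, hU]
      · intro Y _ hne
        rw [ind_false hne, mul_zero]
      · intro h; exact absurd hT h)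
  obtain ⟨M, hM, hM0, hMF⟩ := quad_family (s := k) le_rfl htk hn c F hF hint (dec_all k _)
  rw [Finset.sum_range_succ', Finset.sum_eq_zero (fun e he => by
    rw [h1 (e+1) (by omega) (by have := Finset.mem_range.mp he; omega)]; simp), zero_add] at hNS
  rw [Finset.sum_range_succ'] at hMF
  have hge : 0 ≤ ∑ e ∈ Finset.range k, (1 + ∑ i ∈ Finset.range t, c i *
      lam (Nat.card K) (finrank K V) k (k-i) (e+1)) * M (e+1) := by
    refine Finset.sum_nonneg fun e he => mul_nonneg ?_ (hM _)
    have he' := Finset.mem_range.mp he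
    rcases Nat.lt_or_ge t (e+1) with h | h
    · linarith [h2 (e+1) h (by omega)]
    · rw [h1 (e+1) (by omega) h]; simp
  set w := 1 + ∑ i ∈ Finset.range t, c i * lam (Nat.card K) (finrank K V) k (k-i) 0
  set G := gc (Nat.card K) (finrank K V) k
  have hw : w * S.card = G := by
    have h3 : (S.card : ℝ) * G = w * (S.card:ℝ)^2 := by
      rw [← hN0]; nth_rewrite 1 [hNS]; ring
    have h4 : (S.card : ℝ) * (w * S.card - G) = 0 := by linarith
    have := (mul_eq_zero.mp h4).resolve_left hSpos.ne'
    linarith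
  have hFw : w * (F.card:ℝ)^2 ≤ F.card * G := by
    rw [← hM0]
    have : w * M 0 ≤ F.card := by linarith
    calc w * (M 0 * G) = (w * M 0) * G := by ring
      _ ≤ _ := by gcongr
  rw [← hScard]
  rcases (Nat.cast_nonneg (α := ℝ) F.card).eq_or_lt with h0 | h0
  · rw [← h0]; exact hSpos.le
  · have hwpos : 0 < w := by
      by_contra hcon
      have : w * S.card ≤ 0 := mul_nonpos_of_nonpos_of_nonneg (not_lt.mp hcon) hSpos.le
      linarith
    rw [← hw] at hFw
    have : (F.card:ℝ) * w * F.card ≤ (F.card:ℝ) * w * S.card := by linarith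
    exact le_of_mul_le_mul_left this (by positivity)

end dec

end Part3

section Part4
open Module Finset
set_option linter.unusedSectionVars false

section num

theorem qf_succ (q a : ℕ) : qf q (a+1) = qf q a * ((q:ℝ)^(a+1) - 1) := by
  rw [qf, Finset.prod_range_succ, ← qf]

theorem qf_zero (q : ℕ) : qf q 0 = 1 := by simp [qf]

theorem qm1_pos {q : ℕ} (hq : 2 ≤ q) (a : ℕ) : 0 < (q:ℝ)^(a+1) - 1 := by
  have h1 := qpow_sub_pos hq (Nat.succ_pos a)
  simpa using h1

theorem one_le_qR {q : ℕ} (hq : 2 ≤ q) : (1:ℝ) ≤ q := by exact_mod_cast (by omega : 1 ≤ q)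

theorem qf_prod (q : ℕ) {d a : ℕ} (h : d ≤ a) :
    (∏ s ∈ Finset.range d, ((q:ℝ)^(a-s) - 1)) * qf q (a-d) = qf q a := by
  induction d with
  | zero => simp
  | succ d ih =>
    rw [Finset.prod_range_succ, ← ih (by omega)]
    obtain ⟨b, rfl⟩ : ∃ b, a = b + 1 + d := ⟨a - (1+d), by omega⟩
    rw [show b+1+d-(d+1) = b by omega, show b+1+d-d = b+1 by omega, qf_succ]
    ring

theorem lag_closed {q : ℕ} (hq : 2 ≤ q) (i r : ℕ) :
    ∏ j ∈ (Finset.range (i+1+r)).erase i, (((q:ℝ)^i-(q:ℝ)^j)⁻¹ * (-(q:ℝ)^j)) =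
      (-1)^i * (q:ℝ)^((r+1).choose 2) / (qf q i * qf q r) := by
  have hq0 : (q:ℝ) ≠ 0 := by have := one_le_qR hq; positivity
  induction r with
  | zero =>
    have h1 : (Finset.range (i+1+0)).erase i = Finset.range i := by
      ext x; simp; omega
    rw [h1, qf_zero, qf, ← Finset.prod_range_reflect]
    simp only [zero_add, Nat.choose_one_right]
    rw [show (1:ℕ).choose 2 = 0 from rfl, pow_zero, mul_one, mul_one]
    have : ((-1:ℝ))^i = ∏ _s ∈ Finset.range i, (-1:ℝ) := by simp
    rw [this, ← Finset.prod_div_distrib]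
    refine Finset.prod_congr rfl fun s hs => ?_
    have hs' := Finset.mem_range.mp hs
    obtain ⟨c, rfl⟩ : ∃ c, i = c + 1 + s := ⟨i - (1+s), by omega⟩
    rw [show c+1+s-1-s = c by omega]
    have h2 : (q:ℝ)^(c+1+s) = q^c * q^(s+1) := by ring
    have h3 := qm1_pos hq s
    have h4 : (q:ℝ)^(c+1+s) - q^c = q^c * (q^(s+1)-1) := by rw [h2]; ring
    rw [h4]
    have h5 : (q:ℝ)^c ≠ 0 := by positivity
    have h6 := h3.ne'
    field_simp
  | succ r ih =>
    have h1 : (Finset.range (i+1+(r+1))).erase i = insert (i+1+r) ((Finset.range (i+1+r)).erase i) := by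
      ext x; simp; omega
    rw [h1, Finset.prod_insert (by simp), ih, qf_succ]
    have h3 := qm1_pos hq r
    have h4 : (q:ℝ)^i - (q:ℝ)^(i+1+r) = -(q^i * (q^(r+1)-1)) := by ring
    have h5 : (q:ℝ)^i ≠ 0 := by positivity
    have h6 := h3.ne'
    have h7 := (qf_pos hq i).ne'
    have h8 := (qf_pos hq r).ne'
    rw [h4, show (r+1+1).choose 2 = (r+1) + (r+1).choose 2 by
      rw [Nat.choose_succ_succ' (r+1) 1, Nat.choose_one_right]]
    rw [show (q:ℝ)^(i+1+r) = q^i * q^(r+1) by ring, pow_add _ (r+1) ((r+1).choose 2)]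
    field_simp

noncomputable def LL (q t i : ℕ) : ℝ := (-1)^i * (q:ℝ)^((t-i).choose 2) / (qf q i * qf q (t-1-i))

theorem interp {q : ℕ} (hq : 2 ≤ q) (t : ℕ) (P : Polynomial ℝ) (hP : P.degree < t) :
    ∑ i ∈ Finset.range t, LL q t i * P.eval ((q:ℝ)^i) = P.eval 0 := by
  have hinj : Set.InjOn (fun i : ℕ => (q:ℝ)^i) (Finset.range t) := by
    intro a _ b _ h
    exact pow_right_injective₀ (by linarith [one_le_qR hq]) (by
      have : (2:ℝ) ≤ q := by exact_mod_cast hq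
      linarith) h
  have h := Lagrange.eq_interpolate (f := P) hinj (by simpa using hP)
  conv_rhs => rw [h]
  rw [Lagrange.interpolate_apply, Polynomial.eval_finset_sum]
  refine Finset.sum_congr rfl fun i hi => ?_
  have hi' := Finset.mem_range.mp hi
  obtain ⟨r, rfl⟩ : ∃ r, t = i + 1 + r := ⟨t - (i+1), by omega⟩
  rw [Polynomial.eval_mul, Polynomial.eval_C, Lagrange.basis, Polynomial.eval_prod]
  simp only [Lagrange.basisDivisor, Polynomial.eval_mul, Polynomial.eval_C, Polynomial.eval_sub,
    Polynomial.eval_X, zero_sub]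
  rw [lag_closed hq, LL, show i+1+r-i = r+1 by omega, show i+1+r-1-i = r by omega]
  ring

noncomputable def cc (q n k t i : ℕ) : ℝ := -(-1)^t * LL q t i * qf q (k-1-i) * qf q (n-2*k+i) * qf q i /
  qf q (n-k-t+i) / (q:ℝ)^((k-i)*(k-1))

theorem cc_lam {q n k t i e : ℕ} (hq : 2 ≤ q) (htk : t < k) (hn : 2*k ≤ n) (hi : i < t) (he : 1 ≤ e)
    (hie : i + e ≤ k) : cc q n k t i * lam q n k (k-i) e =
    -(-1)^(t+e) * LL q t i * ((q:ℝ)^(e.choose 2) / (q:ℝ)^((k-i)*(e-1))) *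
      (qf q (k-1-i) / qf q (k-e-i)) * (qf q (n-k-e+i) / qf q (n-k-t+i)) := by
  rw [lam, if_pos (by omega), cc]
  have h1 := gc_eq_qf hq (n-2*k+i) (k-e)
  have h2 := gc_eq_qf hq i (k-i-e)
  rw [show n-2*k+i+(k-e) = n-e-(k-i) by omega] at h1
  rw [show i+(k-i-e) = k-e by omega] at h2
  rw [h1, h2, show n-e-(k-i) = n-k-e+i by omega, show k-i-e = k-e-i by omega,
    show k-1 = (k-e)+(e-1) by omega, mul_add (k-i), pow_add, pow_add, pow_add]
  have hq0 : (q:ℝ) ≠ 0 := by have := one_le_qR hq; positivity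
  have a1 := (qf_pos hq (n-2*k+i)).ne'
  have a2 := (qf_pos hq (k-e)).ne'
  have a3 := (qf_pos hq i).ne'
  have a4 := (qf_pos hq (k-e-i)).ne'
  have a5 := (qf_pos hq (n-k-t+i)).ne'
  field_simp

theorem cc_lam_zero {q n k t i e : ℕ} (hie : k < i + e) : cc q n k t i * lam q n k (k-i) e = 0 ∨ k < i := by
  by_cases h : k < i
  · exact Or.inr h
  · left; rw [lam, if_neg (by omega), mul_zero]

theorem prod_pow_sub (q : ℕ) {d k : ℕ} (h : d < k) :
    (∏ s ∈ Finset.range d, (q:ℝ)^(k-1-s)) * (q:ℝ)^((d+1).choose 2) = (q:ℝ)^(k*d) := by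
  induction d with
  | zero => simp
  | succ d ih =>
    rw [Finset.prod_range_succ, show (d+1+1).choose 2 = (d+1) + (d+1).choose 2 by
      rw [Nat.choose_succ_succ' (d+1) 1, Nat.choose_one_right], mul_add, pow_add _ (k*d), pow_add _ (d+1), ← ih (by omega), mul_one]
    have : (q:ℝ)^k = q^(k-1-d) * q^(d+1) := by rw [← pow_add]; congr 1; omega
    rw [this, pow_add]; ring

theorem num1 {q n k t e : ℕ} (hq : 2 ≤ q) (htk : t < k) (hn : 2*k ≤ n) (he : 1 ≤ e) (het : e ≤ t) :
    ∑ i ∈ Finset.range t, cc q n k t i * lam q n k (k-i) e = -1 := by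
  have hq0 : (q:ℝ) ≠ 0 := by have := one_le_qR hq; positivity
  let P : Polynomial ℝ := (∏ s ∈ Finset.range (e-1), (Polynomial.C ((q:ℝ)^(k-1-s)) - Polynomial.X)) *
    ∏ s ∈ Finset.range (t-e), (Polynomial.C ((q:ℝ)^(n-k-e-s)) * Polynomial.X - Polynomial.C 1)
  have hP : P.degree < t := by
    have h1 : P.degree ≤ ((e-1 : ℕ) : WithBot ℕ) + ((t-e : ℕ) : WithBot ℕ) := by
      refine (Polynomial.degree_mul_le _ _).trans (add_le_add ?_ ?_)
      · refine (Polynomial.degree_prod_le _ _).trans ?_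
        refine (Finset.sum_le_card_nsmul _ _ 1 fun s _ => ?_).trans (by simp)
        refine (Polynomial.degree_sub_le _ _).trans (max_le (Polynomial.degree_C_le.trans (by norm_num)) ?_)
        exact Polynomial.degree_X_le
      · refine (Polynomial.degree_prod_le _ _).trans ?_
        refine (Finset.sum_le_card_nsmul _ _ 1 fun s _ => ?_).trans (by simp)
        refine (Polynomial.degree_sub_le _ _).trans (max_le ?_ (Polynomial.degree_C_le.trans (by norm_num)))
        exact Polynomial.degree_C_mul_X_le _
    refine h1.trans_lt ?_
    rw [← Nat.cast_add]
    exact_mod_cast (by omega : e-1+(t-e) < t)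
  have hI := interp hq t P hP
  have hP0 : P.eval 0 = (-1)^(t-e) * ∏ s ∈ Finset.range (e-1), (q:ℝ)^(k-1-s) := by
    simp [P, Polynomial.eval_prod]; ring
  have hPi : ∀ i, P.eval ((q:ℝ)^i) = (∏ s ∈ Finset.range (e-1), ((q:ℝ)^(k-1-s) - q^i)) *
      ∏ s ∈ Finset.range (t-e), ((q:ℝ)^(n-k-e-s) * q^i - 1) := by
    intro i
    simp [P, Polynomial.eval_prod]
  have key : ∀ i ∈ Finset.range t, cc q n k t i * lam q n k (k-i) e =
      -(-1)^(t+e) * ((q:ℝ)^(e.choose 2) / q^(k*(e-1))) * (LL q t i * P.eval ((q:ℝ)^i)) := by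
    intro i hi
    have hi' := Finset.mem_range.mp hi
    rw [hPi]
    by_cases hie : i + e ≤ k
    · rw [cc_lam hq htk hn hi' he hie]
      have b1 := qf_prod q (show e-1 ≤ k-1-i by omega)
      have b2 := qf_prod q (show t-e ≤ n-k-e+i by omega)
      rw [← b1, ← b2, show k-1-i-(e-1) = k-e-i by omega, show n-k-e+i-(t-e) = n-k-t+i by omega]
      have a4 := (qf_pos hq (k-e-i)).ne'
      have a5 := (qf_pos hq (n-k-t+i)).ne'
      have c1 : ∏ s ∈ Finset.range (e-1), ((q:ℝ)^(k-1-s) - q^i) =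
          q^(i*(e-1)) * ∏ s ∈ Finset.range (e-1), ((q:ℝ)^(k-1-i-s) - 1) := by
        rw [pow_mul]
        nth_rewrite 2 [← Finset.card_range (e-1)]
        rw [← Finset.prod_const, ← Finset.prod_mul_distrib]
        refine Finset.prod_congr rfl fun s hs => ?_
        have := Finset.mem_range.mp hs
        rw [mul_sub, ← pow_add, mul_one, show i + (k-1-i-s) = k-1-s by omega]
      have c2 : ∏ s ∈ Finset.range (t-e), ((q:ℝ)^(n-k-e-s) * q^i - 1) =
          ∏ s ∈ Finset.range (t-e), ((q:ℝ)^(n-k-e+i-s) - 1) := by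
        refine Finset.prod_congr rfl fun s hs => ?_
        have := Finset.mem_range.mp hs
        rw [← pow_add, show n-k-e-s+i = n-k-e+i-s by omega]
      have c3 : (q:ℝ)^(k*(e-1)) = q^((k-i)*(e-1)) * q^(i*(e-1)) := by
        rw [← pow_add, ← add_mul, show k-i+i = k by omega]
      rw [c1, c2, c3, mul_div_cancel_right₀ _ a4, mul_div_cancel_right₀ _ a5]
      field_simp
    · rw [(cc_lam_zero (by omega)).resolve_right (by omega)]
      rw [Finset.prod_eq_zero (i := k-1-i) (by simp; omega), zero_mul, mul_zero, mul_zero]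
      rw [show k-1-(k-1-i) = i by omega, sub_self]
  rw [Finset.sum_congr rfl key, ← Finset.mul_sum, hI, hP0]
  have c4 := prod_pow_sub q (show e-1 < k by omega)
  rw [show e-1+1 = e by omega] at c4
  rw [← c4]
  have c5 : (∏ s ∈ Finset.range (e-1), (q:ℝ)^(k-1-s)) ≠ 0 := Finset.prod_ne_zero_iff.mpr fun _ _ => by positivity
  have c6 : (-1:ℝ)^(t+e) * (-1)^(t-e) = 1 := by
    rw [← pow_add, show t+e+(t-e) = 2*t by omega, pow_mul]; simp
  have c7 : (q:ℝ)^(e.choose 2) ≠ 0 := by positivity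
  field_simp
  linarith

theorem alt_sum (t : ℕ) (A : ℕ → ℝ) (h0 : ∀ i, 0 ≤ A i) (h : ∀ i, i + 1 < t → A (i+1) ≤ A i) :
    0 ≤ ∑ i ∈ Finset.range t, (-1)^i * A i ∧ ∑ i ∈ Finset.range t, (-1)^i * A i ≤ A 0 := by
  induction t generalizing A with
  | zero => simpa using h0 0
  | succ t ih =>
    rw [Finset.sum_range_succ']
    have h1 := ih (fun i => A (i+1)) (fun i => h0 _) (fun i hi => h _ (by omega))
    have h2 : ∑ i ∈ Finset.range t, (-1:ℝ)^(i+1) * A (i+1) = - ∑ i ∈ Finset.range t, (-1)^i * A (i+1) := by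
      rw [← Finset.sum_neg_distrib]; exact Finset.sum_congr rfl fun i _ => by ring
    rw [h2]
    simp only [pow_zero, one_mul]
    refine ⟨?_, by linarith [h1.1]⟩
    rcases Nat.eq_zero_or_pos t with rfl | ht
    · simpa using h0 0
    · have := h 0 (by omega)
      simp only [zero_add] at h1 this
      linarith [h1.2]

noncomputable def WW (q a : ℕ) : ℝ := (q:ℝ)^((a+1).choose 2) / qf q a

theorem WW_pos {q : ℕ} (hq : 2 ≤ q) (a : ℕ) : 0 < WW q a := by
  have := one_le_qR hq
  have := qf_pos hq a
  unfold WW; positivity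

theorem WW_mono {q : ℕ} (hq : 2 ≤ q) : Monotone (WW q) := by
  refine monotone_nat_of_le_succ fun a => ?_
  have h0 := one_le_qR hq
  have h1 := qf_pos hq a
  have h2 := qm1_pos hq a
  unfold WW
  rw [qf_succ, show (a+1+1).choose 2 = (a+1) + (a+1).choose 2 by
      rw [Nat.choose_succ_succ' (a+1) 1, Nat.choose_one_right], pow_add, div_le_div_iff₀ h1 (by positivity)]
  have h3 : (0:ℝ) < q^((a+1).choose 2) * qf q a := by positivity
  nlinarith

theorem qf_mono {q : ℕ} (hq : 2 ≤ q) : Monotone (qf q) := by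
  refine monotone_nat_of_le_succ fun a => ?_
  rw [qf_succ]
  have h0 : (2:ℝ) ≤ q := by exact_mod_cast hq
  have h1 : (q:ℝ) ≤ q^(a+1) := le_self_pow₀ (by linarith) (by omega)
  have := qf_pos hq a
  nlinarith

/-- qf(a)/qf(a+d) antitone -/
theorem qf_ratio {q : ℕ} (hq : 2 ≤ q) {a b : ℕ} (d : ℕ) (hab : a ≤ b) :
    qf q b / qf q (b+d) ≤ qf q a / qf q (a+d) := by
  induction d with
  | zero => 
    have h1 := (qf_pos hq a).ne'
    have h2 := (qf_pos hq b).ne'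
    simp [h1, h2]
  | succ d ih =>
    rw [← add_assoc, ← add_assoc, qf_succ, qf_succ, ← div_div, ← div_div]
    have h1 := qm1_pos hq (a+d)
    have h2 := (div_pos (qf_pos hq a) (qf_pos hq (a+d))).le
    have h3 : (q:ℝ)^(a+d+1) ≤ q^(b+d+1) := pow_le_pow_right₀ (one_le_qR hq) (by omega)
    exact div_le_div₀ h2 ih h1 (by linarith)

/-- q^{ic} qf(a+c-i)/qf(a-i) antitone in i -/
theorem qf_ratio2 {q : ℕ} (hq : 2 ≤ q) (a c : ℕ) :
    (q:ℝ)^c * (qf q (a+c) / qf q a) ≤ qf q (a+1+c) / qf q (a+1) := by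
  have h1 := qf_pos hq a
  have h2 := qm1_pos hq a
  have h3 := qf_pos hq (a+c)
  rw [show a+1+c = a+c+1 by omega, qf_succ, qf_succ, mul_div_assoc', div_le_div_iff₀ h1 (by positivity)]
  have h4 : (q:ℝ)^c * (q^(a+1)-1) ≤ q^(a+c+1) - 1 := by
    have : (1:ℝ) ≤ q^c := one_le_pow₀ (one_le_qR hq)
    have h5 : (q:ℝ)^c * q^(a+1) = q^(a+c+1) := by ring
    linarith
  calc (q:ℝ)^c * qf q (a+c) * (qf q a * (q^(a+1)-1)) = (qf q (a+c) * qf q a) * (q^c * (q^(a+1)-1)) := by ring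
    _ ≤ (qf q (a+c) * qf q a) * (q^(a+c+1) - 1) := by gcongr
    _ = _ := by ring

theorem qf_lower {q : ℕ} (hq : 2 ≤ q) (d : ℕ) : (q:ℝ)^(d.choose 2) ≤ qf q d := by
  induction d with
  | zero => simp [qf_zero]
  | succ d ih =>
    rw [qf_succ, Nat.choose_succ_succ' d 1, Nat.choose_one_right, pow_add, mul_comm]
    have h0 : (2:ℝ) ≤ q := by exact_mod_cast hq
    have h1 : (1:ℝ) ≤ q^d := one_le_pow₀ (by linarith)
    have h2 : (q:ℝ)^d ≤ q^(d+1) - 1 := by rw [pow_succ]; nlinarith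
    have := qf_pos hq d
    gcongr

noncomputable def AA (q n k t e i : ℕ) : ℝ := if i + e ≤ k then
  (WW q (t-1-i) / qf q i) * ((q:ℝ)^(e.choose 2) / (q:ℝ)^((k-i)*(e-1))) *
      (qf q (k-1-i) / qf q (k-e-i)) * (qf q (n-k-e+i) / qf q (n-k-t+i)) else 0

theorem num2 {q n k t e : ℕ} (hq : 2 ≤ q) (ht : 1 ≤ t) (htk : t < k) (hn : 2*k ≤ n) (he : t < e) (hek : e ≤ k) :
    -1 ≤ ∑ i ∈ Finset.range t, cc q n k t i * lam q n k (k-i) e := by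
  have hq0 : (0:ℝ) < q := by have := one_le_qR hq; positivity
  have key : ∀ i ∈ Finset.range t, cc q n k t i * lam q n k (k-i) e = -(-1)^(t+e) * ((-1)^i * AA q n k t e i) := by
    intro i hi
    have hi' := Finset.mem_range.mp hi
    by_cases hie : i + e ≤ k
    · rw [cc_lam hq htk hn hi' (by omega) hie, AA, if_pos hie, LL, WW, show t-1-i+1 = t-i by omega]
      have a3 := (qf_pos hq i).ne'
      have a4 := (qf_pos hq (t-1-i)).ne'
      field_simp
    · rw [(cc_lam_zero (by omega)).resolve_right (by omega), AA, if_neg hie]; simp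
  have hA0 : ∀ i, 0 ≤ AA q n k t e i := by
    intro i
    unfold AA
    split_ifs
    · have a1 := WW_pos hq (t-1-i)
      have a2 := qf_pos hq i
      have a3 := qf_pos hq (k-1-i)
      have a4 := qf_pos hq (k-e-i)
      have a5 := qf_pos hq (n-k-e+i)
      have a6 := qf_pos hq (n-k-t+i)
      positivity
    · exact le_rfl
  have hA : ∀ i, i + 1 < t → AA q n k t e (i+1) ≤ AA q n k t e i := by
    intro i hi
    by_cases hie : i + 1 + e ≤ k
    · rw [AA, AA, if_pos hie, if_pos (by omega)]
      have e1 : WW q (t-1-(i+1)) / qf q (i+1) ≤ WW q (t-1-i) / qf q i :=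
        div_le_div₀ (WW_pos hq _).le (WW_mono hq (by omega)) (qf_pos hq _) (qf_mono hq (by omega))
      have e2 := qf_ratio2 hq (k-e-(i+1)) (e-1)
      rw [show k-e-(i+1)+(e-1) = k-1-(i+1) by omega, show k-e-(i+1)+1 = k-e-i by omega,
        show k-e-i+(e-1) = k-1-i by omega] at e2
      have e3 := qf_ratio hq (a := n-k-e+i) (b := n-k-e+(i+1)) (e-t) (by omega)
      rw [show n-k-e+(i+1)+(e-t) = n-k-t+(i+1) by omega, show n-k-e+i+(e-t) = n-k-t+i by omega] at e3
      have e4 : (q:ℝ)^((k-i)*(e-1)) = q^((k-(i+1))*(e-1)) * q^(e-1) := by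
        rw [← pow_add, ← Nat.succ_mul, show (k-(i+1)).succ = k-i by omega]
      have e5 : (q:ℝ)^(e.choose 2) / q^((k-(i+1))*(e-1)) * (qf q (k-1-(i+1)) / qf q (k-e-(i+1))) ≤
          (q:ℝ)^(e.choose 2) / q^((k-i)*(e-1)) * (qf q (k-1-i) / qf q (k-e-i)) := by
        rw [e4]
        calc _ = (q:ℝ)^(e.choose 2) / (q^((k-(i+1))*(e-1)) * q^(e-1)) *
              (q^(e-1) * (qf q (k-1-(i+1)) / qf q (k-e-(i+1)))) := by field_simp
          _ ≤ _ := by gcongr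
      have p1 := (div_pos (qf_pos hq (n-k-e+(i+1))) (qf_pos hq (n-k-t+(i+1)))).le
      have p2 := (div_pos (WW_pos hq (t-1-i)) (qf_pos hq i)).le
      have p3 := (div_pos (qf_pos hq (k-1-(i+1))) (qf_pos hq (k-e-(i+1)))).le
      have p4 := (div_pos (qf_pos hq (k-1-i)) (qf_pos hq (k-e-i))).le
      rw [mul_assoc (WW q (t-1-(i+1)) / qf q (i+1)), mul_assoc (WW q (t-1-i) / qf q i)]
      refine mul_le_mul (mul_le_mul e1 e5 (by positivity) p2) e3 p1 (by positivity)
    · rw [AA, if_neg hie]; exact hA0 i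
  have hA1 : AA q n k t e 0 ≤ 1 := by
    rw [AA, if_pos (by omega)]
    simp only [Nat.sub_zero, add_zero, qf_zero, div_one]
    have e3 := qf_ratio hq (a := k-e) (b := n-k-e) (e-t) (by omega)
    rw [show n-k-e+(e-t) = n-k-t by omega, show k-e+(e-t) = k-t by omega] at e3
    have e4 : (q:ℝ)^(e.choose 2) / q^(k*(e-1)) * (qf q (k-1) / qf q (k-e)) = WW q (k-e) / WW q (k-1) := by
      have a1 := (qf_pos hq (k-1)).ne'
      have a2 := (qf_pos hq (k-e)).ne'
      have h5 : (q:ℝ)^(e.choose 2) * q^((k-1+1).choose 2) = q^((k-e+1).choose 2) * q^(k*(e-1)) := by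
        have c1 := prod_pow_sub q (show k-1 < k by omega)
        have c2 := prod_pow_sub q (show e-1 < k by omega)
        rw [show k-1+1=k by omega, ← pow_add, ← pow_add]
        congr 1
        obtain ⟨a, rfl⟩ : ∃ a, k = e + a := ⟨k-e, by omega⟩
        obtain ⟨f, rfl⟩ : ∃ f, e = f + 1 := ⟨e-1, by omega⟩
        rw [show f+1+a-(f+1)+1 = a+1 by omega, show f+1-1=f by omega]
        have t1 := Finset.sum_range_id_mul_two (f+1)
        qify
        simp only [Nat.cast_choose_two]
        push_cast
        ring
      unfold WW
      field_simp
      linarith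
    rw [mul_assoc (WW q (t-1)), e4]
    have w1 := WW_pos hq (k-1)
    have w2 := WW_mono hq (show t-1 ≤ k-1 by omega)
    have w3 := WW_pos hq (k-e)
    have w4 := qf_pos hq (k-t)
    have w5 := qf_pos hq (k-e)
    have w6 := qf_pos hq (n-k-e)
    have w7 := qf_pos hq (n-k-t)
    calc WW q (t-1) * (WW q (k-e) / WW q (k-1)) * (qf q (n-k-e) / qf q (n-k-t))
        ≤ WW q (k-1) * (WW q (k-e) / WW q (k-1)) * (qf q (k-e) / qf q (k-t)) := by gcongr
      _ = (q:ℝ)^((k-e+1).choose 2) / qf q (k-t) := by 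
          have := w1.ne'
          rw [mul_div_cancel₀ _ this, WW]; field_simp
      _ ≤ qf q (k-t) / qf q (k-t) := by
          gcongr
          refine le_trans (pow_le_pow_right₀ (one_le_qR hq) (Nat.choose_le_choose 2 ?_)) (qf_lower hq (k-t))
          omega
      _ = 1 := div_self w4.ne'
  rw [Finset.sum_congr rfl key, ← Finset.mul_sum]
  obtain ⟨s1, s2⟩ := alt_sum t (AA q n k t e) hA0 hA
  rcases neg_one_pow_eq_or ℝ (t+e) with h | h <;> rw [h] <;> linarith

end num

theorem ekr_field {K V : Type*} [Field K] [Finite K] [AddCommGroup V] [Module K V] [Finite V]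
    {k t : ℕ} (ht : 1 ≤ t) (htk : t < k) (hn : 2 * k ≤ finrank K V)
    (F : Finset (Submodule K V)) (hF : ∀ U ∈ F, finrank K U = k)
    (hint : ∀ U ∈ F, ∀ U' ∈ F, t ≤ finrank K ↥(U ⊓ U')) :
    F.card ≤ (∏ i ∈ Finset.range (k-t), (Nat.card K ^ (finrank K V - t - i) - 1)) /
      ∏ i ∈ Finset.range (k-t), (Nat.card K ^ (k - t - i) - 1) := by
  have hq := two_le_q (K := K)
  have h := ekr_abs htk hn (cc (Nat.card K) (finrank K V) k t)
    (fun e h1 h2 => num1 hq htk hn h1 h2) (fun e h1 h2 => num2 hq ht htk hn h1 h2) F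
    (fun U hU => mem_Gr.mpr (hF U hU)) hint
  obtain ⟨c, hc⟩ : ∃ c : ℕ, (c:ℝ) = gc (Nat.card K) (finrank K V - t) (k - t) := by
    obtain ⟨T, hT⟩ : ∃ T : Submodule K V, finrank K T = t := 
      by
        by_contra hcon
        push Not at hcon
        have := count_le (⊤ : Submodule K V) t
        rw [finrank_top, Finset.sum_eq_zero (fun T hT => absurd (mem_Gr.mp hT) (hcon T))] at this
        have := gc_pos hq (show t ≤ finrank K V by omega)
        linarith
    have h3 := card_disj_above T ⊥ k (by simp) (by rw [hT]; omega)
    rw [hT] at h3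
    simp only [finrank_bot, zero_mul, pow_zero, one_mul, Nat.sub_zero] at h3
    exact ⟨_, h3⟩
  rw [gaussBinom_eq hq (by omega) hc]
  rw [← hc] at h
  exact_mod_cast h

end Part4

section Part5
open Module Finset
set_option linter.unusedSectionVars false

section anticode
variable {K M W : Type*} [Field K] [Finite K] [AddCommGroup M] [Module K M] [Finite M]
  [AddCommGroup W] [Module K W] [Finite W]

noncomputable def linPoly (K : Type*) [Field K] {L : Type*} [Field L] {t : ℕ} (a : Fin t → L) : Polynomial L :=
  ∑ s, Polynomial.C (a s) * Polynomial.X ^ (Nat.card K ^ (s:ℕ))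

theorem linPoly_ne {L : Type*} [Field L] {t : ℕ} {a : Fin t → L} (ha : a ≠ 0) : linPoly K a ≠ 0 := by
  intro h
  apply ha
  funext s
  have h1 := congrArg (fun p => Polynomial.coeff p (Nat.card K ^ (s:ℕ))) h
  simp only [linPoly, Polynomial.finset_sum_coeff, Polynomial.coeff_C_mul, Polynomial.coeff_X_pow,
    Polynomial.coeff_zero] at h1
  rw [Finset.sum_eq_single s] at h1
  · simpa using h1
  · intro b _ hb
    rw [if_neg, mul_zero]
    intro h2
    exact hb (Fin.ext (Nat.pow_right_injective (Finite.one_lt_card : 2 ≤ Nat.card K) h2).symm)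
  · simp

theorem linPoly_deg {L : Type*} [Field L] {t : ℕ} (a : Fin t → L) :
    (linPoly K a).natDegree ≤ Nat.card K ^ (t-1) := by
  refine Polynomial.natDegree_sum_le_of_forall_le _ _ fun s _ => ?_
  refine (Polynomial.natDegree_C_mul_X_pow_le _ _).trans ?_
  exact Nat.pow_le_pow_right Nat.card_pos (by have := s.2; omega)

theorem exists_ext (l : ℕ) (hl : 1 ≤ l) : ∃ (L : Type) (_ : Field L) (_ : Finite L) (_ : Algebra K L), 
    finrank K L = l := by
  obtain ⟨p, hp⟩ := CharP.exists K
  have : Fact p.Prime := ⟨CharP.char_is_prime K p⟩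
  have : NeZero l := ⟨by omega⟩
  exact ⟨FiniteField.Extension K p l, inferInstance, inferInstance, inferInstance,
    FiniteField.finrank_extension K p l⟩

theorem exists_emb {L : Type*} [AddCommGroup L] [Module K L] [Finite L] (h : finrank K M ≤ finrank K L) :
    ∃ f : M →ₗ[K] L, Function.Injective f := by
  obtain ⟨r, hr⟩ := Nat.exists_eq_add_of_le h
  let e : L ≃ₗ[K] (M × (Fin r → K)) := LinearEquiv.ofFinrankEq _ _ (by simp [hr])
  exact ⟨e.symm.toLinearMap ∘ₗ LinearMap.inl K M (Fin r → K),
    e.symm.injective.comp LinearMap.inl_injective⟩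

theorem anticode {k t l : ℕ} (hk : finrank K M = k) (hl : finrank K W = l) (ht : 1 ≤ t) (htk : t ≤ k)
    (hkl : k ≤ l) (A : Finset (M →ₗ[K] W))
    (hA : ∀ f ∈ A, ∀ g ∈ A, t ≤ finrank K (LinearMap.ker (f - g))) :
    A.card ≤ Nat.card K ^ ((k-t)*l) := by
  classical
  obtain ⟨L, _, _, _, hL⟩ := exists_ext (K := K) l (by omega)
  have := Fintype.ofFinite K
  let e : L ≃ₗ[K] W := LinearEquiv.ofFinrankEq _ _ (by rw [hL, hl])
  obtain ⟨ι, hι⟩ := exists_emb (K := K) (M := M) (L := L) (by omega)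
  let Φ : (Fin t → L) → (M →ₗ[K] W) := fun a => e.toLinearMap ∘ₗ
    (∑ s, (LinearMap.mulLeft K (a s)) ∘ₗ ((FiniteField.frobeniusAlgHom K L)^(s:ℕ)).toLinearMap) ∘ₗ ι
  have hΦ : ∀ a v, Φ a v = e ((linPoly K a).eval (ι v)) := by
    intro a v
    simp only [Φ, linPoly, LinearMap.comp_apply, LinearEquiv.coe_coe, LinearMap.sum_apply,
      Polynomial.eval_finset_sum, Polynomial.eval_mul, Polynomial.eval_C, Polynomial.eval_pow, Polynomial.eval_X]
    congr 1
    refine Finset.sum_congr rfl fun s _ => ?_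
    simp [AlgHom.coe_pow, FiniteField.coe_frobeniusAlgHom, pow_iterate, Nat.card_eq_fintype_card]
  have hΦsub : ∀ a b, Φ (a - b) = Φ a - Φ b := by
    intro a b
    ext v
    rw [LinearMap.sub_apply, hΦ, hΦ, hΦ, ← map_sub, ← Polynomial.eval_sub]
    congr 2
    simp only [linPoly, Pi.sub_apply, map_sub, sub_mul, Finset.sum_sub_distrib]
  have hker : ∀ a, a ≠ 0 → finrank K (LinearMap.ker (Φ a)) < t := by
    intro a ha
    have hp := linPoly_ne (K := K) ha
    have h1 : Nat.card (LinearMap.ker (Φ a)) ≤ Nat.card K ^ (t-1) := by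
      have h2 : Nat.card (LinearMap.ker (Φ a)) ≤ Nat.card (linPoly K a).roots.toFinset := by
        refine Nat.card_le_card_of_injective (fun v => ⟨ι v.1, ?_⟩) ?_
        · rw [Multiset.mem_toFinset, Polynomial.mem_roots hp, Polynomial.IsRoot]
          have := LinearMap.mem_ker.mp v.2
          rw [hΦ] at this
          simpa using this
        · intro v w h
          exact Subtype.ext (hι (congrArg Subtype.val h))
      refine h2.trans ?_
      rw [Nat.card_eq_fintype_card, Fintype.card_coe]
      exact (Multiset.toFinset_card_le _).trans ((Polynomial.card_roots' _).trans (linPoly_deg a))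
    rw [Module.natCard_eq_pow_finrank (K := K)] at h1
    have := (Nat.pow_le_pow_iff_right (Finite.one_lt_card : 1 < Nat.card K)).mp h1
    omega
  have hfin : Finite (M →ₗ[K] W) := Module.finite_of_finite K
  have hcard : Nat.card (A × (Fin t → L)) ≤ Nat.card (M →ₗ[K] W) := by
    refine Nat.card_le_card_of_injective (fun x => x.1.1 + Φ x.2) ?_
    rintro ⟨⟨f, hf⟩, a⟩ ⟨⟨g, hg⟩, b⟩ h
    simp only at h
    have h1 : f - g = Φ (b - a) := by
      rw [hΦsub, sub_eq_sub_iff_add_eq_add, h]; abel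
    have h2 : b - a = 0 := by
      by_contra hne
      have := hker _ hne
      have h3 := hA f hf g hg
      rw [h1] at h3
      omega
    have h3 : b = a := sub_eq_zero.mp h2
    subst h3
    have h4 : f = g := by simpa using h
    subst h4
    rfl
  rw [Nat.card_prod, Nat.card_fun, Module.natCard_eq_pow_finrank (K := K) (V := M →ₗ[K] W),
    Module.finrank_linearMap, Module.natCard_eq_pow_finrank (K := K) (V := L), hL, hk, hl] at hcard
  simp only [Nat.card_eq_fintype_card (α := A), Fintype.card_coe, Nat.card_eq_fintype_card (α := Fin t), Fintype.card_fin] at hcard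
  obtain ⟨r, rfl⟩ := Nat.exists_eq_add_of_le htk
  rw [← pow_mul, add_mul, pow_add, mul_comm l t, mul_comm] at hcard
  rw [Nat.add_sub_cancel_left]
  exact Nat.le_of_mul_le_mul_left hcard (Nat.pow_pos Nat.card_pos)

end anticode

end Part5

section Part6
open Module Finset
set_option linter.unusedSectionVars false

structure CRData {R K : Type*} [Ring R] [Field K] (π : R →+* K) (I : ℕ → Ideal R) (m : ℕ) : Prop where
  surj : Function.Surjective π
  anti : ∀ i, I (i+1) ≤ I i
  two : ∀ i x r, x ∈ I i → x * r ∈ I i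
  ker : ∀ x, x ∈ I 1 ↔ π x = 0
  mul : ∀ i x y, 1 ≤ i → x ∈ I i → y ∈ I i → x * y ∈ I (i+1)
  ann : ∀ i ≤ m, ∀ x, (∀ a ∈ I (m-i), a * x = 0) → x ∈ I i
  mulann : ∀ i ≤ m, ∀ a x, a ∈ I (m-i) → x ∈ I i → a * x = 0
  delta : ∀ i < m, ∃ δ : R → K, (∀ x y, x ∈ I i → y ∈ I i → δ (x+y) = δ x + δ y) ∧
    (∀ r x, x ∈ I i → δ (r * x) = π r * δ x) ∧ (∀ x, x ∈ I i → (δ x = 0 ↔ x ∈ I (i+1))) ∧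
    ∃ θ ∈ I i, δ θ = 1 ∧ ∀ x ∈ I i, ∃ r, x = r * θ
  bot : I m = ⊥
  pos : 1 ≤ m

section partB
variable {R K : Type*} [Ring R] [Finite R] [Field K] [Finite K] {π : R →+* K} {I : ℕ → Ideal R} {m n : ℕ}

def KK (n : ℕ) (I : ℕ → Ideal R) (i : ℕ) : Submodule R (Fin n → R) where
  carrier := {x | ∀ l, x l ∈ I i}
  add_mem' := fun hx hy l => (I i).add_mem (hx l) (hy l)
  zero_mem' := fun _ => (I i).zero_mem
  smul_mem' := fun r _ hx l => (I i).smul_mem r (hx l)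

theorem mem_KK {i : ℕ} {x : Fin n → R} : x ∈ KK n I i ↔ ∀ l, x l ∈ I i := Iff.rfl

def IsB {s : ℕ} (b : Fin s → (Fin n → R)) (F : Submodule R (Fin n → R)) : Prop :=
  (∀ x, x ∈ F ↔ ∃ r : Fin s → R, x = ∑ j, r j • b j) ∧ (∀ r : Fin s → R, ∑ j, r j • b j = 0 → r = 0)

theorem IsB.exists {s : ℕ} {F : Submodule R (Fin n → R)} (h : Nonempty (F ≃ₗ[R] (Fin s → R))) :
    ∃ b : Fin s → (Fin n → R), IsB b F := by
  obtain ⟨e⟩ := h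
  have key : ∀ r : Fin s → R, ∑ j, r j • ((e.symm (Pi.single j 1) : F) : Fin n → R) = (e.symm r : F) := by
    intro r
    conv_rhs => rw [pi_eq_sum_univ' r]
    rw [map_sum, Submodule.coe_sum]
    refine Finset.sum_congr rfl fun j _ => ?_
    rw [map_smul, Submodule.coe_smul]
  refine ⟨fun j => (e.symm (Pi.single j 1) : F), fun x => ⟨fun hx => ⟨e ⟨x, hx⟩, ?_⟩, ?_⟩, fun r hr => ?_⟩
  · rw [key]; simp
  · rintro ⟨r, rfl⟩
    rw [key]; exact (e.symm r).2
  · rw [key] at hr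
    have : e.symm r = 0 := Subtype.ext hr
    simpa using this

theorem IsB.mem {s : ℕ} {b : Fin s → (Fin n → R)} {F : Submodule R (Fin n → R)} (h : IsB b F) (j) : b j ∈ F := by
  rw [h.1]
  refine ⟨Pi.single j 1, ?_⟩
  rw [Finset.sum_eq_single j]
  · simp
  · intro i _ hi; simp [hi]
  · simp

variable (H : CRData π I m)
include H

theorem CRData.anti' {i j : ℕ} (h : i ≤ j) : I j ≤ I i := antitone_nat_of_succ_le H.anti h

theorem CRData.KK_anti {i j : ℕ} (h : i ≤ j) : KK n I j ≤ KK n I i := fun _ hx l => H.anti' h (hx l)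

theorem CRData.smul_KK {i : ℕ} {r : R} (hr : r ∈ I i) (x : Fin n → R) : r • x ∈ KK n I i :=
  fun l => H.two i r _ hr

theorem IsB.coord {s : ℕ} {b : Fin s → (Fin n → R)} {F : Submodule R (Fin n → R)} (h : IsB b F)
    {i : ℕ} (hi : i ≤ m) {r : Fin s → R} (hr : ∑ j, r j • b j ∈ KK n I i) (j) : r j ∈ I i := by
  refine H.ann i hi _ fun a ha => ?_
  have h1 : ∑ j, (a * r j) • b j = 0 := by
    have : ∑ j, (a * r j) • b j = a • ∑ j, r j • b j := by
      rw [Finset.smul_sum]; simp only [mul_smul]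
    rw [this]
    funext l
    exact H.mulann i hi a _ ha (hr l)
  exact congrFun (h.2 _ h1) j

theorem IsB.stepS {s : ℕ} {b : Fin s → (Fin n → R)} {F F' : Submodule R (Fin n → R)} (h : IsB b F)
    {i : ℕ} (hi1 : 1 ≤ i) (hi : i ≤ m) (hF : F ≤ F' ⊔ KK n I i) :
    F ⊓ KK n I i ≤ (F' ⊓ KK n I i) ⊔ KK n I (i+1) := by
  rintro x ⟨hxF, hxK⟩
  obtain ⟨r, rfl⟩ := (h.1 x).mp hxF
  refine Submodule.sum_mem _ fun j _ => ?_
  have hr := h.coord H hi hxK j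
  obtain ⟨f, hf, κ, hκ, hfκ⟩ := Submodule.mem_sup.mp (hF (h.mem j))
  rw [← hfκ, smul_add]
  refine Submodule.add_mem_sup ⟨F'.smul_mem _ hf, H.smul_KK hr f⟩ fun l => ?_
  exact H.mul i _ _ hi1 hr (hκ l)

/-- reduction map on coordinates -/
theorem CRData.rho {i : ℕ} (hi : i < m) : ∃ (ρ : (Fin n → R) → (Fin n → K)) (θ : R), θ ∈ I i ∧
    (∀ x ∈ I i, ∃ r, x = r * θ) ∧
    (∀ x y, x ∈ KK n I i → y ∈ KK n I i → ρ (x + y) = ρ x + ρ y) ∧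
    (∀ r x, x ∈ KK n I i → ρ (r • x) = π r • ρ x) ∧
    (∀ x, x ∈ KK n I i → (ρ x = 0 ↔ x ∈ KK n I (i+1))) ∧
    (∀ r, r * θ ∈ I (i+1) → π r = 0) := by
  obtain ⟨δ, h1, h2, h3, θ, hθ, h4, h5⟩ := H.delta i hi
  refine ⟨fun x l => δ (x l), θ, hθ, h5, ?_, ?_, ?_, ?_⟩
  · intro x y hx hy; funext l; exact h1 _ _ (hx l) (hy l)
  · intro r x hx; funext l; exact h2 _ _ (hx l)
  · intro x hx
    rw [funext_iff]
    exact forall_congr' fun l => h3 _ (hx l)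
  · intro r hr
    have := (h3 _ ((I i).mul_mem_left r hθ)).mpr hr
    rw [h2 _ _ hθ, h4, mul_one] at this
    exact this

omit H in
theorem rho_sum {i : ℕ} {ρ : (Fin n → R) → (Fin n → K)}
    (h1 : ∀ x y, x ∈ KK n I i → y ∈ KK n I i → ρ (x + y) = ρ x + ρ y)
    (h2 : ∀ r x, x ∈ KK n I i → ρ (r • x) = π r • ρ x) {ι : Type*} (s : Finset ι) (x : ι → (Fin n → R))
    (hx : ∀ j, x j ∈ KK n I i) : ρ (∑ j ∈ s, x j) = ∑ j ∈ s, ρ (x j) := by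
  classical
  induction s using Finset.induction_on with
  | empty =>
    have := h2 0 0 (Submodule.zero_mem _)
    simpa using this
  | insert a s ha ih =>
    rw [Finset.sum_insert ha, Finset.sum_insert ha, h1 _ _ (hx a) (Submodule.sum_mem _ fun j _ => hx j), ih]

theorem CRData.fiber {k t : ℕ} (ht : 1 ≤ t) (htk : t < k) (hkn : 2 * k ≤ n) {i : ℕ} (hi1 : 1 ≤ i) (hi : i < m)
    (𝓖 : Finset (Submodule R (Fin n → R)))
    (hfree : ∀ F ∈ 𝓖, ∃ b : Fin k → (Fin n → R), IsB b F)
    (hint : ∀ F ∈ 𝓖, ∀ F' ∈ 𝓖, ∃ U, U ≤ F ⊓ F' ∧ ∃ u : Fin t → (Fin n → R), IsB u U)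
    (heq : ∀ F ∈ 𝓖, ∀ F' ∈ 𝓖, F ⊔ KK n I i = F' ⊔ KK n I i) [DecidableEq (Submodule R (Fin n → R))] :
    (𝓖.image (fun F => F ⊔ KK n I (i+1))).card ≤ Nat.card K ^ ((k-t)*(n-k)) := by
  classical
  rcases 𝓖.eq_empty_or_nonempty with rfl | ⟨F0, hF0⟩
  · simp
  have hle : ∀ F ∈ 𝓖, ∀ F' ∈ 𝓖, F ≤ F' ⊔ KK n I i := fun F hF F' hF' => by
    rw [← heq F hF F' hF']; exact le_sup_left
  have hS : ∀ F ∈ 𝓖, ∀ F' ∈ 𝓖, F ⊓ KK n I i ≤ (F' ⊓ KK n I i) ⊔ KK n I (i+1) := by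
    intro F hF F' hF'
    obtain ⟨b, hb⟩ := hfree F hF
    exact hb.stepS H hi1 hi.le (hle F hF F' hF')
  obtain ⟨b, hb⟩ := hfree F0 hF0
  obtain ⟨ρ, θ, hθ, hθg, r1, r2, r3, r4⟩ := H.rho (n := n) hi
  have r5 : ∀ x y, x ∈ KK n I i → y ∈ KK n I i → ρ (x - y) = ρ x - ρ y := by
    intro x y hx hy
    have := r1 (x-y) y (Submodule.sub_mem _ hx hy) hy
    rw [sub_add_cancel] at this
    rw [this]; abel
  have hθb : ∀ j, θ • b j ∈ KK n I i := fun j => H.smul_KK hθ _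
  have hli : LinearIndependent K (fun j => ρ (θ • b j)) := by
    rw [Fintype.linearIndependent_iff]
    intro c hc j
    choose r hr using fun j => H.surj (c j)
    have h1 : ρ (∑ j, (r j * θ) • b j) = 0 := by
      rw [rho_sum r1 r2 _ _ (fun j => by rw [mul_smul]; exact Submodule.smul_mem _ _ (hθb j)), ← hc]
      refine Finset.sum_congr rfl fun j _ => ?_
      rw [mul_smul, r2 _ _ (hθb j), hr]
    rw [r3 _ (Submodule.sum_mem _ fun j _ => by rw [mul_smul]; exact Submodule.smul_mem _ _ (hθb j))] at h1
    have h2 := hb.coord H (by omega : i + 1 ≤ m) h1 j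
    rw [← hr j]
    exact r4 _ h2
  set S : Submodule K (Fin n → K) := Submodule.span K (Set.range fun j => ρ (θ • b j)) with hSdef
  have hSr : finrank K S = k := by
    rw [hSdef, finrank_span_eq_card hli, Fintype.card_fin]
  have hSm : ∀ x ∈ KK n I i, ρ x ∈ S ↔ x ∈ (F0 ⊓ KK n I i) ⊔ KK n I (i+1) := by
    intro x hx
    constructor
    · intro h
      rw [hSdef, Submodule.mem_span_range_iff_exists_fun] at h
      obtain ⟨c, hc⟩ := h
      choose r hr using fun j => H.surj (c j)
      have hm : ∑ j, (r j * θ) • b j ∈ KK n I i :=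
        Submodule.sum_mem _ fun j _ => by rw [mul_smul]; exact Submodule.smul_mem _ _ (hθb j)
      have h1 : ρ (∑ j, (r j * θ) • b j) = ρ x := by
        rw [rho_sum r1 r2 _ _ (fun j => by rw [mul_smul]; exact Submodule.smul_mem _ _ (hθb j)), ← hc]
        refine Finset.sum_congr rfl fun j _ => ?_
        rw [mul_smul, r2 _ _ (hθb j), hr]
      have h2 : x - ∑ j, (r j * θ) • b j ∈ KK n I (i+1) := by
        rw [← r3 _ (Submodule.sub_mem _ hx hm), r5 _ _ hx hm, h1, sub_self]
      rw [← add_sub_cancel (∑ j, (r j * θ) • b j) x]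
      exact Submodule.add_mem_sup ⟨(hb.1 _).mpr ⟨_, rfl⟩, hm⟩ h2
    · intro h
      obtain ⟨y, ⟨hyF, hyK⟩, z, hz, rfl⟩ := Submodule.mem_sup.mp h
      have hzi := H.KK_anti (Nat.le_succ i) hz
      rw [r1 _ _ hyK hzi, (r3 z hzi).mpr hz, add_zero]
      obtain ⟨s, rfl⟩ := (hb.1 y).mp hyF
      have hs := hb.coord H hi.le hyK
      rw [rho_sum r1 r2 _ _ (fun j => H.smul_KK (hs j) _)]
      refine Submodule.sum_mem _ fun j _ => ?_
      obtain ⟨r, hr⟩ := hθg _ (hs j)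
      rw [hr, mul_smul, r2 _ _ (hθb j)]
      exact S.smul_mem _ (Submodule.subset_span ⟨j, rfl⟩)
  have hκ : ∀ F, F ∈ 𝓖 → ∃ κ : Fin k → (Fin n → R), ∀ j, κ j ∈ KK n I i ∧ b j - κ j ∈ F := by
    intro F hF
    have : ∀ j, ∃ κ, κ ∈ KK n I i ∧ b j - κ ∈ F := by
      intro j
      obtain ⟨f, hf, κ, hκ, h⟩ := Submodule.mem_sup.mp (hle F0 hF0 F hF (hb.mem j))
      exact ⟨κ, hκ, by rw [← h, add_sub_cancel_right]; exact hf⟩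
    choose κ hκ using this
    exact ⟨κ, hκ⟩
  choose! κ hκ using hκ
  let ψ : Submodule R (Fin n → R) → ((Fin k → K) →ₗ[K] ((Fin n → K) ⧸ S)) := fun F =>
    Fintype.linearCombination K (fun j => S.mkQ (ρ (κ F j)))
  have hψ : ∀ F c, ψ F c = S.mkQ (∑ j, c j • ρ (κ F j)) := by
    intro F c
    simp only [ψ, Fintype.linearCombination_apply, map_sum, map_smul]
  -- injectivity
  have hinj : ∀ F ∈ 𝓖, ∀ F' ∈ 𝓖, ψ F = ψ F' → F' ≤ F ⊔ KK n I (i+1) := by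
    intro F hF F' hF' h x hx
    have hB : (F0 ⊓ KK n I i) ⊔ KK n I (i+1) ≤ F ⊔ KK n I (i+1) :=
      sup_le ((hS F0 hF0 F hF).trans (sup_le_sup_right inf_le_left _)) le_sup_right
    have hj : ∀ j, b j - κ F' j ∈ F ⊔ KK n I (i+1) := by
      intro j
      have h1 := LinearMap.congr_fun h (Pi.single j 1)
      rw [hψ, hψ, ← sub_eq_zero, ← map_sub, Submodule.mkQ_apply, Submodule.Quotient.mk_eq_zero] at h1
      have h2 : ∀ G : Submodule R (Fin n → R), ∑ l, (Pi.single j (1:K) : Fin k → K) l • ρ (κ G l) = ρ (κ G j) := by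
        intro G
        rw [Finset.sum_eq_single j]
        · simp
        · intro l _ hl; simp [hl]
        · simp
      rw [h2, h2, ← r5 _ _ ((hκ F hF j).1) ((hκ F' hF' j).1),
        hSm _ (Submodule.sub_mem _ ((hκ F hF j).1) ((hκ F' hF' j).1))] at h1
      have h3 : b j - κ F' j = (b j - κ F j) + (κ F j - κ F' j) := by abel
      rw [h3]
      exact Submodule.add_mem _ (Submodule.mem_sup_left (hκ F hF j).2) (hB h1)
    obtain ⟨y, hy, κx, hκx, hxy⟩ := Submodule.mem_sup.mp (hle F' hF' F0 hF0 hx)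
    obtain ⟨r, rfl⟩ := (hb.1 y).mp hy
    have hz1 : x - ∑ j, r j • (b j - κ F' j) ∈ F' :=
      Submodule.sub_mem _ hx (Submodule.sum_mem _ fun j _ => Submodule.smul_mem _ _ (hκ F' hF' j).2)
    have hz2 : x - ∑ j, r j • (b j - κ F' j) ∈ KK n I i := by
      have : x - ∑ j, r j • (b j - κ F' j) = κx + ∑ j, r j • κ F' j := by
        rw [← hxy]; simp only [smul_sub, Finset.sum_sub_distrib]; abel
      rw [this]
      exact Submodule.add_mem _ hκx (Submodule.sum_mem _ fun j _ => Submodule.smul_mem _ _ (hκ F' hF' j).1)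
    have hz3 := hB (hS F' hF' F0 hF0 ⟨hz1, hz2⟩)
    rw [← add_sub_cancel (∑ j, r j • (b j - κ F' j)) x]
    exact Submodule.add_mem _ (Submodule.sum_mem _ fun j _ => Submodule.smul_mem _ _ (hj j)) hz3
  have hcard : (𝓖.image (fun F => F ⊔ KK n I (i+1))).card ≤ (𝓖.image ψ).card := by
    have : 𝓖.image (fun F => F ⊔ KK n I (i+1)) ⊆
        (𝓖.image ψ).image (fun p => if h : ∃ F ∈ 𝓖, ψ F = p then h.choose ⊔ KK n I (i+1) else ⊥) := by
      intro G hG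
      obtain ⟨F, hF, rfl⟩ := Finset.mem_image.mp hG
      refine Finset.mem_image.mpr ⟨ψ F, Finset.mem_image_of_mem _ hF, ?_⟩
      have h : ∃ F' ∈ 𝓖, ψ F' = ψ F := ⟨F, hF, rfl⟩
      rw [dif_pos h]
      have h1 := h.choose_spec
      exact le_antisymm (sup_le (hinj F hF _ h1.1 h1.2.symm) le_sup_right)
        (sup_le (hinj _ h1.1 F hF h1.2) le_sup_right)
    exact (Finset.card_le_card this).trans Finset.card_image_le
  refine hcard.trans ?_
  have hQ : finrank K ((Fin n → K) ⧸ S) = n - k := by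
    rw [Submodule.finrank_quotient, hSr, finrank_fin_fun]
  have : Finite ((Fin n → K) ⧸ S) := Module.finite_of_finite K
  refine anticode (K := K) (M := Fin k → K) (by simp) hQ ht htk.le (by omega) _ ?_
  intro f hf g hg
  obtain ⟨F, hF, rfl⟩ := Finset.mem_image.mp hf
  obtain ⟨F', hF', rfl⟩ := Finset.mem_image.mp hg
  obtain ⟨U, hU, u, hu⟩ := hint F hF F' hF'
  have hur : ∀ s, ∃ r : Fin k → R, u s - ∑ j, r j • b j ∈ KK n I i := by
    intro s
    obtain ⟨y, hy, κx, hκx, hxy⟩ := Submodule.mem_sup.mp (hle F hF F0 hF0 (hU (hu.mem s)).1)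
    obtain ⟨r, rfl⟩ := (hb.1 y).mp hy
    exact ⟨r, by rw [← hxy, add_sub_cancel_left]; exact hκx⟩
  choose r hr using hur
  have hker : ∀ G ∈ 𝓖, ∀ s, u s ∈ G → ψ G (fun j => π (r s j)) = - S.mkQ (ρ (u s - ∑ j, r s j • b j)) := by
    intro G hG s hs
    rw [hψ, eq_neg_iff_add_eq_zero, ← map_add, Submodule.mkQ_apply, Submodule.Quotient.mk_eq_zero]
    have h1 : ∑ j, π (r s j) • ρ (κ G j) = ρ (∑ j, r s j • κ G j) := by
      rw [rho_sum r1 r2 _ _ (fun j => Submodule.smul_mem _ _ (hκ G hG j).1)]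
      exact Finset.sum_congr rfl fun j _ => (r2 _ _ (hκ G hG j).1).symm
    have h2 : ∑ j, r s j • κ G j ∈ KK n I i := Submodule.sum_mem _ fun j _ => Submodule.smul_mem _ _ (hκ G hG j).1
    rw [h1, ← r1 _ _ h2 (hr s), hSm _ (Submodule.add_mem _ h2 (hr s))]
    refine hS G hG F0 hF0 ⟨?_, Submodule.add_mem _ h2 (hr s)⟩
    have h3 : ∑ j, r s j • κ G j + (u s - ∑ j, r s j • b j) = u s - ∑ j, r s j • (b j - κ G j) := by
      simp only [smul_sub, Finset.sum_sub_distrib]; abel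
    rw [h3]
    exact Submodule.sub_mem _ hs (Submodule.sum_mem _ fun j _ => Submodule.smul_mem _ _ (hκ G hG j).2)
  have hlu : LinearIndependent K (fun s => (fun j => π (r s j) : Fin k → K)) := by
    rw [Fintype.linearIndependent_iff]
    intro c hc s
    choose d hd using fun j => H.surj (c j)
    rw [← hd s, ← H.ker]
    refine hu.coord H H.pos (r := d) ?_ s
    have h1 : ∑ s, d s • u s = ∑ s, d s • (u s - ∑ j, r s j • b j) + ∑ j, (∑ s, d s * r s j) • b j := by
      simp only [smul_sub, Finset.sum_sub_distrib, Finset.smul_sum, Finset.sum_smul, mul_smul]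
      rw [Finset.sum_comm (s := (Finset.univ : Finset (Fin k)))]
      abel
    rw [h1]
    refine Submodule.add_mem _ (Submodule.sum_mem _ fun s _ => Submodule.smul_mem _ _ (H.KK_anti hi1 (hr s)))
      (Submodule.sum_mem _ fun j _ => H.smul_KK ?_ _)
    rw [H.ker, map_sum]
    have h2 := congrFun hc j
    rw [Finset.sum_apply] at h2
    rw [← Pi.zero_apply (M := fun _ => K) j, ← h2]
    refine Finset.sum_congr rfl fun s _ => ?_
    rw [map_mul, hd]; rfl
  have h1 := finrank_span_eq_card hlu
  rw [Fintype.card_fin] at h1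
  rw [← h1]
  refine Submodule.finrank_mono (Submodule.span_le.mpr ?_)
  rintro _ ⟨s, rfl⟩
  rw [SetLike.mem_coe, LinearMap.mem_ker, LinearMap.sub_apply, hker F hF s (hU (hu.mem s)).1,
    hker F' hF' s (hU (hu.mem s)).2, sub_self]

def Pr (n : ℕ) (π : R →+* K) : (Fin n → R) →ₛₗ[π] (Fin n → K) where
  toFun := fun x l => π (x l)
  map_add' := fun x y => by funext l; simp
  map_smul' := fun r x => by funext l; simp

theorem CRData.base {k t : ℕ} (ht : 1 ≤ t) (htk : t < k) (hkn : 2 * k ≤ n)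
    (𝓖 : Finset (Submodule R (Fin n → R)))
    (hfree : ∀ F ∈ 𝓖, ∃ b : Fin k → (Fin n → R), IsB b F)
    (hint : ∀ F ∈ 𝓖, ∀ F' ∈ 𝓖, ∃ U, U ≤ F ⊓ F' ∧ ∃ u : Fin t → (Fin n → R), IsB u U)
    [DecidableEq (Submodule R (Fin n → R))] :
    (𝓖.image (fun F => F ⊔ KK n I 1)).card ≤
      (∏ i ∈ Finset.range (k-t), (Nat.card K ^ (n - t - i) - 1)) /
      ∏ i ∈ Finset.range (k-t), (Nat.card K ^ (k - t - i) - 1) := by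
  classical
  haveI : RingHomSurjective π := ⟨H.surj⟩
  have hP : ∀ x, Pr n π x = 0 ↔ x ∈ KK n I 1 := by
    intro x
    rw [funext_iff]
    exact forall_congr' fun l => (H.ker _).symm
  have hdim : ∀ (s : ℕ) (U : Submodule R (Fin n → R)) (u : Fin s → (Fin n → R)), IsB u U →
      finrank K (U.map (Pr n π)) = s := by
    intro s U u hu
    have hlu : LinearIndependent K (fun s => Pr n π (u s)) := by
      rw [Fintype.linearIndependent_iff]
      intro c hc s
      choose d hd using fun j => H.surj (c j)
      rw [← hd s, ← H.ker]
      refine hu.coord H H.pos (r := d) ?_ s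
      rw [← hP, map_sum, ← hc]
      exact Finset.sum_congr rfl fun j _ => by rw [LinearMap.map_smulₛₗ, hd]
    have h1 := finrank_span_eq_card hlu
    rw [Fintype.card_fin] at h1
    have hs : U.map (Pr n π) = Submodule.span K (Set.range fun s => Pr n π (u s)) := by
      apply le_antisymm
      · rw [Submodule.map_le_iff_le_comap]
        intro x hx
        obtain ⟨r, rfl⟩ := (hu.1 x).mp hx
        refine Submodule.sum_mem _ fun j _ => Submodule.smul_mem _ _ ?_
        exact Submodule.subset_span ⟨j, rfl⟩
      · rw [Submodule.span_le]
        rintro _ ⟨j, rfl⟩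
        exact Submodule.mem_map_of_mem (hu.mem j)
    rw [hs, h1]
  have hinj : ∀ F F' : Submodule R (Fin n → R), F.map (Pr n π) = F'.map (Pr n π) → F ≤ F' ⊔ KK n I 1 := by
    intro F F' h x hx
    have h1 : Pr n π x ∈ F'.map (Pr n π) := h ▸ Submodule.mem_map_of_mem hx
    obtain ⟨y, hy, hyx⟩ := h1
    have h2 : x - y ∈ KK n I 1 := by rw [← hP, map_sub, hyx, sub_self]
    rw [← add_sub_cancel y x]
    exact Submodule.add_mem_sup hy h2
  have hcard : (𝓖.image (fun F => F ⊔ KK n I 1)).card ≤ (𝓖.image (fun F => F.map (Pr n π))).card := by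
    have : 𝓖.image (fun F => F ⊔ KK n I 1) ⊆
        (𝓖.image (fun F => F.map (Pr n π))).image (fun p => p.comap (Pr n π)) := by
      intro G hG
      obtain ⟨F, hF, rfl⟩ := Finset.mem_image.mp hG
      refine Finset.mem_image.mpr ⟨_, Finset.mem_image_of_mem _ hF, ?_⟩
      apply le_antisymm
      · intro x hx
        obtain ⟨y, hy, hyx⟩ := hx
        have h2 : x - y ∈ KK n I 1 := by rw [← hP, map_sub, hyx, sub_self]
        rw [← add_sub_cancel y x]
        exact Submodule.add_mem_sup hy h2
      · refine sup_le (Submodule.le_comap_map _ _) fun x hx => ?_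
        rw [Submodule.mem_comap, (hP x).mpr hx]
        exact Submodule.zero_mem _
    exact (Finset.card_le_card this).trans Finset.card_image_le
  refine hcard.trans ?_
  have h := ekr_field (K := K) (V := Fin n → K) ht htk (by simpa using hkn)
    (𝓖.image (fun F => F.map (Pr n π)))
    (by
      intro U hU
      obtain ⟨F, hF, rfl⟩ := Finset.mem_image.mp hU
      obtain ⟨b, hb⟩ := hfree F hF
      exact hdim k F b hb)
    (by
      intro U hU U' hU'
      obtain ⟨F, hF, rfl⟩ := Finset.mem_image.mp hU
      obtain ⟨F', hF', rfl⟩ := Finset.mem_image.mp hU'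
      obtain ⟨U, hU, u, hu⟩ := hint F hF F' hF'
      rw [← hdim t U u hu]
      exact Submodule.finrank_mono (le_inf (Submodule.map_mono (hU.trans inf_le_left))
        (Submodule.map_mono (hU.trans inf_le_right))))
  rw [finrank_fin_fun] at h
  exact h

theorem CRData.main {k t : ℕ} (ht : 1 ≤ t) (htk : t < k) (hkn : 2 * k ≤ n)
    (𝓖 : Finset (Submodule R (Fin n → R)))
    (hfree : ∀ F ∈ 𝓖, ∃ b : Fin k → (Fin n → R), IsB b F)
    (hint : ∀ F ∈ 𝓖, ∀ F' ∈ 𝓖, ∃ U, U ≤ F ⊓ F' ∧ ∃ u : Fin t → (Fin n → R), IsB u U) :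
    𝓖.card ≤ Nat.card K ^ ((m-1)*(k-t)*(n-k)) *
      ((∏ i ∈ Finset.range (k-t), (Nat.card K ^ (n - t - i) - 1)) /
      ∏ i ∈ Finset.range (k-t), (Nat.card K ^ (k - t - i) - 1)) := by
  classical
  set G := ((∏ i ∈ Finset.range (k-t), (Nat.card K ^ (n - t - i) - 1)) /
      ∏ i ∈ Finset.range (k-t), (Nat.card K ^ (k - t - i) - 1))
  have key : ∀ i, i + 1 ≤ m → (𝓖.image (fun F => F ⊔ KK n I (i+1))).card ≤
      Nat.card K ^ (i*(k-t)*(n-k)) * G := by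
    intro i
    induction i with
    | zero =>
      intro _
      simpa using H.base ht htk hkn 𝓖 hfree hint
    | succ i ih =>
      intro hi
      have h1 := Finset.card_le_mul_card_image (f := fun X => X ⊔ KK n I (i+1))
        (𝓖.image (fun F => F ⊔ KK n I (i+1+1))) (Nat.card K ^ ((k-t)*(n-k))) (by
          intro X hX
          have h2 := H.fiber ht htk hkn (i := i+1) (by omega) (by omega)
            (𝓖.filter (fun F => F ⊔ KK n I (i+1) = X))
            (fun F hF => hfree F (Finset.mem_filter.mp hF).1)
            (fun F hF F' hF' => hint F (Finset.mem_filter.mp hF).1 F' (Finset.mem_filter.mp hF').1)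
            (fun F hF F' hF' => (Finset.mem_filter.mp hF).2.trans (Finset.mem_filter.mp hF').2.symm)
          refine le_trans (Finset.card_le_card ?_) h2
          intro Y hY
          obtain ⟨hY1, hY2⟩ := Finset.mem_filter.mp hY
          obtain ⟨F, hF, rfl⟩ := Finset.mem_image.mp hY1
          refine Finset.mem_image.mpr ⟨F, Finset.mem_filter.mpr ⟨hF, ?_⟩, rfl⟩
          rw [← hY2, sup_assoc, sup_eq_right.mpr (H.KK_anti (Nat.le_succ (i+1)))])
      rw [Finset.image_image] at h1
      have h3 : ((fun X => X ⊔ KK n I (i+1)) ∘ fun F => F ⊔ KK n I (i+1+1)) = fun F => F ⊔ KK n I (i+1) := by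
        funext F
        simp only [Function.comp]
        rw [sup_assoc, sup_eq_right.mpr (H.KK_anti (Nat.le_succ (i+1)))]
      rw [h3] at h1
      refine h1.trans ((Nat.mul_le_mul_left _ (ih (by omega))).trans (le_of_eq ?_))
      rw [← mul_assoc, ← pow_add]
      congr 2
      ring
  have hm := H.pos
  have h := key (m-1) (by omega)
  rw [show m-1+1 = m by omega] at h
  have hbot : KK n I m = ⊥ := by
    rw [eq_bot_iff]
    intro x hx
    rw [Submodule.mem_bot]
    funext l
    have := hx l
    rw [H.bot] at this
    exact this
  rw [hbot] at h
  simpa using h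

end partB

end Part6

section Part7
open Module Finset
set_option linter.unusedSectionVars false
section partA
variable {R : Type*} [Ring R] [Finite R] {N : Ideal R}

theorem chain_le_N (hchain : ∀ I J : Ideal R, I ≤ J ∨ J ≤ I) (hN : N.IsMaximal) (J : Ideal R) (hJ : J ≠ ⊤) :
    J ≤ N := by
  rcases hchain J N with h | h
  · exact h
  · rw [hN.eq_of_le hJ h]

theorem chain_linv (hchain : ∀ I J : Ideal R, I ≤ J ∨ J ≤ I) (hN : N.IsMaximal) (r : R) (hr : r ∉ N) :
    ∃ s, s * r = 1 ∧ r * s = 1 := by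
  have h : Submodule.span R {r} = (⊤ : Ideal R) := by
    by_contra h
    exact hr (chain_le_N hchain hN _ h (Submodule.mem_span_singleton_self r))
  have h1 : (1 : R) ∈ Submodule.span R {r} := by rw [h]; trivial
  obtain ⟨s, hs⟩ := Submodule.mem_span_singleton.mp h1
  rw [smul_eq_mul] at hs
  exact ⟨s, hs, mul_eq_one_symm hs⟩

theorem chain_two (hchain : ∀ I J : Ideal R, I ≤ J ∨ J ≤ I) (hN : N.IsMaximal) (x r : R) (hx : x ∈ N) :
    x * r ∈ N := by
  by_contra h
  obtain ⟨s, hs, _⟩ := chain_linv hchain hN _ h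
  have h1 : r * (s * x) = 1 := mul_eq_one_symm (by rw [mul_assoc]; exact hs)
  apply hN.ne_top
  rw [Ideal.eq_top_iff_one, ← h1, ← mul_assoc]
  exact N.mul_mem_left _ hx

theorem ip_mul {i : ℕ} {a b : R} (ha : a ∈ idealPow N i) (hb : b ∈ N) : a * b ∈ idealPow N (i+1) :=
  Submodule.subset_span ⟨a, ha, b, hb, rfl⟩

theorem ip_le {i : ℕ} {J : Ideal R} (h : ∀ a ∈ idealPow N i, ∀ b ∈ N, a * b ∈ J) : idealPow N (i+1) ≤ J := by
  show Submodule.span R _ ≤ J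
  rw [Submodule.span_le]
  rintro _ ⟨a, ha, b, hb, rfl⟩
  exact h a ha b hb

/-- right colon ideal by a set -/
def colon' (J : Ideal R) (S : Set R) : Ideal R where
  carrier := {z | ∀ c ∈ S, z * c ∈ J}
  add_mem' := fun hx hy c hc => by rw [add_mul]; exact J.add_mem (hx c hc) (hy c hc)
  zero_mem' := fun c _ => by rw [zero_mul]; exact J.zero_mem
  smul_mem' := fun r x hx c hc => by
    rw [smul_eq_mul, mul_assoc]; exact J.mul_mem_left _ (hx c hc)

theorem ip_two (h2 : ∀ x r, x ∈ N → x * r ∈ N) (i : ℕ) (x r : R) (hx : x ∈ idealPow N i) :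
    x * r ∈ idealPow N i := by
  cases i with
  | zero => trivial
  | succ i =>
    have : idealPow N (i+1) ≤ colon' (idealPow N (i+1)) {r} := by
      apply ip_le
      rintro a ha b hb c rfl
      rw [mul_assoc]
      exact ip_mul ha (h2 _ _ hb)
    exact this hx r rfl

theorem ip_one : idealPow N 1 = N := by
  apply le_antisymm
  · exact ip_le fun a _ b hb => N.mul_mem_left _ hb
  · intro x hx
    rw [← one_mul x]
    exact ip_mul (i := 0) trivial hx

theorem ip_anti (h2 : ∀ x r, x ∈ N → x * r ∈ N) (i : ℕ) : idealPow N (i+1) ≤ idealPow N i :=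
  ip_le fun a ha b _ => ip_two h2 i a b ha

theorem ip_antitone (h2 : ∀ x r, x ∈ N → x * r ∈ N) : Antitone (idealPow N) :=
  antitone_nat_of_succ_le (ip_anti h2)

theorem ip_mul_ip (h2 : ∀ x r, x ∈ N → x * r ∈ N) (i j : ℕ) (x y : R) (hx : x ∈ idealPow N i)
    (hy : y ∈ idealPow N j) : x * y ∈ idealPow N (i+j) := by
  induction j generalizing x y with
  | zero => exact ip_two h2 i x y hx
  | succ j ih =>
    refine Submodule.span_induction (p := fun y _ => ∀ x ∈ idealPow N i, x * y ∈ idealPow N (i + (j+1)))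
      ?_ ?_ ?_ ?_ hy x hx
    · rintro _ ⟨a, ha, b, hb, rfl⟩ x hx
      rw [← mul_assoc]
      exact ip_mul (i := i + j) (ih x a hx ha) hb
    · intro x _; rw [mul_zero]; exact Submodule.zero_mem _
    · intro u v _ _ hu hv x hx
      rw [mul_add]; exact Submodule.add_mem _ (hu x hx) (hv x hx)
    · intro r u _ hu x hx
      rw [smul_eq_mul, ← mul_assoc]
      exact hu _ (ip_two h2 i x r hx)

theorem ip_le_of_mul (i j : ℕ) (J : Ideal R) (h : ∀ x ∈ idealPow N i, ∀ y ∈ idealPow N j, x * y ∈ J) :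
    idealPow N (i+j) ≤ J := by
  induction j generalizing J with
  | zero =>
    intro x hx
    rw [← mul_one x]
    exact h x hx 1 trivial
  | succ j ih =>
    refine ip_le (i := i + j) fun a ha b hb => ?_
    refine ih (colon' J N) ?_ ha b hb
    intro x hx y hy c hc
    rw [mul_assoc]
    exact h x hx _ (ip_mul hy hc)

theorem ip_strict (h2 : ∀ x r, x ∈ N → x * r ∈ N) {m : ℕ} (hnil : idealPow N m = ⊥)
    (hnil' : idealPow N (m - 1) ≠ ⊥) (i : ℕ) (hi : i < m) : idealPow N (i+1) ≠ idealPow N i := by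
  intro h
  have h1 : ∀ j, idealPow N i ≤ idealPow N (i + j) := by
    intro j
    induction j with
    | zero => exact le_rfl
    | succ j ih =>
      rw [← h]
      exact ip_le fun a ha b hb => ip_mul (i := i+j) (ih ha) hb
  apply hnil'
  rw [eq_bot_iff, ← hnil]
  refine (ip_antitone h2 (show i ≤ m - 1 by omega)).trans ?_
  have := h1 (m - i)
  rwa [Nat.add_sub_cancel' hi.le] at this

theorem ip_gen (hchain : ∀ I J : Ideal R, I ≤ J ∨ J ≤ I) (hN : N.IsMaximal)
    (j : ℕ) (x : R) (hx : x ∈ idealPow N j) (hx' : x ∉ idealPow N (j+1)) (y : R) (hy : y ∈ idealPow N j) :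
    ∃ r, y = r * x := by
  have h2 := chain_two hchain hN
  rcases hchain (Submodule.span R {y}) (Submodule.span R {x}) with h | h
  · obtain ⟨r, hr⟩ := Submodule.mem_span_singleton.mp (h (Submodule.mem_span_singleton_self y))
    exact ⟨r, hr.symm⟩
  · obtain ⟨r, hr⟩ := Submodule.mem_span_singleton.mp (h (Submodule.mem_span_singleton_self x))
    rw [smul_eq_mul] at hr
    have hrN : r ∉ N := by
      intro hrN
      apply hx'
      rw [← hr, add_comm j 1]
      exact ip_mul_ip h2 1 j r y (by rwa [ip_one]) hy
    obtain ⟨s, hs, _⟩ := chain_linv hchain hN r hrN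
    exact ⟨s, by rw [← hr, ← mul_assoc, hs, one_mul]⟩

theorem CRData.mk' {K : Type*} [Field K] (π : R →+* K) (hπ : Function.Surjective π) {m : ℕ}
    (hchain : ∀ I J : Ideal R, I ≤ J ∨ J ≤ I) (hN : N.IsMaximal)
    (hker : ∀ x, x ∈ N ↔ π x = 0)
    (hnil : idealPow N m = ⊥) (hnil' : idealPow N (m - 1) ≠ ⊥) : CRData π (idealPow N) m := by
  have h2 := chain_two hchain hN
  have hm : 1 ≤ m := by
    rcases m with _ | m
    · exact absurd hnil hnil'
    · omega
  refine ⟨hπ, ip_anti h2, ip_two h2, fun x => by rw [ip_one, hker], ?_, ?_, ?_, ?_, hnil, hm⟩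
  · intro i x y hi hx hy
    exact ip_antitone h2 (show i + 1 ≤ i + i by omega) (ip_mul_ip h2 i i x y hx hy)
  · intro i hi x hx
    by_contra hxi
    have hex : ∃ j, x ∉ idealPow N j := ⟨i, hxi⟩
    classical
    obtain ⟨j, hj⟩ : ∃ j, Nat.find hex = j + 1 := by
      refine Nat.exists_eq_succ_of_ne_zero fun h0 => ?_
      have := Nat.find_spec hex
      rw [h0] at this
      exact this trivial
    have hj1 : x ∉ idealPow N (j+1) := hj ▸ Nat.find_spec hex
    have hj0 : x ∈ idealPow N j := by
      by_contra h
      have := Nat.find_min' hex h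
      omega
    have hji : j + 1 ≤ i := hj ▸ Nat.find_min' hex hxi
    have h0 : idealPow N (m - i + j) ≤ ⊥ := by
      apply ip_le_of_mul
      intro a ha y hy
      obtain ⟨r, rfl⟩ := ip_gen hchain hN j x hj0 hj1 y hy
      rw [← mul_assoc, hx _ (ip_two h2 _ _ r ha)]
      exact Submodule.zero_mem _
    apply hnil'
    rw [eq_bot_iff]
    exact (ip_antitone h2 (show m - i + j ≤ m - 1 by omega)).trans h0
  · intro i hi a x ha hx
    have := ip_mul_ip h2 _ _ a x ha hx
    rw [Nat.sub_add_cancel hi, hnil] at this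
    exact this
  · intro i hi
    obtain ⟨θ, hθ, hθ'⟩ : ∃ θ ∈ idealPow N i, θ ∉ idealPow N (i+1) := by
      by_contra! h
      exact ip_strict h2 hnil hnil' i hi (le_antisymm (ip_anti h2 i) h)
    have hg := ip_gen hchain hN i θ hθ hθ'
    have hk : ∀ r, r * θ ∈ idealPow N (i+1) ↔ π r = 0 := by
      intro r
      rw [← hker]
      constructor
      · intro h
        by_contra hr
        obtain ⟨s, hs, _⟩ := chain_linv hchain hN r hr
        apply hθ'
        rw [← one_mul θ, ← hs, mul_assoc]
        exact Ideal.mul_mem_left _ _ h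
      · intro h
        rw [add_comm i 1]
        exact ip_mul_ip h2 1 i r θ (by rwa [ip_one]) hθ
    classical
    let δ : R → K := fun x => if h : x ∈ idealPow N i then π (hg x h).choose else 0
    have hδ : ∀ r, δ (r * θ) = π r := by
      intro r
      have hr : r * θ ∈ idealPow N i := Ideal.mul_mem_left _ _ hθ
      have hs := (hg _ hr).choose_spec
      simp only [δ, dif_pos hr]
      rw [← sub_eq_zero, ← map_sub, ← hk, sub_mul, ← hs, sub_self]
      exact Submodule.zero_mem _
    refine ⟨δ, ?_, ?_, ?_, θ, hθ, ?_, hg⟩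
    · intro x y hx hy
      obtain ⟨r, rfl⟩ := hg x hx
      obtain ⟨s, rfl⟩ := hg y hy
      rw [← add_mul, hδ, hδ, hδ, map_add]
    · intro s x hx
      obtain ⟨r, rfl⟩ := hg x hx
      rw [← mul_assoc, hδ, hδ, map_mul]
    · intro x hx
      obtain ⟨r, rfl⟩ := hg x hx
      rw [hδ, hk]
    · have := hδ 1
      rwa [one_mul, map_one] at this

theorem exists_field.{u} {R : Type u} [Ring R] [Finite R] {N : Ideal R} (hchain : ∀ I J : Ideal R, I ≤ J ∨ J ≤ I) (hN : N.IsMaximal) :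
    ∃ (K : Type u) (_ : Field K) (_ : Finite K) (π : R →+* K), Function.Surjective π ∧
      (∀ x, x ∈ N ↔ π x = 0) ∧ Nat.card K = Nat.card (R ⧸ N) := by
  haveI : N.IsTwoSided := ⟨fun {a} b ha => chain_two hchain hN a b ha⟩
  haveI : Finite (R ⧸ N) := Quotient.finite _
  have hf : ∀ x, x ∈ N ↔ Ideal.Quotient.mk N x = 0 := fun x => Ideal.Quotient.eq_zero_iff_mem.symm
  haveI : Nontrivial (R ⧸ N) := Ideal.Quotient.nontrivial_iff.mpr hN.ne_top
  haveI : NoZeroDivisors (R ⧸ N) := by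
    constructor
    intro a b hab
    obtain ⟨a, rfl⟩ := Ideal.Quotient.mk_surjective a
    obtain ⟨b, rfl⟩ := Ideal.Quotient.mk_surjective b
    rw [← map_mul, ← hf] at hab
    rw [← hf, ← hf]
    by_contra! h
    obtain ⟨s, hs, _⟩ := chain_linv hchain hN a h.1
    apply h.2
    rw [← one_mul b, ← hs, mul_assoc]
    exact Ideal.mul_mem_left _ _ hab
  haveI : IsDomain (R ⧸ N) := NoZeroDivisors.to_isDomain _
  have hF := Finite.isDomain_to_isField (R ⧸ N)
  letI := hF.toField
  exact ⟨R ⧸ N, hF.toField, inferInstance, Ideal.Quotient.mk N, Ideal.Quotient.mk_surjective, hf, rfl⟩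

end partA

end Part7

/-- **Erdős–Ko–Rado bound for Hjelmslev subspaces.** Let `R` be a finite chain ring of
length `m` with maximal ideal `N` and residue field `F_q`, and let `1 ≤ t < k ≤ n/2`.
If `𝓕` is a family of free rank-`k` submodules of `R^n` such that any two members of `𝓕`
contain a common free rank-`t` submodule, then
`|𝓕| ≤ q^{(m-1)(k-t)(n-k)} · [n-t choose k-t]_q`. -/
theorem ekr_hjelmslev_bound (q m t k n : ℕ) {R : Type*} [Ring R] [Fintype R]
    (hchain : ∀ I J : Ideal R, I ≤ J ∨ J ≤ I)
    (N : Ideal R) (hN : N.IsMaximal)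
    (hnil : idealPow N m = ⊥) (hnil' : idealPow N (m - 1) ≠ ⊥)
    (hq : Nat.card (R ⧸ N) = q) (hq' : IsPrimePow q)
    (ht : 1 ≤ t) (htk : t < k) (hkn : 2 * k ≤ n)
    (𝓕 : Finset (Submodule R (Fin n → R)))
    (hfree : ∀ F ∈ 𝓕, Nonempty (F ≃ₗ[R] (Fin k → R)))
    (hint : ∀ F ∈ 𝓕, ∀ F' ∈ 𝓕, ∃ U : Submodule R (Fin n → R),
      U ≤ F ⊓ F' ∧ Nonempty (U ≃ₗ[R] (Fin t → R))) :
    𝓕.card ≤ q ^ ((m - 1) * (k - t) * (n - k)) * gaussBinom q (n - t) (k - t) := by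
  obtain ⟨K, _, _, π, hπ, hker, hcard⟩ := exists_field hchain hN
  have H := CRData.mk' π hπ hchain hN hker hnil hnil'
  have h := H.main ht htk hkn 𝓕 (fun F hF => IsB.exists (hfree F hF))
    (fun F hF F' hF' => by
      obtain ⟨U, hU, hU'⟩ := hint F hF F' hF'
      exact ⟨U, hU, IsB.exists hU'⟩)
  rw [hcard, hq] at h
  exact h
end
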